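/- arXiv:1809.05666 — 8 statements merged into one kernel-verified Lean document; each statement's English description precedes it below -/
import Mathlib

section
/- Let p be a prime, P an H-cyclic p-group with centre Z, |P/Z| = p^{2r}, and ζ : Z → ℂ^× a faithful character. Then there exists, up to isomorphism, a unique irreducible complex representation τ of P whose restriction to Z contains ζ. Moreover τ is faithful, dim τ = p^r, and the restriction of τ to Z is isomorphic to the direct sum of p^r copies of ζ. -/
open CategoryTheory

namespace CentralChar

variable {P : Type} [Group P]

/-- The centre of `P` acts on `V` through the character `ζ`. -/
def HasCentralChar (ζ : Subgroup.center P →* ℂˣ) (V : FDRep ℂ P) : Prop :=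
  ∀ (z : Subgroup.center P) (v : V), V.ρ (z : P) v = (ζ z : ℂ) • v

/-- The functions on `P` transforming by `ζ` under translation by the centre. -/
def equivariantFunctions (ζ : Subgroup.center P →* ℂˣ) : Submodule ℂ (P → ℂ) where
  carrier := {f | ∀ (z : Subgroup.center P) (x : P), f (z * x) = (ζ z : ℂ) * f x}
  add_mem' hf hg z x := by simp [hf z x, hg z x, mul_add]
  zero_mem' z x := by simp
  smul_mem' c f hf z x := by simp [hf z x, mul_left_comm]

/-- The representation of `P` by right translation on `equivariantFunctions ζ`, that is,
the representation induced from `ζ`. -/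
def rightTranslation (ζ : Subgroup.center P →* ℂˣ) :
    Representation ℂ P (equivariantFunctions ζ) where
  toFun g :=
    { toFun f := ⟨fun x => f.1 (x * g), fun z x => by
        simpa only [mul_assoc] using f.2 z (x * g)⟩
      map_add' _ _ := rfl
      map_smul' _ _ := rfl }
  map_one' := by ext; simp
  map_mul' g h := by ext; simp [mul_assoc]

theorem exists_hasCentralChar [Fintype P] (ζ : Subgroup.center P →* ℂˣ) :
    ∃ V : FDRep ℂ P, HasCentralChar ζ V ∧ 0 < Module.finrank ℂ V := by
  classical
  refine ⟨FDRep.of (rightTranslation ζ), fun z f => ?_, ?_⟩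
  · refine Subtype.ext (funext fun x => ?_)
    change f.1 (x * z) = (ζ z : ℂ) * f.1 x
    rw [← f.2 z x, (Subgroup.mem_center_iff.mp z.2 x)]
  · let f : equivariantFunctions ζ :=
      ⟨fun x => if h : x ∈ Subgroup.center P then (ζ ⟨x, h⟩ : ℂ) else 0, fun z x => by
        by_cases h : x ∈ Subgroup.center P
        · have hzx : (z : P) * x ∈ Subgroup.center P := mul_mem z.2 h
          have : (⟨z * x, hzx⟩ : Subgroup.center P) = z * ⟨x, h⟩ := rfl
          simp [h, hzx, this]
        · have hzx : (z : P) * x ∉ Subgroup.center P :=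
            fun H => h (((Subgroup.center P).mul_mem_cancel_left z.2).mp H)
          simp [h, hzx]⟩
    have hf : f ≠ 0 := fun h => by
      have h1 : f.1 1 = 0 := by rw [h]; rfl
      simp [f, one_mem] at h1
    have : Nontrivial (equivariantFunctions ζ) := ⟨f, 0, hf⟩
    exact Module.finrank_pos (R := ℂ) (M := equivariantFunctions ζ)

theorem hom_comm {V W : FDRep ℂ P} (f : V ⟶ W) (g : P) (v : V) :
    f.hom (V.ρ g v) = W.ρ g (f.hom v) :=
  ConcreteCategory.congr_hom (f.comm g) v

theorem hom_injective_of_mono {V W : FDRep ℂ P} (f : V ⟶ W) [Mono f] :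
    Function.Injective f.hom := by
  have : Mono f.hom := inferInstanceAs (Mono ((Action.forget _ _).map f))
  exact (ModuleCat.mono_iff_injective ((forget₂ (FGModuleCat ℂ) (ModuleCat ℂ)).map f.hom)).mp
    inferInstance

/-- A representation of minimal positive dimension with a given central character is simple. -/
theorem exists_simple_hasCentralChar [Fintype P] (ζ : Subgroup.center P →* ℂˣ) :
    ∃ V : FDRep ℂ P, HasCentralChar ζ V ∧ Simple V := by
  classical
  have hex : ∃ n, ∃ V : FDRep ℂ P, HasCentralChar ζ V ∧ 0 < Module.finrank ℂ V ∧
      Module.finrank ℂ V = n := by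
    obtain ⟨V, h, h'⟩ := exists_hasCentralChar ζ
    exact ⟨_, V, h, h', rfl⟩
  obtain ⟨V, hV, hpos, hn⟩ := Nat.find_spec hex
  refine ⟨V, hV, ⟨fun {W} f _ => ⟨fun hf h0 => ?_, fun hf => ?_⟩⟩⟩
  · subst h0
    have : Nontrivial V := Module.nontrivial_of_finrank_pos hpos
    obtain ⟨v, hv⟩ := exists_ne (0 : V)
    obtain ⟨w, hw⟩ := ((ConcreteCategory.isIso_iff_bijective (0 : W ⟶ V)).mp hf).2 v
    exact hv hw.symm
  · have hinj := hom_injective_of_mono f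
    let F : W →ₗ[ℂ] V := f.hom.hom.hom
    have hW : HasCentralChar ζ W := fun z w => hinj <| by
      rw [hom_comm, hV]
      exact (F.map_smul _ w).symm
    have hWpos : 0 < Module.finrank ℂ W := by
      by_contra! h0
      have : Subsingleton W := Module.finrank_zero_iff.mp (Nat.le_zero.mp h0)
      refine hf (Action.Hom.ext (ConcreteCategory.hom_ext _ _ fun w => ?_))
      rw [Subsingleton.elim w 0]
      exact F.map_zero
    have hle : Module.finrank ℂ V ≤ Module.finrank ℂ W :=
      hn ▸ Nat.find_min' hex ⟨W, hW, hWpos, rfl⟩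
    have hfin := le_antisymm (LinearMap.finrank_le_finrank_of_injective (f := F) hinj) hle
    exact (ConcreteCategory.isIso_iff_bijective f).mpr
      ⟨hinj, (LinearMap.injective_iff_surjective_of_finrank_eq_finrank hfin).mp hinj⟩

theorem hasCentralChar_of_simple {ζ : Subgroup.center P →* ℂˣ} (V : FDRep ℂ P)
    [Simple V]
    (h : ∃ v : V, v ≠ 0 ∧ ∀ z : Subgroup.center P, V.ρ (z : P) v = (ζ z : ℂ) • v) :
    HasCentralChar ζ V := by
  obtain ⟨v, hv, hz⟩ := h
  intro z w
  let f : V ⟶ V := ⟨Action.ρ V (z : P), fun g => by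
    have : Commute (z : P) g := (Subgroup.mem_center_iff.mp z.2 g).symm
    exact (this.map (Action.ρ V)).eq⟩
  obtain ⟨c, hc⟩ := (finrank_eq_one_iff_of_nonzero' (𝟙 V) (id_nonzero V)).mp
    (finrank_endomorphism_simple_eq_one ℂ V) f
  have key (u : V) : V.ρ (z : P) u = c • u := by
    have := congrArg (fun k : V ⟶ V => k.hom u) hc
    exact this.symm
  have : c = ζ z := smul_left_injective ℂ hv ((key v).symm.trans (hz z))
  rw [key, this]

section Character

variable {ζ : Subgroup.center P →* ℂˣ} {V : FDRep ℂ P}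

theorem HasCentralChar.character_center (h : HasCentralChar ζ V) (z : Subgroup.center P) :
    V.character (z : P) = ζ z * Module.finrank ℂ V := by
  have : V.ρ (z : P) = (ζ z : ℂ) • LinearMap.id := LinearMap.ext (h z)
  rw [FDRep.character, this, map_smul, LinearMap.trace_id, smul_eq_mul]

theorem HasCentralChar.character_of_notMem (h : HasCentralChar ζ V)
    (habel : ∀ x y : P ⧸ Subgroup.center P, Commute x y) (hζ : Function.Injective ζ)
    {x : P} (hx : x ∉ Subgroup.center P) : V.character x = 0 := by
  obtain ⟨y, hy⟩ : ∃ y, y * x ≠ x * y := by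
    by_contra! H
    exact hx (Subgroup.mem_center_iff.mpr H)
  have hmem : y * x * y⁻¹ * x⁻¹ ∈ Subgroup.center P := by
    rw [← QuotientGroup.eq_one_iff]
    change (y : P ⧸ Subgroup.center P) * x * (y : P ⧸ Subgroup.center P)⁻¹ *
      (x : P ⧸ Subgroup.center P)⁻¹ = 1
    rw [(habel y x).eq, mul_inv_cancel_right, mul_inv_cancel]
  have hne : (⟨_, hmem⟩ : Subgroup.center P) ≠ 1 := fun H => hy <| by
    have := congrArg Subtype.val H
    simpa [mul_inv_eq_iff_eq_mul] using this
  have hρ : V.ρ (y * x * y⁻¹) = (ζ ⟨_, hmem⟩ : ℂ) • V.ρ x := by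
    ext v
    have := h ⟨_, hmem⟩ (V.ρ x v)
    rw [← Module.End.mul_apply, ← map_mul, inv_mul_cancel_right] at this
    exact this
  have hc : V.character x = ζ ⟨_, hmem⟩ * V.character x := by
    conv_lhs => rw [← FDRep.char_conj V x y]
    rw [FDRep.character, hρ, map_smul, smul_eq_mul]
    rfl
  by_contra h0
  refine hne (hζ ?_)
  rw [map_one]
  exact Units.ext (mul_right_cancel₀ h0 (by rw [← hc]; simp))

theorem HasCentralChar.sum_character_mul [Fintype P] {W : FDRep ℂ P} (h : HasCentralChar ζ V)
    (hW : HasCentralChar ζ W)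
    (habel : ∀ x y : P ⧸ Subgroup.center P, Commute x y) (hζ : Function.Injective ζ) :
    ∑ g : P, V.character g * W.character g⁻¹ =
      Nat.card (Subgroup.center P) * (Module.finrank ℂ V * Module.finrank ℂ W) := by
  classical
  rw [← Finset.sum_subset (Finset.subset_univ (Finset.univ.filter (· ∈ Subgroup.center P)))
    fun x _ hx => by
      rw [h.character_of_notMem habel hζ (by simpa using hx), zero_mul]]
  rw [Finset.sum_congr rfl (g := fun _ => (Module.finrank ℂ V * Module.finrank ℂ W : ℂ))]
  · rw [Finset.sum_const, nsmul_eq_mul, Nat.card_eq_fintype_card, Fintype.card_subtype]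
  · intro x hx
    let z : Subgroup.center P := ⟨x, by simpa using hx⟩
    have h1 := h.character_center z
    have h2 := hW.character_center z⁻¹
    rw [map_inv] at h2
    change V.character z * W.character ((z⁻¹ : Subgroup.center P) : P) = _
    rw [h1, h2, mul_mul_mul_comm, Units.mul_inv, one_mul]

end Character

end CentralChar

open CentralChar in
/-- existence and uniqueness of the irreducible representation of
an H-cyclic `p`-group containing a given faithful central character. -/
theorem stmt_1 (p r : ℕ) (hp : p.Prime) (P : Type) [Group P] [Fintype P]
    (hP : IsPGroup p P)
    (hZcyc : IsCyclic (Subgroup.center P))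
    (hZne : Subgroup.center P ≠ ⊤)
    (helem : ∀ x : P ⧸ Subgroup.center P, x ^ p = 1)
    (habel : ∀ x y : P ⧸ Subgroup.center P, Commute x y)
    (hr : 1 ≤ r)
    (hcard : Nat.card (P ⧸ Subgroup.center P) = p ^ (2 * r))
    (ζ : Subgroup.center P →* ℂˣ) (hζ : Function.Injective ζ) :
    ∃ τ : FDRep ℂ P,
      -- τ is irreducible and its restriction to the centre contains ζ
      Simple τ ∧
      (∃ v : τ, v ≠ 0 ∧ ∀ z : Subgroup.center P, τ.ρ (z : P) v = (ζ z : ℂ) • v) ∧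
      -- τ is faithful
      Function.Injective τ.ρ ∧
      -- dim τ = p ^ r
      Module.finrank ℂ τ = p ^ r ∧
      -- the restriction of τ to the centre is a multiple (p ^ r copies) of ζ
      (∀ (z : Subgroup.center P) (v : τ), τ.ρ (z : P) v = (ζ z : ℂ) • v) ∧
      -- uniqueness up to isomorphism
      (∀ τ' : FDRep ℂ P, Simple τ' →
        (∃ v : τ', v ≠ 0 ∧ ∀ z : Subgroup.center P, τ'.ρ (z : P) v = (ζ z : ℂ) • v) →
        Nonempty (τ ≅ τ')) := by
  have hinv := invertibleOfNonzero (NeZero.ne (Nat.card P : ℂ))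
  have hcardP : Nat.card P = p ^ (2 * r) * Nat.card (Subgroup.center P) := by
    rw [← hcard, ← Subgroup.card_eq_card_quotient_mul_card_subgroup]
  have hdim (V : FDRep ℂ P) (hs : Simple V) (hV : HasCentralChar ζ V) :
      Module.finrank ℂ V = p ^ r := by
    have h1 := (FDRep.simple_iff_char_is_norm_one V).mp hs
    rw [hV.sum_character_mul hV habel hζ, hcardP] at h1
    have hZ : 0 < Nat.card (Subgroup.center P) := Nat.card_pos
    norm_cast at h1
    rw [mul_comm (p ^ (2 * r))] at h1
    have h2 := Nat.eq_of_mul_eq_mul_left hZ h1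
    rw [← pow_two, mul_comm 2 r, pow_mul] at h2
    exact Nat.pow_left_injective two_ne_zero h2
  obtain ⟨τ, hτ, hs⟩ := exists_simple_hasCentralChar ζ
  have hd := hdim τ hs hτ
  have hpos : 0 < p ^ r := pow_pos hp.pos r
  have : Nontrivial τ := Module.nontrivial_of_finrank_pos (R := ℂ) (hd ▸ hpos)
  obtain ⟨v, hv⟩ := exists_ne (0 : τ)
  refine ⟨τ, hs, ⟨v, hv, fun z => hτ z v⟩, ?_, hd, hτ, fun τ' hs' h' => ?_⟩
  · refine (injective_iff_map_eq_one τ.ρ).mpr fun g hg => ?_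
    have hmem : g ∈ Subgroup.center P := by
      by_contra hg'
      have h0 := hτ.character_of_notMem habel hζ hg'
      rw [FDRep.character, hg, LinearMap.trace_one, hd] at h0
      exact hpos.ne' (by exact_mod_cast h0)
    have h1 := hτ ⟨g, hmem⟩ v
    rw [hg] at h1
    have h2 : (ζ ⟨g, hmem⟩ : ℂ) = 1 :=
      smul_left_injective ℂ hv (h1.symm.trans (one_smul ℂ v).symm)
    exact congrArg Subtype.val (hζ ((Units.ext h2).trans (map_one ζ).symm))
  · have hτ' := hasCentralChar_of_simple τ' h'
    by_contra hne
    have h1 := FDRep.char_orthonormal τ τ'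
    rw [if_neg hne, hτ.sum_character_mul hτ' habel hζ, hd, hdim τ' hs' hτ'] at h1
    have hZ : 0 < Nat.card (Subgroup.center P) := Nat.card_pos
    have hp0 : p ≠ 0 := hp.ne_zero
    simp [hZ.ne', hp0] at h1
end

section
/- Let p be a prime, P an H-cyclic p-group with centre Z, and ζ : Z → ℂ^× a faithful character. Let S be a cyclic group of automorphisms of P whose order is not divisible by p and which acts trivially on Z. Let G = S ⋉ P be the semidirect product and τ the unique irreducible complex representation of P whose restriction to Z contains ζ. Then: (1) there exists a unique (up to isomorphism) representation τ̃ of G such that the restriction of τ̃ to P is isomorphic to τ and det τ̃(s) = 1 for all s ∈ S; (2) an irreducible representation ρ of G satisfies ρ|_P ≅ τ if and only if there is a one-dimensional character χ of S = G/P with ρ ≅ χ ⊗ τ̃. -/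
open CategoryTheory SemidirectProduct

namespace FDRep

/-- The isomorphism of finite-dimensional representations given by an equivariant linear
equivalence. -/
noncomputable def isoOfLinearEquiv {k : Type*} [Field k] {G : Type*} [Monoid G]
    {V W : FDRep k G} (e : V ≃ₗ[k] W) (he : ∀ g v, e (V.ρ g v) = W.ρ g (e v)) : V ≅ W :=
  Action.mkIso (LinearEquiv.toFGModuleCatIso e) fun g => by
    ext v
    exact he g v

theorem isIrreducible_of_simple {k : Type*} [Field k] {G : Type*} [Monoid G]
    (V : FDRep k G) [Simple V] : Representation.IsIrreducible V.ρ := by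
  have key (W : Subrepresentation V.ρ) : W = ⊥ ∨ W = ⊤ := by
    let i : FDRep.of W.toRepresentation ⟶ V :=
      ⟨ConcreteCategory.ofHom W.toSubmodule.subtype, fun g => by ext v; rfl⟩
    have : Mono i := by
      refine (Action.forget _ G).mono_of_mono_map ?_
      exact ConcreteCategory.mono_of_injective _ Subtype.val_injective
    by_cases hi : i = 0
    · left
      refine Subrepresentation.toSubmodule_injective <| (Submodule.eq_bot_iff _).2 fun v hv => ?_
      exact congrArg (fun f : FDRep.of W.toRepresentation ⟶ V => f.hom.hom.hom ⟨v, hv⟩) hi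
    · right
      have : IsIso i := isIso_of_mono_of_nonzero hi
      refine Subrepresentation.toSubmodule_injective <| (Submodule.eq_top_iff').2 fun v => ?_
      have h := congrArg (fun f : V ⟶ V => f.hom.hom.hom v) (IsIso.inv_hom_id i)
      exact (show _ = v from h) ▸ ((inv i).hom.hom.hom v).2
  have hne : (⊥ : Subrepresentation V.ρ) ≠ ⊤ := fun h => id_nonzero V <| by
    ext v
    have : v ∈ (⊤ : Subrepresentation V.ρ) := Submodule.mem_top (R := k)
    rw [← h] at this
    exact (Submodule.mem_bot k).1 this
  exact { exists_pair_ne := ⟨_, _, hne⟩, eq_bot_or_eq_top := key }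

end FDRep

namespace Representation

section Field

variable {k G H V : Type*} [Field k] [AddCommGroup V] [Module k V]

theorem IsIrreducible.nontrivial [Monoid G] (ρ : Representation k G V) [IsIrreducible ρ] :
    Nontrivial V := by
  by_contra h
  rw [not_nontrivial_iff_subsingleton] at h
  exact bot_ne_top (α := Subrepresentation ρ)
    (Subrepresentation.toSubmodule_injective (Subsingleton.elim _ _))

theorem IsIrreducible.comp_of_surjective [Monoid G] [Monoid H] (ρ : Representation k G V)
    [IsIrreducible ρ] {f : H →* G} (hf : Function.Surjective f) :
    IsIrreducible (ρ.comp f : Representation k H V) where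
  exists_pair_ne := by
    have := IsIrreducible.nontrivial ρ
    exact ⟨⊥, ⊤, fun h => bot_ne_top (α := Submodule k V)
      (congrArg Subrepresentation.toSubmodule h)⟩
  eq_bot_or_eq_top W := by
    let W' : Subrepresentation ρ := ⟨W.toSubmodule, fun g v hv => by
      obtain ⟨h, rfl⟩ := hf g
      exact W.apply_mem_toSubmodule h hv⟩
    exact (eq_bot_or_eq_top W').imp
      (fun h => Subrepresentation.toSubmodule_injective
        (congrArg (fun U : Subrepresentation ρ => U.toSubmodule) h :))
      (fun h => Subrepresentation.toSubmodule_injective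
        (congrArg (fun U : Subrepresentation ρ => U.toSubmodule) h :))

/-- **Schur's lemma**: a linear map commuting with an irreducible representation is a scalar. -/
theorem IsIrreducible.exists_eq_smul_one [Monoid G] [IsAlgClosed k] [FiniteDimensional k V]
    (ρ : Representation k G V) [IsIrreducible ρ] (f : Module.End k V)
    (hf : ∀ g v, f (ρ g v) = ρ g (f v)) : ∃ c : k, f = c • 1 := by
  let F : IntertwiningMap ρ ρ := LinearMap.intertwiningMap_of_isIntertwiningMap ρ ρ f hf
  obtain ⟨c, hc⟩ := (IsIrreducible.algebraMap_intertwiningMap_bijective_of_isAlgClosed (ρ := ρ)).2 F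
  refine ⟨c, LinearMap.ext fun v => ?_⟩
  exact (congrArg (fun T : IntertwiningMap ρ ρ => T v) hc).symm

end Field

/-- The scalar automorphisms of a module. -/
abbrev scalarUnits (k V : Type*) [Field k] [AddCommGroup V] [Module k V] :
    kˣ →* (Module.End k V)ˣ :=
  Units.map (algebraMap k (Module.End k V)).toMonoidHom

section Scalar

variable {k V : Type*} [Field k] [AddCommGroup V] [Module k V]

theorem scalarUnits_injective [Nontrivial V] : Function.Injective (scalarUnits k V) :=
  Units.map_injective (algebraMap k (Module.End k V)).injective

theorem scalarUnits_commute (c : kˣ) (A : (Module.End k V)ˣ) : Commute (scalarUnits k V c) A :=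
  Units.ext (Algebra.commutes (c : k) (A : Module.End k V))

theorem det_scalarUnits (c : kˣ) :
    Units.map LinearMap.det (scalarUnits k V c) = c ^ Module.finrank k V := by
  ext
  simp [Algebra.algebraMap_eq_smul_one, LinearMap.det_smul]

/-- An automorphism whose `m`-th power is scalar can be rescaled to have trivial `m`-th power and
determinant one, if `m` is prime to the dimension. -/
theorem exists_scalarUnits_mul_pow_eq_one [IsAlgClosed k] {m : ℕ} (hm : 0 < m)
    (hcop : (Module.finrank k V).Coprime m) (A : (Module.End k V)ˣ) {c : kˣ}
    (hA : A ^ m = scalarUnits k V c) :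
    ∃ a : kˣ, (scalarUnits k V a * A) ^ m = 1 ∧
      Units.map LinearMap.det (scalarUnits k V a * A) = 1 := by
  obtain ⟨a₀, ha₀⟩ := IsAlgClosed.exists_pow_nat_eq ((c⁻¹ : kˣ) : k) hm
  obtain ⟨a, rfl⟩ : IsUnit a₀ := (isUnit_pow_iff hm.ne').1 (ha₀ ▸ Units.isUnit _)
  have ha : a ^ m = c⁻¹ := Units.ext (by simpa using ha₀)
  set B := scalarUnits k V a * A with hB
  have hBm : B ^ m = 1 := by
    rw [hB, (scalarUnits_commute a A).mul_pow, hA, ← map_pow, ← map_mul, ha, inv_mul_cancel,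
      map_one]
  set d : kˣ := Units.map LinearMap.det B with hd
  have hdm : d ^ m = 1 := by rw [hd, ← map_pow, hBm, map_one]
  obtain ⟨j, hj⟩ := exists_pow_eq_self_of_coprime
    (hcop.coprime_dvd_right (orderOf_dvd_of_pow_eq_one hdm))
  refine ⟨(d ^ j)⁻¹ * a, ?_, ?_⟩
  · rw [map_mul, mul_assoc, (scalarUnits_commute _ _).mul_pow, hBm, ← map_pow, inv_pow, ← pow_mul,
      mul_comm j, pow_mul, hdm, one_pow, inv_one, map_one, one_mul]
  · rw [map_mul (scalarUnits k V), mul_assoc, ← hB, map_mul, det_scalarUnits, ← hd, inv_pow, ← pow_mul, mul_comm j,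
      pow_mul, hj, inv_mul_cancel]

end Scalar

section Extension

variable {k N S V : Type*} [Field k] [IsAlgClosed k] [Group N] [Group S] {φ : S →* MulAut N}
  [AddCommGroup V] [Module k V] [FiniteDimensional k V]
  (ρ : Representation k N V) [IsIrreducible ρ]

/-- **Schur's lemma** for automorphisms. -/
theorem IsIrreducible.exists_eq_scalarUnits (A : (Module.End k V)ˣ)
    (hA : ∀ g, Commute A (ρ.toHomUnits g)) : ∃ c : kˣ, A = scalarUnits k V c := by
  have := IsIrreducible.nontrivial ρ
  obtain ⟨c, hc⟩ := IsIrreducible.exists_eq_smul_one ρ A fun g v =>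
    congrArg (fun T : (Module.End k V)ˣ => (T : Module.End k V) v) (hA g)
  have hc0 : c ≠ 0 := by
    rintro rfl
    exact A.ne_zero (by simp at hc)
  exact ⟨Units.mk0 c hc0, Units.ext (by simpa [Algebra.algebraMap_eq_smul_one] using hc)⟩

/-- An irreducible representation of `N` that is isomorphic to all its twists by a cyclic group
`S` of automorphisms, whose order is prime to the dimension, extends to `N ⋊ S` with `S` acting
with determinant one. -/
theorem IsIrreducible.exists_extension [Finite S] [IsCyclic S]
    (hcop : (Module.finrank k V).Coprime (Nat.card S))
    (htwist : ∀ s : S, ∃ A : (Module.End k V)ˣ, ∀ g,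
      ρ.toHomUnits (φ s g) = A * ρ.toHomUnits g * A⁻¹) :
    ∃ σ : Representation k (N ⋊[φ] S) V,
      (∀ g, σ (inl g) = ρ g) ∧ ∀ s, LinearMap.det (σ (inr s)) = 1 := by
  obtain ⟨t, ht⟩ := IsCyclic.exists_generator (α := S)
  obtain ⟨A, hA⟩ := htwist t
  have hpow (j : ℕ) (g : N) :
      ρ.toHomUnits (φ (t ^ j) g) = A ^ j * ρ.toHomUnits g * (A ^ j)⁻¹ := by
    induction j generalizing g with
    | zero => simp
    | succ j ih => rw [pow_succ, map_mul, MulAut.mul_apply, ih, hA, pow_succ]; group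
  have hAm : ∃ c, A ^ Nat.card S = scalarUnits k V c := by
    refine IsIrreducible.exists_eq_scalarUnits ρ _ fun g => ?_
    have h := hpow (Nat.card S) g
    rw [pow_card_eq_one', map_one, MulAut.one_apply, eq_mul_inv_iff_mul_eq] at h
    exact h.symm
  obtain ⟨c, hc⟩ := hAm
  obtain ⟨a, hBm, hBdet⟩ := exists_scalarUnits_mul_pow_eq_one Nat.card_pos hcop A hc
  set B := scalarUnits k V a * A with hB
  have hBt (g : N) : ρ.toHomUnits (φ t g) = B * ρ.toHomUnits g * B⁻¹ := by
    have h := (scalarUnits_commute a (A * ρ.toHomUnits g * A⁻¹)).eq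
    rw [hA, ← mul_inv_eq_iff_eq_mul.2 h, hB]
    group
  have hdvd : orderOf B ∣ orderOf t := by
    rw [orderOf_eq_card_of_forall_mem_zpowers ht]
    exact orderOf_dvd_of_pow_eq_one hBm
  let f : S →* (Module.End k V)ˣ := monoidHomOfForallMemZpowers ht hdvd
  have hft : f t = B := monoidHomOfForallMemZpowers_apply_gen ht hdvd
  have hf (s : S) : (∀ g, ρ.toHomUnits (φ s g) = f s * ρ.toHomUnits g * (f s)⁻¹) ∧
      Units.map LinearMap.det (f s) = 1 := by
    obtain ⟨j, rfl⟩ := (mem_powers_iff_mem_zpowers).2 (ht s)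
    dsimp only
    induction j with
    | zero => simp
    | succ j ih =>
      refine ⟨fun g => ?_, ?_⟩
      · rw [pow_succ, map_mul, MulAut.mul_apply, ih.1, hBt, map_mul, hft]; group
      · rw [pow_succ, map_mul, map_mul, ih.2, hft, hBdet, one_mul]
  let F : N ⋊[φ] S →* (Module.End k V)ˣ := lift ρ.toHomUnits f fun s => by
    ext1 g
    exact (hf s).1 g
  refine ⟨(Units.coeHom _).comp F, fun g => ?_, fun s => ?_⟩
  · simp [F]
  · simpa [F] using congrArg Units.val (hf s).2

/-- Two extensions to `N ⋊ S` of an irreducible representation of `N` differ by a character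
of `S`. -/
theorem IsIrreducible.exists_character (σ σ' : Representation k (N ⋊[φ] S) V)
    (hσ : ∀ g, σ (inl g) = ρ g) (hσ' : ∀ g, σ' (inl g) = ρ g) :
    ∃ χ : S →* kˣ, ∀ g, σ' g = (χ (rightHom g) : k) • σ g := by
  have := IsIrreducible.nontrivial ρ
  have hN (g) : σ.toHomUnits (inl g) = ρ.toHomUnits g := Units.ext (hσ g)
  have hN' (g) : σ'.toHomUnits (inl g) = ρ.toHomUnits g := Units.ext (hσ' g)
  have hconj (s : S) (g : N) :
      σ'.toHomUnits (inr s) * ρ.toHomUnits g * (σ'.toHomUnits (inr s))⁻¹ =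
        σ.toHomUnits (inr s) * ρ.toHomUnits g * (σ.toHomUnits (inr s))⁻¹ := by
    trans ρ.toHomUnits (φ s g)
    · rw [← hN', ← hN', inl_aut, map_mul, map_mul, map_inv, map_inv]
    · rw [← hN, ← hN, inl_aut, map_mul, map_mul, map_inv, map_inv]
  have hex (s : S) : ∃ c : kˣ,
      (σ.toHomUnits (inr s))⁻¹ * σ'.toHomUnits (inr s) = scalarUnits k V c := by
    refine IsIrreducible.exists_eq_scalarUnits ρ _ fun g => ?_
    have h := hconj s g
    rw [mul_inv_eq_iff_eq_mul] at h
    simp only [commute_iff_eq, mul_assoc, h]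
    group
  choose c hc using hex
  have hc' (s) : σ'.toHomUnits (inr s) = scalarUnits k V (c s) * σ.toHomUnits (inr s) := by
    rw [(scalarUnits_commute _ _).eq, ← hc, mul_inv_cancel_left]
  refine ⟨MonoidHom.mk' c fun s t => scalarUnits_injective (V := V) ?_, fun g => ?_⟩
  · rw [← hc, map_mul, map_mul, map_mul, hc' s, hc' t, map_mul, mul_inv_rev,
      (scalarUnits_commute (c s) _).eq, mul_assoc, mul_assoc, inv_mul_cancel_left,
      ← mul_assoc (scalarUnits k V (c s)), ← map_mul, (scalarUnits_commute _ _).eq,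
      inv_mul_cancel_left]
  · have h : σ'.toHomUnits g = scalarUnits k V (c g.right) * σ.toHomUnits g := by
      rw [← inl_left_mul_inr_right g, map_mul, map_mul, hN, hN', hc', ← mul_assoc, ← mul_assoc,
        (scalarUnits_commute _ _).eq]
      simp
    simpa [Algebra.algebraMap_eq_smul_one] using congrArg Units.val h

/-- Two representations of `N ⋊ S` whose restrictions to `N` are isomorphic to the same irreducible
representation differ by a character of `S`. -/
theorem IsIrreducible.exists_character_of_equiv {W W' : Type*} [AddCommGroup W] [Module k W]
    [AddCommGroup W'] [Module k W'] (σ : Representation k (N ⋊[φ] S) W)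
    (σ' : Representation k (N ⋊[φ] S) W') (e : W ≃ₗ[k] V) (e' : W' ≃ₗ[k] V)
    (he : ∀ g w, e (σ (inl g) w) = ρ g (e w)) (he' : ∀ g w, e' (σ' (inl g) w) = ρ g (e' w)) :
    ∃ χ : S →* kˣ, ∀ g w,
      (e'.trans e.symm) (σ' g w) = (χ (rightHom g) : k) • σ g ((e'.trans e.symm) w) := by
  obtain ⟨χ, hχ⟩ := IsIrreducible.exists_character ρ
    (e.conjRingEquiv.toMonoidHom.comp σ) (e'.conjRingEquiv.toMonoidHom.comp σ')
    (fun g => by ext v; simp [he])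
    (fun g => by ext v; simp [he'])
  refine ⟨χ, fun g w => e.injective ?_⟩
  simpa using congrArg (fun T => T (e' w)) (hχ g)

end Extension

section Center

variable {P V : Type*} [Group P] [AddCommGroup V] [Module ℂ V] [FiniteDimensional ℂ V]
  (ρ : Representation ℂ P V)

theorem IsIrreducible.apply_center [IsIrreducible ρ] {ζ : Subgroup.center P →* ℂˣ}
    (hζ : ∃ v : V, v ≠ 0 ∧ ∀ z : Subgroup.center P, ρ z v = (ζ z : ℂ) • v)
    (z : Subgroup.center P) : ρ z = (ζ z : ℂ) • 1 := by
  obtain ⟨v, hv, hvz⟩ := hζ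
  obtain ⟨c, hc⟩ := IsIrreducible.exists_eq_smul_one ρ (ρ z) fun g w => by
    rw [← Module.End.mul_apply, ← Module.End.mul_apply, ← map_mul, ← map_mul,
      Subgroup.mem_center_iff.1 z.2 g]
  have h := hvz z
  rw [hc, LinearMap.smul_apply, Module.End.one_apply] at h
  rw [hc, smul_left_injective ℂ hv h]

variable {ρ} {ζ : Subgroup.center P →* ℂˣ} (hρ : ∀ z : Subgroup.center P, ρ z = (ζ z : ℂ) • 1)

include hρ

omit [FiniteDimensional ℂ V] in
theorem character_mul_of_center (z : Subgroup.center P) (g : P) :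
    ρ.character (z * g) = ζ z * ρ.character g := by
  simp [character, hρ]

theorem character_of_center (z : Subgroup.center P) :
    ρ.character z = ζ z * Module.finrank ℂ V := by
  simpa using character_mul_of_center hρ z 1

variable (hζ : Function.Injective ζ) (habel : ∀ x y : P ⧸ Subgroup.center P, Commute x y)

include hζ habel

omit [FiniteDimensional ℂ V] in
theorem character_eq_zero_of_notMem_center {g : P} (hg : g ∉ Subgroup.center P) :
    ρ.character g = 0 := by
  rw [Subgroup.mem_center_iff] at hg
  push Not at hg
  obtain ⟨h, hh⟩ := hg
  have hz : h * g * h⁻¹ * g⁻¹ ∈ Subgroup.center P := by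
    rw [← QuotientGroup.eq_one_iff]
    simp only [QuotientGroup.mk_mul, QuotientGroup.mk_inv, (habel h g).eq]
    group
  have hchar := character_mul_of_center hρ ⟨_, hz⟩ g
  rw [inv_mul_cancel_right, char_conj] at hchar
  by_contra h0
  have h1 : ζ ⟨_, hz⟩ = 1 := Units.ext (mul_right_cancel₀ h0 (by simpa using hchar.symm))
  have h2 := hζ (h1.trans (map_one ζ).symm)
  rw [Subtype.ext_iff, Subgroup.coe_one, mul_inv_eq_one, mul_inv_eq_iff_eq_mul] at h2
  exact hh h2

theorem card_center_mul_finrank_sq [Finite P] [IsIrreducible ρ] :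
    Nat.card (Subgroup.center P) * Module.finrank ℂ V ^ 2 = Nat.card P := by
  classical
  have := Fintype.ofFinite P
  have : Invertible (Nat.card P : ℂ) := invertibleOfNonzero (by simp)
  have hsum := char_orthonormal ρ ρ
  rw [if_pos ⟨Equiv.refl ρ⟩, inv_mul_eq_one₀ (by simp)] at hsum
  have hterm (g : P) : ρ.character g * ρ.character g⁻¹ =
      if g ∈ Subgroup.center P then (Module.finrank ℂ V : ℂ) ^ 2 else 0 := by
    split_ifs with hg
    · have h := character_of_center hρ ⟨g, hg⟩
      have h' := character_of_center hρ (⟨g, hg⟩⁻¹)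
      rw [Subgroup.coe_inv] at h'
      rw [h, h', map_inv, mul_mul_mul_comm, Units.mul_inv, one_mul, sq]
    · rw [character_eq_zero_of_notMem_center hρ hζ habel hg, zero_mul]
  simp only [hterm, Finset.sum_ite, Finset.sum_const_zero, Finset.sum_const, add_zero,
    nsmul_eq_mul] at hsum
  rw [← Fintype.card_subtype, ← Nat.card_eq_fintype_card] at hsum
  exact_mod_cast hsum.symm

theorem exists_conj_of_fix_center [Finite P] [IsIrreducible ρ] (φ : MulAut P)
    (hφ : ∀ z ∈ Subgroup.center P, φ z = z) :
    ∃ A : (Module.End ℂ V)ˣ, ∀ g, ρ.toHomUnits (φ g) = A * ρ.toHomUnits g * A⁻¹ := by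
  classical
  have := Fintype.ofFinite P
  have : Invertible (Nat.card P : ℂ) := invertibleOfNonzero (by simp)
  let ρ' : Representation ℂ P V := ρ.comp φ.toMonoidHom
  have : IsIrreducible ρ' := IsIrreducible.comp_of_surjective ρ φ.surjective
  have hmem (g : P) : φ g ∈ Subgroup.center P ↔ g ∈ Subgroup.center P := by
    refine ⟨fun h => ?_, fun h => (hφ g h).symm ▸ h⟩
    rwa [← φ.injective (hφ _ h)]
  have hchar (g : P) : ρ'.character g = ρ.character g := by
    change ρ.character (φ g) = _
    by_cases hg : g ∈ Subgroup.center P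
    · rw [hφ g hg]
    · rw [character_eq_zero_of_notMem_center hρ hζ habel hg,
        character_eq_zero_of_notMem_center hρ hζ habel ((hmem g).not.2 hg)]
  have hne : Nonempty (Equiv ρ ρ') := by
    by_contra hne
    have h' := char_orthonormal ρ' ρ
    have h := char_orthonormal ρ ρ
    rw [if_neg hne] at h'
    rw [if_pos ⟨Equiv.refl ρ⟩] at h
    simp only [hchar] at h'
    exact one_ne_zero (h.symm.trans h')
  obtain ⟨e⟩ := hne
  refine ⟨(LinearMap.GeneralLinearGroup.generalLinearEquiv ℂ V).symm e.toLinearEquiv,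
    fun g => ?_⟩
  rw [eq_mul_inv_iff_mul_eq]
  ext v
  exact (congrArg (fun T : V →ₗ[ℂ] V => T v) (e.isIntertwining' g)).symm

end Center

end Representation

open CategoryTheory SemidirectProduct

/-- extensions to `G = S ⋉ P` of the irreducible representation of an
H-cyclic `p`-group `P` containing a faithful central character. -/
theorem stmt_4 (p : ℕ) (hp : p.Prime) (P : Type) [Group P] [Fintype P]
    (hP : IsPGroup p P)
    (hZcyc : IsCyclic (Subgroup.center P))
    (hZne : Subgroup.center P ≠ ⊤)
    (helem : ∀ x : P ⧸ Subgroup.center P, x ^ p = 1)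
    (habel : ∀ x y : P ⧸ Subgroup.center P, Commute x y)
    (ζ : Subgroup.center P →* ℂˣ) (hζ : Function.Injective ζ)
    -- S is a cyclic group of automorphisms of P, of order prime to p,
    -- acting trivially on the centre
    (S : Subgroup (MulAut P)) (hScyc : IsCyclic S)
    (hSord : ¬ p ∣ Nat.card S)
    (hSZ : ∀ s : S, ∀ z ∈ Subgroup.center P, (s : MulAut P) z = z)
    -- τ is the unique irreducible representation of P containing ζ
    (τ : FDRep ℂ P) (hτirr : Simple τ)
    (hτζ : ∃ v : τ, v ≠ 0 ∧ ∀ z : Subgroup.center P, τ.ρ (z : P) v = (ζ z : ℂ) • v) :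
    ∃ τext : FDRep ℂ (P ⋊[S.subtype] S),
      -- (1) τext restricts to τ on P and has det trivial on S ...
      (∃ e : τext ≃ₗ[ℂ] τ, ∀ (g : P) (v : τext), e (τext.ρ (inl g) v) = τ.ρ g (e v)) ∧
      (∀ s : S, LinearMap.det (τext.ρ (inr s)) = 1) ∧
      -- ... and is the unique such representation, up to isomorphism
      (∀ τext' : FDRep ℂ (P ⋊[S.subtype] S),
        (∃ e : τext' ≃ₗ[ℂ] τ, ∀ (g : P) (v : τext'), e (τext'.ρ (inl g) v) = τ.ρ g (e v)) →
        (∀ s : S, LinearMap.det (τext'.ρ (inr s)) = 1) →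
        Nonempty (τext ≅ τext')) ∧
      -- (2) an irreducible representation ρ of G restricts to τ on P iff it is a
      -- twist of τext by a character of S = G/P
      (∀ ρ : FDRep ℂ (P ⋊[S.subtype] S), Simple ρ →
        ((∃ e : ρ ≃ₗ[ℂ] τ, ∀ (g : P) (v : ρ), e (ρ.ρ (inl g) v) = τ.ρ g (e v)) ↔
          (∃ (χ : S →* ℂˣ) (e : ρ ≃ₗ[ℂ] τext),
            ∀ (g : P ⋊[S.subtype] S) (v : ρ),
              e (ρ.ρ g v) = (χ (rightHom g) : ℂ) • τext.ρ g (e v)))) := by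
  have hirr : Representation.IsIrreducible τ.ρ := FDRep.isIrreducible_of_simple τ
  have hρ := Representation.IsIrreducible.apply_center τ.ρ hτζ
  have hcop : (Module.finrank ℂ τ).Coprime (Nat.card S) := by
    have := Fact.mk hp
    obtain ⟨n, hn⟩ := IsPGroup.iff_card.1 hP
    have hdvd : Module.finrank ℂ τ ∣ p ^ n := by
      rw [← hn, ← Representation.card_center_mul_finrank_sq hρ hζ habel]
      exact (dvd_pow_self _ two_ne_zero).mul_left _
    exact (((hp.coprime_iff_not_dvd).2 hSord).pow_left n).coprime_dvd_left hdvd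
  obtain ⟨σ, hσ, hdet⟩ := Representation.IsIrreducible.exists_extension τ.ρ
    (φ := S.subtype) hcop fun s =>
      Representation.exists_conj_of_fix_center hρ hζ habel s (hSZ s)
  have hσe (g : P) (v : τ) : LinearEquiv.refl ℂ τ (σ (inl g) v) = τ.ρ g v := by
    rw [hσ]
    rfl
  refine ⟨FDRep.of σ, ⟨LinearEquiv.refl ℂ τ, hσe⟩, hdet, ?_, fun ρ _ => ⟨?_, ?_⟩⟩
  · rintro τ' ⟨e', he'⟩ hdet'
    obtain ⟨χ, hχ⟩ := Representation.IsIrreducible.exists_character_of_equiv τ.ρ σ τ'.ρ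
      (LinearEquiv.refl ℂ τ) e' hσe he'
    have hχ1 (s : S) : χ s = 1 := by
      have hm : χ s ^ Nat.card S = 1 := by rw [← map_pow, pow_card_eq_one', map_one]
      have hn : χ s ^ Module.finrank ℂ τ = 1 := by
        have h : LinearMap.det ((χ s : ℂ) • σ (inr s)) = 1 := by
          rw [← hdet' s, ← LinearMap.det_conj (τ'.ρ (inr s)) e']
          congr 1
          ext v
          simpa using (hχ (inr s) (e'.symm v)).symm
        rw [LinearMap.det_smul, hdet, mul_one] at h
        exact Units.ext (by simpa using h)
      exact orderOf_eq_one_iff.1 (Nat.eq_one_of_dvd_coprimes hcop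
        (orderOf_dvd_of_pow_eq_one hn) (orderOf_dvd_of_pow_eq_one hm))
    refine ⟨(FDRep.isoOfLinearEquiv (V := τ') (W := FDRep.of σ) e' fun g v => ?_).symm⟩
    simpa [hχ1] using hχ g v
  · rintro ⟨e, he⟩
    obtain ⟨χ, hχ⟩ := Representation.IsIrreducible.exists_character_of_equiv τ.ρ σ ρ.ρ
      (LinearEquiv.refl ℂ τ) e hσe he
    exact ⟨χ, e, hχ⟩
  · rintro ⟨χ, e, he⟩
    refine ⟨e, fun g v => ?_⟩
    rw [he, rightHom_inl, map_one, Units.val_one, one_smul]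
    exact hσe g (e v)
end

section
/- Let p be a prime, P an H-cyclic p-group with centre Z and |P/Z| = p^{2r}, ζ : Z → ℂ^× a faithful character, S a cyclic group of automorphisms of P of order prime to p acting trivially on Z, G = S ⋉ P, and τ̃ the unique extension to G of the irreducible representation τ of P containing ζ with det τ̃(s) = 1 for all s ∈ S. Suppose that for every s ∈ S with s ≠ 1, the centralizer of s in G equals SZ. Then there is a constant ε ∈ {+1, −1} and a character μ of S with μ² = 1 such that: (1) tr τ̃(sz) = ε μ(s) ζ(z) for all s ∈ S, s ≠ 1, and all z ∈ Z; (2) p^r − ε = k|S| for an integer k; (3) the restriction to S of the character of τ̃ equals k·R_S + ε·μ, where R_S is the character of the regular representation of S (R_S(1) = |S| and R_S(s) = 0 for s ≠ 1); (4) μ is non-trivial if and only if |S| is even and k is odd. -/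
open scoped Classical

open CategoryTheory SemidirectProduct

/-- An integer-valued function on a finite commutative group whose autocorrelation is constant off
the identity and one larger at the identity is constant up to a change by `±1` at one point. -/
theorem exists_eq_add_ite_of_autocorrelation {R : Type*} [CommGroup R] [Fintype R] (a : R → ℤ)
    (h : ∀ y ≠ 1, ∑ x, a x * a (x * y) + 1 = ∑ x, a x * a x) :
    ∃ (ε k : ℤ) (x₀ : R), (ε = 1 ∨ ε = -1) ∧ ∀ x, a x = k + if x = x₀ then ε else 0 := by
  obtain ⟨m, hm⟩ := Finite.exists_min a
  have hsq : ∀ y ≠ 1, ∑ x, (a x - a (x * y)) ^ 2 = 2 := by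
    intro y hy
    have h1 : ∑ x, a (x * y) * a (x * y) = ∑ x, a x * a x :=
      Equiv.sum_comp (Equiv.mulRight y) fun x ↦ a x * a x
    have h2 : ∑ x, (a x - a (x * y)) ^ 2 =
        ∑ x, a x * a x + ∑ x, a (x * y) * a (x * y) - 2 * ∑ x, a x * a (x * y) := by
      rw [Finset.mul_sum, ← Finset.sum_add_distrib, ← Finset.sum_sub_distrib]
      exact Finset.sum_congr rfl fun x _ ↦ by ring
    linarith [h y hy]
  have hle : ∀ x, a x = a m ∨ a x = a m + 1 := by
    intro x
    by_cases hx : x = m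
    · exact .inl (by rw [hx])
    have h1 : (a m - a x) ^ 2 ≤ 2 := by
      rw [← hsq (m⁻¹ * x) (by rwa [Ne, inv_mul_eq_one, eq_comm])]
      have := Finset.single_le_sum (f := fun z ↦ (a z - a (z * (m⁻¹ * x))) ^ 2)
        (fun z _ ↦ sq_nonneg _) (Finset.mem_univ m)
      simpa using this
    have h2 := hm x
    have h3 : a x - a m < 2 := by nlinarith
    omega
  set A : Finset R := {x | a x = a m + 1} with hA
  have ha : ∀ x, a x = a m + if x ∈ A then 1 else 0 := by
    intro x
    have := hle x
    by_cases hx : a x = a m + 1 <;> simp [hA, hx]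
    omega
  set b : R → ℤ := fun x ↦ if x ∈ A then 1 else 0 with hb
  have hbb : ∀ x, b x * b x = b x := fun x ↦ by by_cases hx : x ∈ A <;> simp [hb, hx]
  have hB : ∑ x, b x = A.card := by simp [hb]
  have hsh : ∀ y, ∑ x, b (x * y) = A.card := fun y ↦ by
    rw [← hB]; exact Equiv.sum_comp (Equiv.mulRight y) b
  have hcor : ∀ y, ∑ x, b x * b (x * y) = (A.card : ℤ) - 1 + if y = 1 then 1 else 0 := by
    intro y
    split_ifs with hy
    · simp [hy, hbb, hB]
    have h1 : ∑ x, (a x - a (x * y)) ^ 2 =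
        ∑ x, b x + ∑ x, b (x * y) - 2 * ∑ x, b x * b (x * y) := by
      rw [Finset.mul_sum, ← Finset.sum_add_distrib, ← Finset.sum_sub_distrib]
      refine Finset.sum_congr rfl fun x _ ↦ ?_
      have h2 : a x - a (x * y) = b x - b (x * y) := by rw [ha x, ha (x * y)]; ring
      rw [h2]
      linear_combination hbb x + hbb (x * y)
    rw [hsq y hy, hB, hsh] at h1
    linarith
  have htot : (A.card : ℤ) * A.card = Fintype.card R * ((A.card : ℤ) - 1) + 1 := by
    have h1 : ∑ y, ∑ x, b x * b (x * y) = (A.card : ℤ) * A.card := by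
      rw [Finset.sum_comm]
      simp_rw [← Finset.mul_sum]
      have (x : R) : ∑ y, b (x * y) = A.card := by
        rw [← hB]; exact Equiv.sum_comp (Equiv.mulLeft x) b
      simp_rw [this, ← Finset.sum_mul, hB]
    rw [← h1]
    simp_rw [hcor]
    rw [Finset.sum_add_distrib]
    simp [mul_sub]
  have hor : A.card = 1 ∨ Aᶜ.card = 1 := by
    rw [Finset.card_compl]
    have hAR := A.card_le_univ
    zify [hAR]
    have : ((A.card : ℤ) - 1) * (Fintype.card R - A.card - 1) = 0 := by linarith
    rcases mul_eq_zero.mp this with h | h <;> omega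
  rcases hor with hc | hc <;> obtain ⟨x₀, hx₀⟩ := Finset.card_eq_one.mp hc
  · refine ⟨1, a m, x₀, .inl rfl, fun x ↦ ?_⟩
    rw [ha x, hx₀]
    simp
  · refine ⟨-1, a m + 1, x₀, .inr rfl, fun x ↦ ?_⟩
    have : x ∈ A ↔ x ≠ x₀ := by
      rw [Ne, ← Finset.mem_singleton, ← hx₀, Finset.mem_compl, not_not]
    rw [ha x]
    simp only [this]
    by_cases hx : x = x₀ <;> simp [hx]

/-- An endomorphism of finite order dividing `n` is diagonalisable with eigenvalues `n`-th roots of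
unity: the traces of its powers and its determinant in terms of multiplicities. -/
theorem exists_multiplicity_of_pow_eq_one {V : Type*} [AddCommGroup V] [Module ℂ V]
    [FiniteDimensional ℂ V] (n : ℕ) [NeZero n]
    [Fintype (rootsOfUnity n ℂ)] (T : Module.End ℂ V) (hT : T ^ n = 1) :
    ∃ a : rootsOfUnity n ℂ → ℕ,
      (∀ i : ℕ, LinearMap.trace ℂ V (T ^ i) = ∑ x : rootsOfUnity n ℂ, (a x : ℂ) * ((x : ℂˣ) : ℂ) ^ i) ∧
      LinearMap.det T = ∏ x : rootsOfUnity n ℂ, ((x : ℂˣ) : ℂ) ^ a x := by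
  have hspan : ⊤ ≤ Submodule.span ℂ {v : V | ∃ x : rootsOfUnity n ℂ, T v = ((x : ℂˣ) : ℂ) • v} := by
    have hss : T.IsSemisimple := by
      refine Module.End.isSemisimple_of_squarefree_aeval_eq_zero
        (p := (Polynomial.X ^ n - Polynomial.C 1 : Polynomial ℂ)) ?_ (by simp [hT])
      exact (Polynomial.separable_X_pow_sub_C (1 : ℂ) (by simp [NeZero.ne n])
        one_ne_zero).squarefree
    rw [← T.iSup_maxGenEigenspace_eq_top]
    refine iSup_le fun μ v hv ↦ ?_
    rw [hss.isFinitelySemisimple.maxGenEigenspace_eq_eigenspace,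
      Module.End.mem_eigenspace_iff] at hv
    by_cases hv0 : v = 0
    · simp [hv0]
    have hpow : ∀ i : ℕ, (T ^ i) v = μ ^ i • v := by
      intro i
      induction i with
      | zero => simp
      | succ i ih => rw [pow_succ', Module.End.mul_apply, ih, map_smul, hv, smul_smul, pow_succ]
    have hμ : μ ^ n = 1 := by
      have := hpow n
      rw [hT, Module.End.one_apply] at this
      have h2 : (μ ^ n - 1) • v = 0 := by rw [sub_smul, ← this, one_smul, sub_self]
      exact sub_eq_zero.mp ((smul_eq_zero.mp h2).resolve_right hv0)
    exact Submodule.subset_span ⟨rootsOfUnity.mkOfPowEq μ hμ, by simpa using hv⟩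
  set b := Module.Basis.ofSpan hspan with hb
  have : Fintype ((linearIndepOn_empty ℂ (id : V → V)).extend (Set.empty_subset _)) :=
    FiniteDimensional.fintypeBasisIndex b
  have hbe : ∀ j, ∃ x : rootsOfUnity n ℂ, T (b j) = ((x : ℂˣ) : ℂ) • b j := fun j ↦
    Module.Basis.ofSpan_subset hspan ⟨j, rfl⟩
  choose e he using hbe
  have hmat : ∀ i : ℕ, LinearMap.toMatrix b b (T ^ i) =
      Matrix.diagonal fun j ↦ (((e j : ℂˣ) : ℂ)) ^ i := by
    intro i
    have h1 : LinearMap.toMatrix b b T = Matrix.diagonal fun j ↦ (((e j : ℂˣ) : ℂ)) := by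
      ext j k
      rw [LinearMap.toMatrix_apply, he k]
      by_cases hjk : j = k
      · simp [hjk]
      · simp [Matrix.diagonal_apply_ne _ hjk, Ne.symm hjk]
    rw [← LinearMap.toMatrix_pow, h1, Matrix.diagonal_pow]
    rfl
  refine ⟨fun x ↦ (Finset.univ.filter fun j ↦ e j = x).card, fun i ↦ ?_, ?_⟩
  · rw [LinearMap.trace_eq_matrix_trace ℂ b, hmat i, Matrix.trace_diagonal,
      ← Finset.sum_fiberwise _ e]
    refine Finset.sum_congr rfl fun x _ ↦ ?_
    rw [← nsmul_eq_mul, ← Finset.sum_const]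
    refine Finset.sum_congr rfl fun j hj ↦ ?_
    rw [(Finset.mem_filter.mp hj).2]
  · have h1 := hmat 1
    rw [pow_one] at h1
    rw [← LinearMap.det_toMatrix b, h1, Matrix.det_diagonal,
      ← Finset.prod_fiberwise _ e]
    refine Finset.prod_congr rfl fun x _ ↦ ?_
    rw [← Finset.prod_const]
    refine Finset.prod_congr rfl fun j hj ↦ ?_
    rw [(Finset.mem_filter.mp hj).2, pow_one]

/-- The geometric sum of an `n`-th root of unity. -/
theorem sum_range_pow_rootsOfUnity (n : ℕ) (x : rootsOfUnity n ℂ) :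
    ∑ i ∈ Finset.range n, ((x : ℂˣ) : ℂ) ^ i = if x = 1 then (n : ℂ) else 0 := by
  split_ifs with hx
  · simp [hx]
  · have h1 : ((x : ℂˣ) : ℂ) ≠ 1 := by simpa using hx
    have h2 : ((x : ℂˣ) : ℂ) ^ n = 1 := by
      rw [← Units.val_pow_eq_pow_val, (mem_rootsOfUnity n _).mp x.2, Units.val_one]
    rw [geom_sum_eq h1, h2]
    simp

/-- The power sums of the `n`-th roots of unity. -/
theorem sum_pow_rootsOfUnity (n : ℕ) [NeZero n] [Fintype (rootsOfUnity n ℂ)] (i : ℕ) :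
    ∑ x : rootsOfUnity n ℂ, ((x : ℂˣ) : ℂ) ^ i = if n ∣ i then (n : ℂ) else 0 := by
  have hprim := Complex.isPrimitiveRoot_exp n (NeZero.ne n)
  let f : rootsOfUnity n ℂ →* ℂ :=
    ((powMonoidHom i).comp (Units.coeHom ℂ)).comp (rootsOfUnity n ℂ).subtype
  have hf : f = 1 ↔ n ∣ i := by
    refine ⟨fun h ↦ ?_, fun ⟨j, hj⟩ ↦ ?_⟩
    · have := DFunLike.congr_fun h hprim.toRootsOfUnity
      rw [← hprim.pow_eq_one_iff_dvd]
      simpa [f] using this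
    · ext x
      have h2 : ((x : ℂˣ) : ℂ) ^ n = 1 := by
        rw [← Units.val_pow_eq_pow_val, (mem_rootsOfUnity n _).mp x.2, Units.val_one]
      simp [f, hj, pow_mul, h2]
  have hcard : Fintype.card (rootsOfUnity n ℂ) = n := by
    rw [← Nat.card_eq_fintype_card, hprim.card_rootsOfUnity]
  have := sum_hom_units f
  simpa [f, hf, hcard] using this

/-- The product of the `n`-th roots of unity. -/
theorem prod_rootsOfUnity (n : ℕ) [NeZero n] [Fintype (rootsOfUnity n ℂ)] :
    ∏ x : rootsOfUnity n ℂ, ((x : ℂˣ) : ℂ) = (-1) ^ (n - 1) := by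
  have hprim := Complex.isPrimitiveRoot_exp n (NeZero.ne n)
  have hn : 0 < n := NeZero.pos n
  have h1 : ∏ x : rootsOfUnity n ℂ, ((x : ℂˣ) : ℂ) =
      ∏ z ∈ Polynomial.nthRootsFinset n (1 : ℂ), z := by
    refine Finset.prod_bij (fun x _ ↦ ((x : ℂˣ) : ℂ)) (fun x _ ↦ ?_) (fun x _ y _ h ↦ ?_)
      (fun z hz ↦ ?_) (fun _ _ ↦ rfl)
    · rw [Polynomial.mem_nthRootsFinset hn, ← Units.val_pow_eq_pow_val,
        (mem_rootsOfUnity n _).mp x.2, Units.val_one]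
    · exact Subtype.ext (Units.ext h)
    · rw [Polynomial.mem_nthRootsFinset hn] at hz
      exact ⟨rootsOfUnity.mkOfPowEq z hz, Finset.mem_univ _, by simp⟩
  have h2 := congrArg (Polynomial.eval 0) (Polynomial.X_pow_sub_one_eq_prod hn hprim)
  have hcard : (Polynomial.nthRootsFinset n (1 : ℂ)).card = n := hprim.card_nthRootsFinset
  rw [Polynomial.eval_prod] at h2
  simp only [Polynomial.eval_sub, Polynomial.eval_pow, Polynomial.eval_X, Polynomial.eval_one,
    Polynomial.eval_C, zero_sub, zero_pow hn.ne'] at h2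
  rw [Finset.prod_neg, hcard] at h2
  rw [h1]
  obtain ⟨m, rfl⟩ := Nat.exists_eq_add_of_le' hn
  rw [Nat.add_sub_cancel]
  have h3 : ((-1 : ℂ) ^ m) * (-1) ^ m = 1 := by rw [← mul_pow]; simp
  linear_combination (-1) ^ m * h2 - h3 * (∏ z ∈ Polynomial.nthRootsFinset (m + 1) (1 : ℂ), z)

/-- An endomorphism `T` with `T ^ n = 1` such that `tr T ^ i * tr T ^ (-i) = 1` whenever `T ^ i` is
a non-trivial power has all `n`-th roots of unity as eigenvalues with the same multiplicity `k`,
except for one root of unity whose multiplicity is `k + ε`. -/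
theorem exists_trace_pow_eq_of_trace_mul_trace_eq_one {V : Type*} [AddCommGroup V] [Module ℂ V]
    [FiniteDimensional ℂ V] (n : ℕ) [NeZero n] (T : Module.End ℂ V) (hT : T ^ n = 1)
    (htr : ∀ i : ℕ, ¬ n ∣ i →
      LinearMap.trace ℂ V (T ^ i) * LinearMap.trace ℂ V (T ^ ((n - 1) * i)) = 1) :
    ∃ (ε k : ℤ) (x₀ : rootsOfUnity n ℂ), (ε = 1 ∨ ε = -1) ∧
      (∀ i : ℕ, LinearMap.trace ℂ V (T ^ i) =
        k * (if n ∣ i then (n : ℂ) else 0) + ε * ((x₀ : ℂˣ) : ℂ) ^ i) ∧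
      LinearMap.det T = ((-1) ^ (n - 1)) ^ k * ((x₀ : ℂˣ) : ℂ) ^ ε := by
  have := Fintype.ofFinite (rootsOfUnity n ℂ)
  obtain ⟨a, ha, hdet⟩ := exists_multiplicity_of_pow_eq_one n T hT
  have hn : 0 < n := NeZero.pos n
  have hinv : ∀ x : rootsOfUnity n ℂ, ((x : ℂˣ) : ℂ) ^ (n - 1) = (((x⁻¹ : _) : ℂˣ) : ℂ) := by
    intro x
    have : x ^ (n - 1) = x⁻¹ := by
      rw [eq_inv_iff_mul_eq_one, ← pow_succ, Nat.sub_add_cancel hn]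
      exact Subtype.ext ((mem_rootsOfUnity n _).mp x.2)
    rw [← this]
    simp
  have key : ∀ y : rootsOfUnity n ℂ, (n : ℂ) * ∑ x, (a x : ℂ) * a (x * y) =
      (∑ x, (a x : ℂ)) ^ 2 - 1 + if y = 1 then (n : ℂ) else 0 := by
    intro y
    have h1 : ∑ i ∈ Finset.range n, LinearMap.trace ℂ V (T ^ i) *
        LinearMap.trace ℂ V (T ^ ((n - 1) * i)) * ((y : ℂˣ) : ℂ) ^ i =
        (n : ℂ) * ∑ x, (a x : ℂ) * a (x * y) := by
      have h2 : ∀ i : ℕ, LinearMap.trace ℂ V (T ^ i) *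
          LinearMap.trace ℂ V (T ^ ((n - 1) * i)) * ((y : ℂˣ) : ℂ) ^ i =
          ∑ x, ∑ w, (a x : ℂ) * a w * (((x * w⁻¹ * y : rootsOfUnity n ℂ) : ℂˣ) : ℂ) ^ i := by
        intro i
        rw [ha, ha, Finset.sum_mul_sum, Finset.sum_mul]
        refine Finset.sum_congr rfl fun x _ ↦ ?_
        rw [Finset.sum_mul]
        refine Finset.sum_congr rfl fun w _ ↦ ?_
        rw [pow_mul, hinv]
        push_cast
        ring
      simp_rw [h2]
      rw [Finset.sum_comm, Finset.mul_sum]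
      refine Finset.sum_congr rfl fun x _ ↦ ?_
      rw [Finset.sum_comm]
      simp_rw [← Finset.mul_sum, sum_range_pow_rootsOfUnity]
      rw [Finset.sum_eq_single (x * y)]
      · rw [if_pos (by rw [mul_right_comm, mul_inv_cancel])]
        ring
      · intro w _ hw
        rw [if_neg, mul_zero]
        intro h
        apply hw
        rw [mul_right_comm, mul_inv_eq_one] at h
        exact h.symm
      · simp
    rw [← h1, ← sum_range_pow_rootsOfUnity n y]
    obtain ⟨m, rfl⟩ := Nat.exists_eq_add_of_le' hn
    rw [Finset.sum_range_succ', Finset.sum_range_succ']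
    have h3 : ∑ i ∈ Finset.range m, LinearMap.trace ℂ V (T ^ (i + 1)) *
        LinearMap.trace ℂ V (T ^ ((m + 1 - 1) * (i + 1))) * ((y : ℂˣ) : ℂ) ^ (i + 1) =
        ∑ i ∈ Finset.range m, ((y : ℂˣ) : ℂ) ^ (i + 1) := by
      refine Finset.sum_congr rfl fun i hi ↦ ?_
      rw [htr, one_mul]
      intro hd
      have := Nat.le_of_dvd (by omega) hd
      have := Finset.mem_range.mp hi
      omega
    rw [h3, mul_zero, ha 0]
    simp only [pow_zero, mul_one]
    ring
  obtain ⟨ε, k, x₀, hε, hk⟩ := exists_eq_add_ite_of_autocorrelation (fun x ↦ (a x : ℤ)) (by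
    intro y hy
    have h1 := key 1
    have h2 := key y
    simp only [if_neg hy, if_true, mul_one] at h1 h2
    have h3 : (n : ℂ) * (∑ x, (a x : ℂ) * a (x * y) + 1) = n * ∑ x, (a x : ℂ) * a x := by
      linear_combination h2 - h1
    have h4 := mul_left_cancel₀ (by exact_mod_cast hn.ne') h3
    exact_mod_cast h4)
  replace hk : ∀ x, (a x : ℤ) = k + if x = x₀ then ε else 0 :=
    fun x ↦ (hk x).trans (by congr)
  have hkC : ∀ x, (a x : ℂ) = k + if x = x₀ then (ε : ℂ) else 0 := by
    intro x
    have := congrArg (Int.cast : ℤ → ℂ) (hk x)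
    push_cast at this
    exact this
  refine ⟨ε, k, x₀, hε, fun i ↦ ?_, ?_⟩
  · rw [ha]
    simp_rw [hkC, add_mul, Finset.sum_add_distrib, ← Finset.mul_sum, sum_pow_rootsOfUnity]
    simp
  · rw [hdet]
    simp_rw [← zpow_natCast]
    simp_rw [hk]
    have : ∀ x : rootsOfUnity n ℂ, ((x : ℂˣ) : ℂ) ^ (k + if x = x₀ then ε else 0) =
        ((x : ℂˣ) : ℂ) ^ k * if x = x₀ then ((x₀ : ℂˣ) : ℂ) ^ ε else 1 := by
      intro x
      rw [zpow_add₀ (Units.ne_zero _)]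
      by_cases hx : x = x₀ <;> simp [hx]
    simp_rw [this, Finset.prod_mul_distrib]
    rw [Finset.prod_zpow, prod_rootsOfUnity]
    simp

/-- **Schur's lemma**: a linear endomorphism commuting with a simple representation is a scalar. -/
theorem FDRep.exists_eq_smul_one_of_commute {G : Type} [Group G] (τ : FDRep ℂ G) [Simple τ]
    (f : Module.End ℂ τ) (hf : ∀ g, f * τ.ρ g = τ.ρ g * f) : ∃ c : ℂ, f = c • 1 := by
  let F : τ ⟶ τ := ⟨InducedCategory.homMk (ModuleCat.ofHom f), fun g ↦ by
    ext v
    exact LinearMap.congr_fun (hf g) v⟩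
  obtain ⟨c, hc⟩ := endomorphism_simple_eq_smul_id ℂ F
  refine ⟨c, LinearMap.ext fun v ↦ ?_⟩
  have h : F.hom.hom.hom v = (c • 𝟙 τ : τ ⟶ τ).hom.hom.hom v := by rw [hc]
  exact h

section CentralCharacter

variable {P V : Type*} [Group P] [AddCommGroup V] [Module ℂ V] (ρ : P →* Module.End ℂ V)
  (ζ : Subgroup.center P →* ℂˣ)

/-- If `P ⧸ Z(P)` is abelian and `Z(P)` acts through a faithful character, the trace vanishes off
the centre. -/
theorem trace_eq_zero_of_notMem_center
    (habel : ∀ x y : P ⧸ Subgroup.center P, Commute x y) (hζ : Function.Injective ζ)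
    (hρ : ∀ z : Subgroup.center P, ρ z = (ζ z : ℂ) • 1) {x : P} (hx : x ∉ Subgroup.center P) :
    LinearMap.trace ℂ V (ρ x) = 0 := by
  rw [Subgroup.mem_center_iff] at hx
  push Not at hx
  obtain ⟨y, hy⟩ := hx
  have hz : y * x * y⁻¹ * x⁻¹ ∈ Subgroup.center P := by
    rw [← QuotientGroup.eq_one_iff]
    have := habel y x
    simp only [QuotientGroup.mk_mul, QuotientGroup.mk_inv]
    rw [this.eq]
    group
  have h1 : LinearMap.trace ℂ V (ρ (y * x * y⁻¹)) = LinearMap.trace ℂ V (ρ x) := by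
    rw [map_mul, LinearMap.trace_mul_comm, ← map_mul]
    congr 2
    group
  have h2 : ρ (y * x * y⁻¹) = (ζ ⟨_, hz⟩ : ℂ) • ρ x := by
    rw [← one_mul (ρ x), ← smul_mul_assoc, ← hρ, ← map_mul]
    congr 1
    group
  rw [h2, map_smul, smul_eq_mul] at h1
  by_contra h0
  have h3 : (ζ ⟨_, hz⟩ : ℂ) = 1 := mul_right_cancel₀ h0 (by rw [h1, one_mul])
  have h4 : (⟨_, hz⟩ : Subgroup.center P) = 1 := hζ (by rw [map_one]; exact Units.ext h3)
  apply hy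
  have h5 := congrArg Subtype.val h4
  simp only [Subgroup.coe_one] at h5
  rw [mul_inv_eq_one] at h5
  exact mul_inv_eq_iff_eq_mul.mp h5

/-- The dimension formula `|Z| d² = |P|` for an irreducible representation whose character vanishes
off the centre. -/
theorem card_center_mul_finrank_sq [Fintype P] [FiniteDimensional ℂ V]
    (hρ : ∀ z : Subgroup.center P, ρ z = (ζ z : ℂ) • 1)
    (hoff : ∀ x ∉ Subgroup.center P, LinearMap.trace ℂ V (ρ x) = 0)
    (hnorm : ∑ g : P, LinearMap.trace ℂ V (ρ g) * LinearMap.trace ℂ V (ρ g⁻¹) = Nat.card P) :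
    Nat.card (Subgroup.center P) * Module.finrank ℂ V ^ 2 = Nat.card P := by
  have h1 : ∀ g : P, LinearMap.trace ℂ V (ρ g) * LinearMap.trace ℂ V (ρ g⁻¹) =
      if g ∈ Subgroup.center P then (Module.finrank ℂ V : ℂ) ^ 2 else 0 := by
    intro g
    split_ifs with hg
    · have h2 := hρ ⟨g, hg⟩
      have h3 := hρ (⟨g, hg⟩⁻¹)
      rw [Subgroup.coe_inv] at h3
      rw [h2, h3, map_smul, map_smul, LinearMap.trace_one, map_inv, smul_eq_mul, smul_eq_mul]
      rw [Units.val_inv_eq_inv_val]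
      field_simp
    · rw [hoff g hg, zero_mul]
  simp_rw [h1] at hnorm
  rw [Finset.sum_ite, Finset.sum_const_zero, add_zero, Finset.sum_const, nsmul_eq_mul,
    ← Fintype.card_subtype, ← Nat.card_eq_fintype_card] at hnorm
  exact_mod_cast hnorm

end CentralCharacter

section Semidirect

variable {P S V : Type*} [Group P] [Group S] {φ : S →* MulAut P}

/-- In a semidirect product with a group acting trivially on the centre of `P`, an element of
`P` lying in `S Z(P)` is central in `P`. -/
theorem mem_center_of_inl_mem_sup (hφ : ∀ s, ∀ z ∈ Subgroup.center P, φ s z = z) {g : P}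
    (hg : (inl g : P ⋊[φ] S) ∈ Subgroup.map (inr : S →* P ⋊[φ] S) ⊤ ⊔
      Subgroup.map (inl : P →* P ⋊[φ] S) (Subgroup.center P)) :
    g ∈ Subgroup.center P := by
  let K : Subgroup (P ⋊[φ] S) :=
    { carrier := {x | x.left ∈ Subgroup.center P}
      one_mem' := by simp
      mul_mem' := fun {a b} ha hb ↦ by
        simp only [Set.mem_ofPred_eq] at ha hb ⊢
        rw [mul_left, hφ _ _ hb]
        exact mul_mem ha hb
      inv_mem' := fun {a} ha ↦ by
        simp only [Set.mem_ofPred_eq] at ha ⊢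
        rw [inv_left, hφ _ _ (inv_mem ha)]
        exact inv_mem ha }
  have hK : Subgroup.map (inr : S →* P ⋊[φ] S) ⊤ ⊔
      Subgroup.map (inl : P →* P ⋊[φ] S) (Subgroup.center P) ≤ K := by
    refine sup_le ?_ ?_
    · rintro _ ⟨s, -, rfl⟩
      change (inr s : P ⋊[φ] S).left ∈ Subgroup.center P
      simp
    · rintro _ ⟨z, hz, rfl⟩
      exact hz
  exact hK hg

/-- Coprime action: if `s` has order prime to `p`, fixes the centre of the `p`-group `P` and
fixes a coset of the centre, then it fixes every element of the coset. -/
theorem apply_eq_self_of_mul_apply_inv_mem_center [Finite S] {p : ℕ} (hp : p.Prime)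
    (hP : IsPGroup p P) (hS : ¬ p ∣ Nat.card S) (hφ : ∀ s, ∀ z ∈ Subgroup.center P, φ s z = z)
    {s : S} {g : P} (hg : g * φ s g⁻¹ ∈ Subgroup.center P) : φ s g = g := by
  set z := g * φ s g⁻¹ with hz
  have h1 : φ s g = z⁻¹ * g := by rw [hz, map_inv]; group
  have h2 : ∀ m : ℕ, φ (s ^ m) g = (z⁻¹) ^ m * g := by
    intro m
    induction m with
    | zero => simp
    | succ m ih =>
      rw [pow_succ', map_mul, MulAut.mul_apply, ih, map_mul, h1,
        hφ s _ (pow_mem (inv_mem hg) m), pow_succ, mul_assoc]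
  have h3 : (z⁻¹) ^ Nat.card S = 1 := by
    have := h2 (Nat.card S)
    rw [pow_card_eq_one', map_one, MulAut.one_apply] at this
    exact (right_eq_mul.mp this)
  obtain ⟨k, hk⟩ := hP z⁻¹
  have h4 : z⁻¹ = 1 := by
    have hc : Nat.Coprime (Nat.card S) (p ^ k) :=
      Nat.Coprime.pow_right k ((Nat.Prime.coprime_iff_not_dvd hp).mpr hS).symm
    rw [← orderOf_eq_one_iff]
    exact Nat.eq_one_of_dvd_coprimes hc (orderOf_dvd_of_pow_eq_one h3)
      (orderOf_dvd_of_pow_eq_one hk)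
  rw [h1, h4, one_mul]

/-- If `s` fixes only the trivial coset of the centre, the trace of `s` on a representation of
`P ⋊ S` that is irreducible on `P` and has character vanishing on `P` off the centre
satisfies `tr s * tr s⁻¹ = 1`. -/
theorem trace_inr_mul_trace_inr_inv [Fintype P] [AddCommGroup V] [Module ℂ V]
    [FiniteDimensional ℂ V] (ρ : P ⋊[φ] S →* Module.End ℂ V)
    (hschur : ∀ f : Module.End ℂ V, (∀ g : P, f * ρ (inl g) = ρ (inl g) * f) →
      ∃ c : ℂ, f = c • 1)
    (hoff : ∀ x ∉ Subgroup.center P, LinearMap.trace ℂ V (ρ (inl x)) = 0)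
    (hdim : Nat.card (Subgroup.center P) * Module.finrank ℂ V ^ 2 = Nat.card P)
    (hφ : ∀ s, ∀ z ∈ Subgroup.center P, φ s z = z) {s : S}
    (hs : ∀ g : P, g * φ s g⁻¹ ∈ Subgroup.center P → g ∈ Subgroup.center P) :
    LinearMap.trace ℂ V (ρ (inr s)) * LinearMap.trace ℂ V (ρ (inr s⁻¹)) = 1 := by
  set A : Module.End ℂ V := ∑ g : P, ρ (inl g * inr s * inl g⁻¹) with hA
  obtain ⟨c, hc⟩ := hschur A fun h ↦ by
    rw [hA, Finset.sum_mul, Finset.mul_sum, ← Equiv.sum_comp (Equiv.mulLeft h)]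
    refine Finset.sum_congr rfl fun g _ ↦ ?_
    rw [← map_mul, ← map_mul, Equiv.coe_mulLeft]
    congr 1
    simp only [map_mul, map_inv]
    group
  have h1 : LinearMap.trace ℂ V A = Nat.card P * LinearMap.trace ℂ V (ρ (inr s)) := by
    rw [hA, map_sum, Nat.card_eq_fintype_card, ← nsmul_eq_mul, ← Finset.card_univ,
      ← Finset.sum_const]
    refine Finset.sum_congr rfl fun g _ ↦ ?_
    rw [map_mul, LinearMap.trace_mul_comm, ← map_mul]
    congr 2
    simp only [map_inv]
    group
  have h2 : LinearMap.trace ℂ V (A * ρ (inr s⁻¹)) =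
      Nat.card (Subgroup.center P) * Module.finrank ℂ V := by
    have h3 : ∀ g : P, LinearMap.trace ℂ V (ρ (inl g * inr s * inl g⁻¹) * ρ (inr s⁻¹)) =
        if g ∈ Subgroup.center P then (Module.finrank ℂ V : ℂ) else 0 := by
      intro g
      have h4 : (inl g * inr s * inl g⁻¹ * inr s⁻¹ : P ⋊[φ] S) = inl (g * φ s g⁻¹) := by
        rw [map_mul, inl_aut]
        simp only [mul_assoc, map_inv]
      rw [← map_mul, h4]
      split_ifs with hg
      · rw [hφ s _ (inv_mem hg), mul_inv_cancel, map_one, map_one, LinearMap.trace_one]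
      · exact hoff _ fun h ↦ hg (hs g h)
    rw [hA, Finset.sum_mul, map_sum]
    simp_rw [h3]
    rw [Finset.sum_ite, Finset.sum_const_zero, add_zero, Finset.sum_const, nsmul_eq_mul,
      ← Fintype.card_subtype, ← Nat.card_eq_fintype_card]
  rw [hc, map_smul, LinearMap.trace_one, smul_eq_mul] at h1
  rw [hc, smul_mul_assoc, one_mul, map_smul, smul_eq_mul] at h2
  have hdimC : (Nat.card (Subgroup.center P) : ℂ) * (Module.finrank ℂ V : ℂ) ^ 2 = Nat.card P := by
    exact_mod_cast hdim
  have hP0 : (Nat.card P : ℂ) ≠ 0 := by exact_mod_cast Nat.card_pos.ne'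
  apply mul_left_cancel₀ hP0
  linear_combination (-LinearMap.trace ℂ V (ρ (inr s⁻¹))) * h1 +
    (Module.finrank ℂ V : ℂ) * h2 + hdimC

end Semidirect

/-- Glauberman–Isaacs character formula for the canonical extension
`τ̃` of the irreducible representation of an H-cyclic `p`-group `P` to `G = S ⋉ P`,
when every nontrivial element of `S` has centralizer `SZ` in `G`. -/
theorem stmt_5 (p r : ℕ) (hp : p.Prime) (P : Type) [Group P] [Fintype P]
    (hP : IsPGroup p P)
    (hZcyc : IsCyclic (Subgroup.center P))
    (hZne : Subgroup.center P ≠ ⊤)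
    (helem : ∀ x : P ⧸ Subgroup.center P, x ^ p = 1)
    (habel : ∀ x y : P ⧸ Subgroup.center P, Commute x y)
    (hr : 1 ≤ r)
    (hcard : Nat.card (P ⧸ Subgroup.center P) = p ^ (2 * r))
    (ζ : Subgroup.center P →* ℂˣ) (hζ : Function.Injective ζ)
    (S : Subgroup (MulAut P)) (hScyc : IsCyclic S)
    (hSord : ¬ p ∣ Nat.card S)
    (hSZ : ∀ s : S, ∀ z ∈ Subgroup.center P, (s : MulAut P) z = z)
    -- τ is the unique irreducible representation of P containing ζ
    (τ : FDRep ℂ P) (hτirr : Simple τ)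
    (hτζ : ∃ v : τ, v ≠ 0 ∧ ∀ z : Subgroup.center P, τ.ρ (z : P) v = (ζ z : ℂ) • v)
    -- τext is the extension of τ to G = S ⋉ P with trivial determinant on S
    (τext : FDRep ℂ (P ⋊[S.subtype] S))
    (hres : ∃ e : τext ≃ₗ[ℂ] τ, ∀ (g : P) (v : τext), e (τext.ρ (inl g) v) = τ.ρ g (e v))
    (hdet : ∀ s : S, LinearMap.det (τext.ρ (inr s)) = 1)
    -- every nontrivial s ∈ S has G-centralizer equal to SZ
    (hcent : ∀ s : S, s ≠ 1 →
      Subgroup.centralizer {(inr s : P ⋊[S.subtype] S)} =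
        Subgroup.map (inr : S →* P ⋊[S.subtype] S) ⊤ ⊔
          Subgroup.map (inl : P →* P ⋊[S.subtype] S) (Subgroup.center P)) :
    ∃ (ε : ℤ) (μ : S →* ℂˣ) (k : ℤ),
      (ε = 1 ∨ ε = -1) ∧
      (∀ s : S, μ s * μ s = 1) ∧
      -- (1) tr τ̃(sz) = ε μ(s) ζ(z) for s ≠ 1
      (∀ s : S, s ≠ 1 → ∀ z : Subgroup.center P,
        τext.character (inl (z : P) * inr s) = (ε : ℂ) * (μ s : ℂ) * (ζ z : ℂ)) ∧
      -- (2) p^r − ε = k |S|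
      ((p : ℤ) ^ r - ε = k * Nat.card S) ∧
      -- (3) tr τ̃ restricted to S equals k·R_S + ε·μ
      (∀ s : S, τext.character (inr s) =
        (k : ℂ) * (if s = 1 then (Nat.card S : ℂ) else 0) + (ε : ℂ) * (μ s : ℂ)) ∧
      -- (4) μ is nontrivial iff |S| is even and k is odd
      ((∃ s : S, μ s ≠ 1) ↔ (Even (Nat.card S) ∧ Odd k)) := by
  have : Finite S := inferInstance
  obtain ⟨e, he⟩ := hres
  have hconj : ∀ g : P, e.conj (τext.ρ (inl g)) = τ.ρ g := fun g ↦ LinearMap.ext fun v ↦ by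
    rw [LinearEquiv.conj_apply_apply, he, e.apply_symm_apply]
  have htrP : ∀ g : P, LinearMap.trace ℂ τext (τext.ρ (inl g)) = τ.character g := fun g ↦ by
    rw [FDRep.character, ← hconj, LinearMap.trace_conj']
  have hschur : ∀ f : Module.End ℂ τext,
      (∀ g : P, f * τext.ρ (inl g) = τext.ρ (inl g) * f) → ∃ c : ℂ, f = c • 1 := by
    intro f hf
    obtain ⟨c, hc⟩ := FDRep.exists_eq_smul_one_of_commute τ (e.conj f) fun g ↦ by
      rw [← hconj, Module.End.mul_eq_comp, ← LinearEquiv.conj_comp, ← Module.End.mul_eq_comp, hf,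
        Module.End.mul_eq_comp, LinearEquiv.conj_comp, Module.End.mul_eq_comp]
    refine ⟨c, LinearMap.ext fun v ↦ e.injective ?_⟩
    have := LinearMap.congr_fun hc (e v)
    rw [LinearEquiv.conj_apply_apply, e.symm_apply_apply] at this
    rw [this]
    simp
  have hcen : ∀ z : Subgroup.center P,
      (τext.ρ.comp (inl : P →* P ⋊[S.subtype] S)) z = (ζ z : ℂ) • 1 := by
    intro z
    obtain ⟨c, hc⟩ := hschur (τext.ρ (inl (z : P))) fun g ↦ by
      rw [← map_mul, ← map_mul, ← map_mul, ← map_mul, Subgroup.mem_center_iff.mp z.2 g]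
    obtain ⟨v, hv0, hv⟩ := hτζ
    have h1 := he (z : P) (e.symm v)
    rw [hc, e.apply_symm_apply, hv] at h1
    simp only [LinearMap.smul_apply, Module.End.one_apply, map_smul, e.apply_symm_apply] at h1
    rw [MonoidHom.comp_apply, hc, smul_left_injective ℂ hv0 h1]
  have hoff : ∀ x ∉ Subgroup.center P, LinearMap.trace ℂ τext (τext.ρ (inl x)) = 0 :=
    fun x hx ↦ trace_eq_zero_of_notMem_center (τext.ρ.comp inl) ζ habel hζ hcen hx
  have hP0 : (Nat.card P : ℂ) ≠ 0 := by exact_mod_cast Nat.card_pos.ne'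
  have hnorm : ∑ g : P, LinearMap.trace ℂ τext (τext.ρ (inl g)) *
      LinearMap.trace ℂ τext (τext.ρ (inl g⁻¹)) = Nat.card P := by
    have : Invertible (Nat.card P : ℂ) := invertibleOfNonzero hP0
    have h1 := FDRep.char_orthonormal τ τ
    rw [if_pos ⟨Iso.refl τ⟩, inv_mul_eq_iff_eq_mul₀ hP0, mul_one] at h1
    simp_rw [htrP]
    exact h1
  have hdim := card_center_mul_finrank_sq (τext.ρ.comp inl) ζ hcen hoff hnorm
  have hd : Module.finrank ℂ τext = p ^ r := by
    have h1 := Subgroup.card_eq_card_quotient_mul_card_subgroup (Subgroup.center P)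
    rw [hcard, ← hdim, mul_comm (p ^ _)] at h1
    have h2 := Nat.eq_of_mul_eq_mul_left Nat.card_pos h1
    rw [mul_comm, pow_mul] at h2
    exact Nat.pow_left_injective two_ne_zero h2
  have htr : ∀ s : S, s ≠ 1 → LinearMap.trace ℂ τext (τext.ρ (inr s)) *
      LinearMap.trace ℂ τext (τext.ρ (inr s⁻¹)) = 1 := by
    intro s hs
    refine trace_inr_mul_trace_inr_inv τext.ρ hschur hoff hdim hSZ fun g hg ↦ ?_
    have hfix := apply_eq_self_of_mul_apply_inv_mem_center hp hP hSord hSZ hg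
    refine mem_center_of_inl_mem_sup (φ := S.subtype) hSZ ?_
    rw [← hcent s hs, Subgroup.mem_centralizer_singleton_iff]
    have h1 := inl_aut (φ := S.subtype) s g
    rw [hfix, map_inv, eq_mul_inv_iff_mul_eq] at h1
    exact h1
  obtain ⟨γ, hγ⟩ := hScyc.exists_generator
  set n := Nat.card S with hn
  have : NeZero n := ⟨Nat.card_pos.ne'⟩
  have hord : orderOf γ = n := orderOf_eq_card_of_forall_mem_zpowers hγ
  have hpow : ∀ i : ℕ, τext.ρ (inr γ) ^ i = τext.ρ (inr (γ ^ i)) := fun i ↦ by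
    rw [map_pow, map_pow]
  obtain ⟨ε, k, x₀, hε, htrγ, hdetγ⟩ :=
    exists_trace_pow_eq_of_trace_mul_trace_eq_one n (τext.ρ (inr γ))
      (by rw [hpow, ← hord, pow_orderOf_eq_one, map_one, map_one]) (by
        intro i hi
        rw [hpow, hpow, pow_mul']
        have h1 : (γ ^ i) ^ (n - 1) = (γ ^ i)⁻¹ := by
          rw [eq_inv_iff_mul_eq_one, ← pow_succ, Nat.sub_add_cancel (NeZero.pos n), hn,
            pow_card_eq_one']
        rw [h1]
        refine htr _ fun h ↦ hi ?_
        rwa [← hord, orderOf_dvd_iff_pow_eq_one])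
  let μ : S →* ℂˣ := monoidHomOfForallMemZpowers hγ (g' := (x₀ : ℂˣ)) (by
    rw [hord]
    exact orderOf_dvd_of_pow_eq_one ((mem_rootsOfUnity n _).mp x₀.2))
  have hμγ : μ γ = (x₀ : ℂˣ) := monoidHomOfForallMemZpowers_apply_gen hγ _
  have hchar : ∀ s : S, τext.character (inr s) =
      (k : ℂ) * (if s = 1 then (n : ℂ) else 0) + (ε : ℂ) * (μ s : ℂ) := by
    intro s
    obtain ⟨i, rfl⟩ := (mem_powers_iff_mem_zpowers.mpr (hγ s) : s ∈ Submonoid.powers γ)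
    have h1 := htrγ i
    rw [hpow] at h1
    have h2 : n ∣ i ↔ γ ^ i = 1 := by rw [← hord, orderOf_dvd_iff_pow_eq_one]
    rw [FDRep.character, h1]
    simp only [map_pow, hμγ, h2, Units.val_pow_eq_pow_val]
  rw [hdet γ] at hdetγ
  set σ : ℂ := (-1) ^ (n - 1) with hσ
  have hx₀ : ((x₀ : ℂˣ) : ℂ) = σ ^ k := by
    have hσσ : σ * σ = 1 := by rw [hσ, ← mul_pow]; simp
    have hσk : σ ^ k * σ ^ k = 1 := by rw [← mul_zpow, hσσ, one_zpow]
    rcases hε with rfl | rfl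
    · rw [zpow_one] at hdetγ
      linear_combination (-σ ^ k) * hdetγ + (-((x₀ : ℂˣ) : ℂ)) * hσk
    · rw [zpow_neg_one, eq_mul_inv_iff_mul_eq₀ (Units.ne_zero _), one_mul] at hdetγ
      exact hdetγ
  have hμsq : ∀ s : S, μ s * μ s = 1 := by
    intro s
    obtain ⟨i, rfl⟩ := (mem_powers_iff_mem_zpowers.mpr (hγ s) : s ∈ Submonoid.powers γ)
    have h1 : (x₀ : ℂˣ) * x₀ = 1 := Units.ext (by
      rw [Units.val_mul, hx₀, ← mul_zpow, hσ, ← mul_pow]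
      simp)
    simp only [map_pow]
    rw [← mul_pow, hμγ, h1, one_pow]
  refine ⟨ε, μ, k, hε, hμsq, fun s hs z ↦ ?_, ?_, hchar, ?_⟩
  · have h1 := hcen z
    rw [MonoidHom.comp_apply] at h1
    have h2 := hchar s
    rw [if_neg hs, mul_zero, zero_add] at h2
    rw [FDRep.character, map_mul, h1, smul_mul_assoc, one_mul, map_smul, smul_eq_mul, mul_comm,
      ← h2, FDRep.character]
  · have h1 := hchar 1
    rw [map_one, FDRep.char_one, hd, map_one, if_pos rfl] at h1
    have h2 : ((p : ℤ) ^ r - ε : ℂ) = k * n := by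
      push_cast at h1 ⊢
      linear_combination h1
    exact_mod_cast h2
  · have h1 : (∃ s : S, μ s ≠ 1) ↔ σ ^ k ≠ 1 := by
      rw [← not_iff_not]
      push Not
      rw [← hx₀, Units.val_eq_one, ← hμγ]
      refine ⟨fun h ↦ h γ, fun h s ↦ ?_⟩
      obtain ⟨i, rfl⟩ := (mem_powers_iff_mem_zpowers.mpr (hγ s) : s ∈ Submonoid.powers γ)
      simp only [map_pow]
      rw [h, one_pow]
    rw [h1]
    have hpos := NeZero.pos n
    rcases Nat.even_or_odd n with hne | hno
    · have h2 : σ = -1 := Odd.neg_one_pow (Nat.Even.sub_odd hpos hne odd_one)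
      rw [h2]
      rcases Int.even_or_odd k with hk | hk
      · rw [hk.neg_one_zpow]
        simp [Int.not_odd_iff_even.mpr hk]
      · rw [hk.neg_one_zpow]
        simp only [hne, hk, and_self, iff_true]
        norm_num
    · have h2 : σ = 1 := Even.neg_one_pow (Nat.Odd.sub_odd hno odd_one)
      simp [h2, Nat.not_even_iff_odd.mpr hno]
end

section
/- Let p be a prime, T a finite group, V a finite-dimensional 𝔽_p-vector space with a linear action of T, and h a nondegenerate T-invariant alternating 𝔽_p-bilinear form on V which is T-anisotropic. Let V = U₁ ⊇ U₂ ⊇ ⋯ ⊇ U_m ⊇ U_{m+1} = 0 be a chain of T-invariant subspaces, and for 1 ≤ i ≤ m set W_i = {u ∈ U_i : h(u, u') = 0 for all u' ∈ U_{i+1}}, the h-orthogonal complement of U_{i+1} in U_i. Then V is the orthogonal direct sum of the subspaces W_1, …, W_m: V = W_1 ⊕ ⋯ ⊕ W_m and h(W_i, W_j) = 0 whenever i ≠ j. -/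
/-- A subspace that meets its orthogonal complement trivially splits off orthogonally. -/
theorem exists_mem_sub_orthogonal_of_disjoint {K V : Type*} [Field K] [AddCommGroup V] [Module K V]
    [FiniteDimensional K V] (h : V →ₗ[K] V →ₗ[K] K) (U : Submodule K V)
    (hU : ∀ v ∈ U, (∀ u ∈ U, h v u = 0) → v = 0) (v : V) :
    ∃ u ∈ U, ∀ w ∈ U, h (v - u) w = 0 := by
  let f : V →ₗ[K] Module.Dual K U := U.subtype.dualMap ∘ₗ h
  have hinj : Function.Injective (f ∘ₗ U.subtype) := by
    rw [← LinearMap.ker_eq_bot, LinearMap.ker_eq_bot']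
    intro u hu
    exact Subtype.ext (hU u u.2 fun w hw => LinearMap.congr_fun hu ⟨w, hw⟩)
  have hsurj : Function.Surjective (f ∘ₗ U.subtype) :=
    (LinearMap.injective_iff_surjective_of_finrank_eq_finrank
      Subspace.dual_finrank_eq.symm).1 hinj
  obtain ⟨u, hu⟩ := hsurj (f v)
  refine ⟨u, u.2, fun w hw => ?_⟩
  have huw : h u w = h v w := LinearMap.congr_fun hu ⟨w, hw⟩
  rw [map_sub, LinearMap.sub_apply, huw, sub_self]

/-- a T-anisotropic nondegenerate alternating space is the
orthogonal direct sum of the relative orthogonal complements along any chain of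
T-invariant subspaces. -/
theorem stmt_8 (p : ℕ) [Fact p.Prime] (T : Type*) [Group T] [Finite T]
    (V : Type*) [AddCommGroup V] [Module (ZMod p) V] [FiniteDimensional (ZMod p) V]
    (ρ : Representation (ZMod p) T V)
    (h : V →ₗ[ZMod p] V →ₗ[ZMod p] ZMod p)
    (halt : ∀ v : V, h v v = 0)
    (hnd : ∀ v : V, (∀ w : V, h v w = 0) → v = 0)
    (hinv : ∀ (t : T) (v w : V), h (ρ t v) (ρ t w) = h v w)
    (haniso : ∀ U : Submodule (ZMod p) V,
      (∀ t : T, ∀ u ∈ U, ρ t u ∈ U) → (∀ u ∈ U, ∀ w ∈ U, h u w = 0) → U = ⊥)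
    -- the chain V = U 0 ⊇ U 1 ⊇ ⋯ ⊇ U m = 0 of T-invariant subspaces
    (m : ℕ) (U : Fin (m + 1) → Submodule (ZMod p) V)
    (hU0 : U 0 = ⊤) (hUm : U (Fin.last m) = ⊥)
    (hmono : ∀ i j : Fin (m + 1), i ≤ j → U j ≤ U i)
    (hUinv : ∀ (i : Fin (m + 1)) (t : T), ∀ u ∈ U i, ρ t u ∈ U i)
    -- W i is the h-orthogonal complement of U (i+1) in U i
    (W : Fin m → Submodule (ZMod p) V)
    (hW : ∀ (i : Fin m) (v : V),
      v ∈ W i ↔ v ∈ U i.castSucc ∧ ∀ u ∈ U i.succ, h v u = 0) :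
    -- V is the orthogonal direct sum of the W i
    (⨆ i, W i) = ⊤ ∧
    iSupIndep W ∧
    (∀ i j : Fin m, i ≠ j → ∀ u ∈ W i, ∀ w ∈ W j, h u w = 0) := by
  have hskew : ∀ v w : V, h v w = 0 → h w v = 0 := fun v w => LinearMap.IsAlt.isRefl halt v w
  have hrad : ∀ i, ∀ v ∈ U i, (∀ u ∈ U i, h v u = 0) → v = 0 := by
    intro i
    let R : Submodule (ZMod p) V :=
      { carrier := {v | v ∈ U i ∧ ∀ u ∈ U i, h v u = 0}
        add_mem' := fun {a b} ha hb => ⟨add_mem ha.1 hb.1, fun u hu => by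
          simp [ha.2 u hu, hb.2 u hu]⟩
        zero_mem' := ⟨zero_mem _, by simp⟩
        smul_mem' := fun c a ha => ⟨(U i).smul_mem c ha.1, fun u hu => by simp [ha.2 u hu]⟩ }
    have hR : R = ⊥ := by
      refine haniso R (fun t v hv => ⟨hUinv i t v hv.1, fun u hu => ?_⟩)
        fun u hu w hw => hu.2 w hw.1
      have hu' := hv.2 _ (hUinv i t⁻¹ u hu)
      rw [← hinv t] at hu'
      simpa using hu'
    intro v hv hvu
    have hvR : v ∈ R := ⟨hv, hvu⟩
    rwa [hR, Submodule.mem_bot] at hvR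
  have hle : ∀ i, U i ≤ ⨆ j, W j := by
    intro i
    induction i using Fin.reverseInduction with
    | last => simp [hUm]
    | cast i ih =>
      intro v hv
      obtain ⟨u, hu, huv⟩ := exists_mem_sub_orthogonal_of_disjoint h (U i.succ) (hrad _) v
      have huW : v - u ∈ W i := (hW i _).2
        ⟨sub_mem hv (hmono _ _ Fin.castSucc_lt_succ.le hu), huv⟩
      rw [← sub_add_cancel v u]
      exact add_mem (le_iSup W i huW) (ih hu)
  have htop : (⨆ i, W i) = ⊤ := top_le_iff.1 (hU0 ▸ hle 0)
  have hlt : ∀ i j : Fin m, i < j → ∀ u ∈ W i, ∀ w ∈ W j, h u w = 0 := fun i j hij u hu w hw =>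
    ((hW i u).1 hu).2 w (hmono i.succ j.castSucc (Fin.succ_le_castSucc_iff.2 hij) ((hW j w).1 hw).1)
  have horth : ∀ i j : Fin m, i ≠ j → ∀ u ∈ W i, ∀ w ∈ W j, h u w = 0 := by
    intro i j hij u hu w hw
    rcases hij.lt_or_gt with hij | hij
    · exact hlt i j hij u hu w hw
    · exact hskew _ _ (hlt j i hij w hw u hu)
  refine ⟨htop, fun i => Submodule.disjoint_def.2 fun v hv hv' => hnd v fun w => ?_, horth⟩
  have hker : (⨆ j, W j) ≤ LinearMap.ker (h v) := by
    refine iSup_le fun j w hw => LinearMap.mem_ker.2 ?_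
    rcases eq_or_ne j i with rfl | hji
    · have hsup : (⨆ k, ⨆ (_ : k ≠ j), W k) ≤ LinearMap.ker (h w) :=
        iSup₂_le fun k hk u hu => horth j k hk.symm w hw u hu
      exact hskew _ _ (hsup hv')
    · exact horth i j hji.symm v hv w hw
  exact hker (htop ▸ Submodule.mem_top)
end

section
/- Let p be a prime, S a finite cyclic group of order prime to p, 𝔽̄_p an algebraic closure of 𝔽_p, and χ : S → 𝔽̄_p^× a homomorphism. Let 𝔽_p(χ) be the subfield of 𝔽̄_p generated by the values of χ, regarded as a representation of S over 𝔽_p via s·x = χ(s)x. The following are equivalent: (a) 𝔽_p(χ) admits a nondegenerate S-invariant alternating 𝔽_p-bilinear form; (b) the character χ⁻¹ equals χ composed with some power of the Frobenius x ↦ x^p, but χ⁻¹ ≠ χ; (c) the degree [𝔽_p(χ) : 𝔽_p] equals 2d for some integer d ≥ 1 and the image χ(S) is contained in the unique subgroup of 𝔽_p(χ)^× of order 1 + p^d. -/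
set_option synthInstance.maxHeartbeats 1000000
set_option maxHeartbeats 1000000

/-- The subfield `𝔽_p(χ)` of `𝔽̄_p` generated by the values of a character
`χ : S → 𝔽̄_p^×` (as a subalgebra of the algebraic closure; since everything is
algebraic over `𝔽_p` this is a field). -/
noncomputable def chiField (p : ℕ) [Fact p.Prime] {S : Type*} [Group S]
    (χ : S →* (AlgebraicClosure (ZMod p))ˣ) :
    Subalgebra (ZMod p) (AlgebraicClosure (ZMod p)) :=
  Algebra.adjoin (ZMod p) (Set.range fun s => (χ s : AlgebraicClosure (ZMod p)))

/-- The value `χ s`, as an element of `𝔽_p(χ)`.  The `S`-representation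
structure on `𝔽_p(χ)` is given by `s • x = chiVal p χ s * x`. -/
noncomputable def chiVal (p : ℕ) [Fact p.Prime] {S : Type*} [Group S]
    (χ : S →* (AlgebraicClosure (ZMod p))ˣ) (s : S) : chiField p χ :=
  ⟨(χ s : AlgebraicClosure (ZMod p)), Algebra.subset_adjoin ⟨s, rfl⟩⟩

section FiniteFieldCharacter

variable {k L S : Type*} [Field k] [Field L] [Algebra k L] [Group S]

/-- If a character is inverse to itself, then the algebra its values generate is the base field. -/
theorem adjoin_range_eq_bot_of_mul_self_eq_one (u : S →* L) (h : ∀ s, u s * u s = 1) :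
    Algebra.adjoin k (Set.range u) = ⊥ := by
  rw [eq_bot_iff, Algebra.adjoin_le_iff]
  rintro _ ⟨s, rfl⟩
  rcases mul_self_eq_one_iff.mp (h s) with h1 | h1 <;> rw [h1]
  · exact one_mem _
  · exact neg_mem (one_mem _)

theorem finrank_eq_one_of_mul_self_eq_one (u : S →* L)
    (hu : Algebra.adjoin k (Set.range u) = ⊤) (h : ∀ s, u s * u s = 1) :
    Module.finrank k L = 1 := by
  rw [adjoin_range_eq_bot_of_mul_self_eq_one u h] at hu
  exact Subalgebra.bot_eq_top_iff_finrank_eq_one.mp hu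

/-- A linear map intertwining a generating character with its inverse, and fixing `1`, is an
algebra homomorphism. -/
theorem exists_algHom_of_map_mul_eq_inv_mul (u : S →* L)
    (hu : Algebra.adjoin k (Set.range u) = ⊤) (T : L →ₗ[k] L) (h1 : T 1 = 1)
    (hT : ∀ s v, T (u s * v) = u s⁻¹ * T v) :
    ∃ f : L →ₐ[k] L, ∀ s, f (u s) = u s⁻¹ := by
  have hu' (s : S) : T (u s) = u s⁻¹ := by simpa [h1] using hT s 1
  have key : ∀ x ∈ Algebra.adjoin k (Set.range u), ∀ y, T (x * y) = T x * T y := by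
    intro x hx
    induction hx using Algebra.adjoin_induction with
    | mem x hx =>
      obtain ⟨s, rfl⟩ := hx
      intro y
      rw [hT, hu']
    | algebraMap r =>
      intro y
      simp [Algebra.algebraMap_eq_smul_one, h1]
    | add x y _ _ hx hy =>
      intro z
      rw [add_mul, map_add, map_add, add_mul, hx, hy]
    | mul x y _ _ hx hy =>
      intro z
      rw [mul_assoc, hx, hy, hx, mul_assoc]
  exact ⟨AlgHom.ofLinearMap T h1 fun x y => key x (by simp [hu]) y, hu'⟩

variable [Fintype k]

theorem frobeniusAlgHom_pow_apply (n : ℕ) (x : L) :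
    (FiniteField.frobeniusAlgHom k L ^ n) x = x ^ Fintype.card k ^ n := by
  simp [AlgHom.coe_pow, FiniteField.coe_frobeniusAlgHom, pow_iterate]

/-- A generating character on whose values a power of the Frobenius acts as inversion: the square
of that power is the identity. -/
theorem frobeniusAlgHom_pow_two_mul_eq_one (u : S →* L)
    (hu : Algebra.adjoin k (Set.range u) = ⊤) {n : ℕ}
    (hn : ∀ s, u s * u s ^ Fintype.card k ^ n = 1) :
    FiniteField.frobeniusAlgHom k L ^ (2 * n) = 1 := by
  refine AlgHom.ext_of_adjoin_eq_top hu ?_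
  rintro _ ⟨s, rfl⟩
  have h2 : (u s ^ Fintype.card k ^ n) ^ Fintype.card k ^ n = u s := by
    rw [eq_inv_of_mul_eq_one_right (hn s), inv_pow, eq_inv_of_mul_eq_one_right (hn s), inv_inv]
  rw [frobeniusAlgHom_pow_apply, two_mul, pow_add, pow_mul, h2, AlgHom.one_apply]

variable [Finite L]

theorem exists_pow_card_of_algHom (f : L →ₐ[k] L) :
    ∃ n : ℕ, ∀ x, f x = x ^ Fintype.card k ^ n := by
  obtain ⟨n, hn⟩ := (FiniteField.bijective_frobeniusAlgHom_pow k L).2 f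
  refine ⟨n, fun x => ?_⟩
  rw [← hn]
  exact frobeniusAlgHom_pow_apply n x

theorem exists_alternating_of_inv_eq_pow (u : S →* L)
    (hu : Algebra.adjoin k (Set.range u) = ⊤)
    (hn : ∃ n : ℕ, ∀ s, u s * u s ^ Fintype.card k ^ n = 1) (hs : ∃ s, u s * u s ≠ 1) :
    ∃ h : L →ₗ[k] L →ₗ[k] k, (∀ v, h v v = 0) ∧ (∀ v, (∀ w, h v w = 0) → v = 0) ∧
      ∀ s v w, h (u s * v) (u s * w) = h v w := by
  obtain ⟨n, hn⟩ := hn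
  obtain ⟨t, ht⟩ := hs
  set σ : L →ₐ[k] L := FiniteField.frobeniusAlgHom k L ^ n with hσ
  have hσu (s : S) : u s * σ (u s) = 1 := by rw [hσ, frobeniusAlgHom_pow_apply, hn]
  have hσσ (x : L) : σ (σ x) = x := by
    have := DFunLike.congr_fun (frobeniusAlgHom_pow_two_mul_eq_one u hu hn) x
    rwa [two_mul, pow_add, AlgHom.mul_apply, AlgHom.one_apply] at this
  let e : L ≃ₐ[k] L := AlgEquiv.ofAlgHom σ σ (AlgHom.ext hσσ) (AlgHom.ext hσσ)
  have htr (x : L) : Algebra.trace k L (σ x) = Algebra.trace k L x :=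
    Algebra.trace_eq_of_algEquiv e x
  have ha : u t - σ (u t) ≠ 0 := fun h => ht <| by
    have := hσu t
    rwa [← sub_eq_zero.mp h] at this
  refine ⟨(Algebra.traceForm k L).compl₁₂ (LinearMap.mulLeft k (u t - σ (u t))) σ.toLinearMap,
    fun v => ?_, fun v hv => ?_, fun s v w => ?_⟩
  · have := htr (u t * (v * σ v))
    simp only [map_mul, hσσ] at this
    simp only [LinearMap.compl₁₂_apply, LinearMap.mulLeft_apply, Algebra.traceForm_apply,
      AlgHom.toLinearMap_apply]
    rw [sub_mul, sub_mul, map_sub, sub_eq_zero, mul_assoc, ← this, mul_assoc, mul_comm v]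
  · have h0 : (u t - σ (u t)) * v = 0 := by
      refine (traceForm_nondegenerate k L).1 _ fun w => ?_
      simpa [hσσ] using hv (σ w)
    exact (mul_eq_zero.mp h0).resolve_left ha
  · simp only [LinearMap.compl₁₂_apply, LinearMap.mulLeft_apply, Algebra.traceForm_apply,
      AlgHom.toLinearMap_apply, map_mul]
    congr 1
    linear_combination (u t - σ (u t)) * v * σ w * hσu s

theorem inv_eq_pow_of_alternating (u : S →* L)
    (hu : Algebra.adjoin k (Set.range u) = ⊤) (h : L →ₗ[k] L →ₗ[k] k) (halt : ∀ v, h v v = 0)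
    (hnd : ∀ v, (∀ w, h v w = 0) → v = 0) (hinv : ∀ s v w, h (u s * v) (u s * w) = h v w) :
    (∃ n : ℕ, ∀ s, u s * u s ^ Fintype.card k ^ n = 1) ∧ ∃ s, u s * u s ≠ 1 := by
  have hus (s : S) : u s * u s⁻¹ = 1 := by rw [← map_mul, mul_inv_cancel, map_one]
  constructor
  · have hB := traceForm_nondegenerate k L
    let T : L →ₗ[k] L := (LinearMap.BilinForm.toDual _ hB).symm.toLinearMap ∘ₗ h
    have hT (x y : L) : Algebra.trace k L (T x * y) = h x y :=
      LinearMap.BilinForm.apply_toDual_symm_apply (hB := hB) (h x) y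
    have hTu (s : S) (v : L) : T (u s * v) = u s⁻¹ * T v := by
      rw [← sub_eq_zero]
      refine hB.1 _ fun w => ?_
      rw [Algebra.traceForm_apply, sub_mul, map_sub, hT, sub_eq_zero, mul_comm _ (T v), mul_assoc,
        hT, ← hinv s v, ← mul_assoc, hus, one_mul]
    have hc : T 1 ≠ 0 := fun h0 => one_ne_zero <| hnd 1 fun w => by
      rw [← hT, h0, zero_mul, map_zero]
    obtain ⟨f, hf⟩ := exists_algHom_of_map_mul_eq_inv_mul u hu (LinearMap.mulLeft k (T 1)⁻¹ ∘ₗ T)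
      (by simp [hc]) (fun s v => by simp [hTu, mul_left_comm])
    obtain ⟨n, hn⟩ := exists_pow_card_of_algHom f
    exact ⟨n, fun s => by rw [← hn, hf, hus]⟩
  · by_contra! h1
    have hr := finrank_eq_one_of_mul_self_eq_one u hu h1
    refine one_ne_zero (α := L) (hnd 1 fun w => ?_)
    obtain ⟨c, rfl⟩ := (finrank_eq_one_iff_of_nonzero' (1 : L) one_ne_zero).mp hr w
    rw [map_smul, halt, smul_zero]

theorem inv_eq_pow_iff_finrank_eq_two_mul (u : S →* L)
    (hu : Algebra.adjoin k (Set.range u) = ⊤) :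
    ((∃ n : ℕ, ∀ s, u s * u s ^ Fintype.card k ^ n = 1) ∧ ∃ s, u s * u s ≠ 1) ↔
      ∃ d : ℕ, 1 ≤ d ∧ Module.finrank k L = 2 * d ∧
        ∀ s, u s * u s ^ Fintype.card k ^ d = 1 := by
  constructor
  · rintro ⟨⟨n, hn⟩, t, ht⟩
    have h2 : Module.finrank k L ∣ 2 * n := by
      rw [← FiniteField.orderOf_frobeniusAlgHom k L]
      exact orderOf_dvd_of_pow_eq_one (frobeniusAlgHom_pow_two_mul_eq_one u hu hn)
    have h1 : ¬ Module.finrank k L ∣ n := by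
      rw [← FiniteField.orderOf_frobeniusAlgHom k L, orderOf_dvd_iff_pow_eq_one]
      intro h
      have := frobeniusAlgHom_pow_apply (k := k) n (u t)
      rw [h, AlgHom.one_apply] at this
      have h3 := hn t
      rw [← this] at h3
      exact ht h3
    have hpos : 0 < Module.finrank k L := Module.finrank_pos
    have heven : 2 ∣ Module.finrank k L := by
      by_contra hodd
      exact h1 (((Nat.prime_two.coprime_iff_not_dvd.mpr hodd).symm).dvd_of_dvd_mul_left h2)
    obtain ⟨d, hd⟩ := heven
    refine ⟨d, by lia, hd, fun s => ?_⟩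
    rw [hd] at h1 h2
    obtain ⟨j, rfl⟩ := Nat.dvd_of_mul_dvd_mul_left two_pos h2
    obtain ⟨i, rfl | rfl⟩ := Nat.even_or_odd' j
    · exact absurd ⟨i, by ring⟩ h1
    · have hi : FiniteField.frobeniusAlgHom k L ^ (d * (2 * i + 1)) =
          FiniteField.frobeniusAlgHom k L ^ d := by
        rw [show d * (2 * i + 1) = 2 * d * i + d by ring, pow_add, pow_mul, ← hd,
          ← FiniteField.orderOf_frobeniusAlgHom k L, pow_orderOf_eq_one, one_pow, one_mul]
      rw [← frobeniusAlgHom_pow_apply, ← hi, frobeniusAlgHom_pow_apply, hn]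
  · rintro ⟨d, -, hd, h⟩
    refine ⟨⟨d, h⟩, ?_⟩
    by_contra! h1
    have := finrank_eq_one_of_mul_self_eq_one u hu h1
    lia

end FiniteFieldCharacter

section chiField

variable (p : ℕ) [Fact p.Prime] {S : Type*} [Group S] (χ : S →* (AlgebraicClosure (ZMod p))ˣ)

theorem isField_chiField : IsField (chiField p χ) :=
  Subalgebra.isField_of_algebraic _

theorem finite_chiField [Finite S] : Finite (chiField p χ) := by
  have : Module.Finite (ZMod p) (chiField p χ) :=
    Module.Finite.iff_fg.mpr <| fg_adjoin_of_finite (Set.finite_range _)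
      fun x _ => Algebra.IsIntegral.isIntegral x
  exact Module.finite_of_finite (ZMod p)

/-- `χ`, as a multiplicative map to the field generated by its values. -/
noncomputable def chiValHom : S →* chiField p χ where
  toFun := chiVal p χ
  map_one' := Subtype.ext (by simp [chiVal])
  map_mul' s t := Subtype.ext (by simp [chiVal])

theorem adjoin_range_chiValHom : Algebra.adjoin (ZMod p) (Set.range (chiValHom p χ)) = ⊤ := by
  refine Subalgebra.map_injective (f := (chiField p χ).val) Subtype.val_injective ?_
  rw [AlgHom.map_adjoin, Algebra.map_top, Subalgebra.range_val, ← Set.range_comp]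
  rfl

theorem chiValHom_mul_pow_eq_one_iff (s : S) (m : ℕ) :
    chiValHom p χ s * chiValHom p χ s ^ m = 1 ↔ χ s * χ s ^ m = 1 := by
  rw [Subtype.ext_iff, Units.ext_iff]
  simp [chiValHom, chiVal]

end chiField

/-- characterization of the characters `χ` whose associated
representation `𝔽_p(χ)` is symplectic. -/
theorem stmt_9 (p : ℕ) [Fact p.Prime] (S : Type*) [Group S] [Finite S]
    (hScyc : IsCyclic S) (hSord : ¬ p ∣ Nat.card S)
    (χ : S →* (AlgebraicClosure (ZMod p))ˣ) :
    -- (a) ↔ (b)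
    ((∃ h : chiField p χ →ₗ[ZMod p] chiField p χ →ₗ[ZMod p] ZMod p,
        (∀ v, h v v = 0) ∧
        (∀ v, (∀ w, h v w = 0) → v = 0) ∧
        (∀ (s : S) (v w : chiField p χ),
          h (chiVal p χ s * v) (chiVal p χ s * w) = h v w)) ↔
      ((∃ n : ℕ, ∀ s : S, (χ s)⁻¹ = (χ s) ^ (p ^ n)) ∧ χ⁻¹ ≠ χ)) ∧
    -- (b) ↔ (c)
    (((∃ n : ℕ, ∀ s : S, (χ s)⁻¹ = (χ s) ^ (p ^ n)) ∧ χ⁻¹ ≠ χ) ↔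
      (∃ d : ℕ, 1 ≤ d ∧ Module.finrank (ZMod p) (chiField p χ) = 2 * d ∧
        ∀ s : S, (χ s) ^ (1 + p ^ d) = 1)) := by
  let : Field (chiField p χ) := (isField_chiField p χ).toField
  have := finite_chiField p χ
  have hu := adjoin_range_chiValHom p χ
  have hb1 : (∃ n : ℕ, ∀ s : S, (χ s)⁻¹ = (χ s) ^ (p ^ n)) ↔
      ∃ n : ℕ, ∀ s, chiValHom p χ s * chiValHom p χ s ^ Fintype.card (ZMod p) ^ n = 1 := by
    simp only [ZMod.card, chiValHom_mul_pow_eq_one_iff, mul_eq_one_iff_inv_eq]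
  have hb2 : χ⁻¹ ≠ χ ↔ ∃ s, chiValHom p χ s * chiValHom p χ s ≠ 1 := by
    have (s : S) := chiValHom_mul_pow_eq_one_iff p χ s 1
    simp only [pow_one] at this
    simp [this, MonoidHom.ext_iff, mul_eq_one_iff_inv_eq]
  have hc (d : ℕ) : (∀ s : S, (χ s) ^ (1 + p ^ d) = 1) ↔
      ∀ s, chiValHom p χ s * chiValHom p χ s ^ Fintype.card (ZMod p) ^ d = 1 := by
    simp only [ZMod.card, chiValHom_mul_pow_eq_one_iff, pow_add, pow_one]
  simp only [hb1, hb2, hc]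
  refine ⟨⟨?_, ?_⟩, inv_eq_pow_iff_finrank_eq_two_mul (chiValHom p χ) hu⟩
  · rintro ⟨h, halt, hnd, hinv⟩
    exact inv_eq_pow_of_alternating (chiValHom p χ) hu h halt hnd hinv
  · rintro ⟨h1, h2⟩
    exact exists_alternating_of_inv_eq_pow (chiValHom p χ) hu h1 h2
end

section
/- Let p be a prime, S a finite cyclic group of order prime to p, and χ : S → 𝔽̄_p^× a homomorphism such that the representation 𝔽_p(χ) of S is symplectic. Then: (1) every nonzero S-invariant alternating 𝔽_p-bilinear form h on 𝔽_p(χ) is S-anisotropic, i.e., 𝔽_p(χ) has no nonzero S-invariant 𝔽_p-subspace on which h vanishes identically; (2) any two nonzero S-invariant alternating forms h, h' on 𝔽_p(χ) are S-isometric: there is an 𝔽_p-linear S-equivariant bijection g of 𝔽_p(χ) with h'(g(x), g(y)) = h(x,y) for all x, y. -/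
set_option synthInstance.maxHeartbeats 1000000
set_option maxHeartbeats 1000000

/-- Over a finite field, every element fixed by a nontrivial involution is a norm. -/
theorem exists_mul_eq_of_involution {k K : Type*} [Field k] [Field K] [Algebra k K] [Finite K]
    (σ : K ≃ₐ[k] K) (hσ : σ ≠ 1) (hσ2 : σ * σ = 1) {c : K} (hc : σ c = c) :
    ∃ d, σ d * d = c := by
  classical
  have : FiniteDimensional k K := Module.Finite.of_finite
  let H : Subgroup (K ≃ₐ[k] K) := Subgroup.zpowers σ
  have hH : ∀ f ∈ H, f = 1 ∨ f = σ := by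
    rintro f ⟨n, rfl⟩
    have h2 : σ ^ (2 : ℤ) = 1 := by rw [zpow_ofNat, pow_two, hσ2]
    obtain ⟨m, rfl | rfl⟩ := Int.even_or_odd' n
    · exact Or.inl (by simp only [zpow_mul, h2, one_zpow])
    · exact Or.inr (by simp only [zpow_add, zpow_mul, h2, one_zpow, one_mul, zpow_one])
  let L := IntermediateField.fixedField H
  have hcL : c ∈ L := by
    rw [IntermediateField.mem_fixedField_iff]
    intro f hf
    obtain rfl | rfl := hH f hf
    · rfl
    · exact hc
  have : Finite L := Subtype.finite
  let e := IntermediateField.fixingSubgroupEquiv L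
  have hL : L.fixingSubgroup = H := IntermediateField.fixingSubgroup_fixedField H
  let τ : K ≃ₐ[L] K := e ⟨σ, hL ▸ Subgroup.mem_zpowers σ⟩
  have hτ : ∀ x, τ x = σ x := fun _ => rfl
  have huniv : (Finset.univ : Finset (K ≃ₐ[L] K)) = {1, τ} := by
    ext f
    simp only [Finset.mem_univ, Finset.mem_insert, Finset.mem_singleton, true_iff]
    have hf : f.restrictScalars k ∈ H := hL ▸ (e.symm f).2
    refine (hH _ hf).imp ?_ ?_ <;> intro h <;> ext x
    · exact DFunLike.congr_fun h x
    · exact (DFunLike.congr_fun h x).trans (hτ x).symm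
  have hτ1 : (1 : K ≃ₐ[L] K) ≠ τ := by
    intro h
    apply hσ
    ext x
    exact (DFunLike.congr_fun h x).symm
  obtain ⟨d, hd⟩ := FiniteField.norm_surjective L K ⟨c, hcL⟩
  refine ⟨d, ?_⟩
  have := Algebra.norm_eq_prod_automorphisms L d
  rw [hd, huniv, Finset.prod_pair hτ1] at this
  rw [mul_comm]
  exact this.symm

section InvariantForms

variable {k K : Type*} [Field k] [Field K] [Algebra k K] {T : Set K}

theorem mul_mem_of_adjoin_eq_top (hT : Algebra.adjoin k T = ⊤) (U : Submodule k K)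
    (hU : ∀ t ∈ T, ∀ u ∈ U, t * u ∈ U) (a : K) : ∀ u ∈ U, a * u ∈ U := by
  have ha : a ∈ Algebra.adjoin k T := hT ▸ Algebra.mem_top
  induction ha using Algebra.adjoin_induction with
  | mem x hx => exact hU x hx
  | algebraMap r =>
    intro u hu
    rw [← Algebra.smul_def]
    exact U.smul_mem r hu
  | add x y _ _ hx hy =>
    intro u hu
    rw [add_mul]
    exact U.add_mem (hx u hu) (hy u hu)
  | mul x y _ _ hx hy =>
    intro u hu
    rw [mul_assoc]
    exact hx _ (hy u hu)

theorem eq_bot_of_isotropic (hT : Algebra.adjoin k T = ⊤) {h : K →ₗ[k] K →ₗ[k] k} (h0 : h ≠ 0)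
    (U : Submodule k K) (hU : ∀ t ∈ T, ∀ u ∈ U, t * u ∈ U)
    (hiso : ∀ u ∈ U, ∀ w ∈ U, h u w = 0) : U = ⊥ := by
  rw [Submodule.eq_bot_iff]
  intro u hu
  by_contra hu0
  have htop : ∀ x, x ∈ U := fun x => by
    simpa [hu0] using mul_mem_of_adjoin_eq_top hT U hU (x / u) u hu
  exact h0 (LinearMap.ext₂ fun x y => hiso x (htop x) y (htop y))

/-- The inverse of a multiplier preserving a form is its adjoint. -/
theorem form_mul_left_eq {h : K →ₗ[k] K →ₗ[k] k} {t t' : K} (htt : t * t' = 1)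
    (ht : ∀ v w, h (t * v) (t * w) = h v w) (v w : K) : h (t * v) w = h v (t' * w) := by
  rw [← ht v, ← mul_assoc, htt, one_mul]

theorem form_mul_left_eq_of_adjoin_eq_top (hT : Algebra.adjoin k T = ⊤)
    {h : K →ₗ[k] K →ₗ[k] k} (σ : K →ₐ[k] K)
    (hσ : ∀ t ∈ T, ∀ v w, h (t * v) w = h v (σ t * w)) (a v w : K) :
    h (a * v) w = h v (σ a * w) := by
  have ha : a ∈ Algebra.adjoin k T := hT ▸ Algebra.mem_top
  induction ha using Algebra.adjoin_induction generalizing v w with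
  | mem x hx => exact hσ x hx v w
  | algebraMap r => simp [← Algebra.smul_def]
  | add x y _ _ hx hy => simp [add_mul, hx, hy]
  | mul x y _ _ hx hy => rw [mul_assoc, hx, hy, map_mul σ, ← mul_assoc, mul_comm (σ y)]

/-- A nondegenerate form which is invariant under generators of `K` has an adjoint involution. -/
theorem exists_adjoint_algHom (hT : Algebra.adjoin k T = ⊤)
    (hTinv : ∀ t ∈ T, ∃ t' ∈ T, t * t' = 1) {h : K →ₗ[k] K →ₗ[k] k} (halt : ∀ v, h v v = 0)
    (hnd : ∀ v, (∀ w, h v w = 0) → v = 0) (hinv : ∀ t ∈ T, ∀ v w, h (t * v) (t * w) = h v w) :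
    ∃ σ : K →ₐ[k] K, ∀ a v w, h (a * v) w = h v (σ a * w) := by
  have hneg : ∀ x y, h x y = -h y x := fun x y => (LinearMap.IsAlt.neg halt y x).symm
  have hnd' : ∀ x y, (∀ v, h v x = h v y) → x = y := fun x y hxy => by
    refine sub_eq_zero.mp (hnd _ fun w => ?_)
    rw [hneg, map_sub, hxy, sub_self, neg_zero]
  have key : ∀ a : K, ∃ b, ∀ v w, h (a * v) w = h v (b * w) := fun a => by
    have ha : a ∈ Algebra.adjoin k T := hT ▸ Algebra.mem_top
    induction ha using Algebra.adjoin_induction with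
    | mem x hx =>
      obtain ⟨x', -, hxx⟩ := hTinv x hx
      exact ⟨x', form_mul_left_eq hxx (hinv x hx)⟩
    | algebraMap r => exact ⟨algebraMap k K r, fun v w => by simp [← Algebra.smul_def]⟩
    | add x y _ _ hx hy =>
      obtain ⟨x', hx⟩ := hx
      obtain ⟨y', hy⟩ := hy
      exact ⟨x' + y', fun v w => by simp [add_mul, hx, hy]⟩
    | mul x y _ _ hx hy =>
      obtain ⟨x', hx⟩ := hx
      obtain ⟨y', hy⟩ := hy
      exact ⟨y' * x', fun v w => by rw [mul_assoc, hx, hy, mul_assoc]⟩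
  choose σ hσ using key
  have huniq : ∀ a b, (∀ v w, h (a * v) w = h v (b * w)) → σ a = b := fun a b hab => by
    refine hnd' _ _ fun v => ?_
    simpa [hσ] using hab v 1
  have hone : σ 1 = 1 := huniq _ _ fun v w => by simp
  refine ⟨AlgHom.ofLinearMap
    { toFun := σ
      map_add' := fun x y => huniq _ _ fun v w => by simp [add_mul, hσ]
      map_smul' := fun r x => huniq _ _ fun v w => by simp [hσ] } hone fun x y => ?_, hσ⟩
  exact huniq _ _ fun v w => by
    rw [mul_assoc, hσ, hσ, ← mul_assoc, mul_comm (σ y)]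
    rfl

theorem ker_eq_bot_of_invariant (hT : Algebra.adjoin k T = ⊤)
    (hTinv : ∀ t ∈ T, ∃ t' ∈ T, t * t' = 1) {h : K →ₗ[k] K →ₗ[k] k} (h0 : h ≠ 0)
    (hinv : ∀ t ∈ T, ∀ v w, h (t * v) (t * w) = h v w) : LinearMap.ker h = ⊥ := by
  refine eq_bot_of_isotropic hT h0 _ (fun t ht u hu => ?_) fun u hu w _ => ?_
  · obtain ⟨t', -, htt⟩ := hTinv t ht
    rw [LinearMap.mem_ker] at hu ⊢
    ext w
    rw [form_mul_left_eq htt (hinv t ht), hu]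
    rfl
  · rw [LinearMap.mem_ker.mp hu]
    rfl

theorem exists_isometry [Finite K] (hT : Algebra.adjoin k T = ⊤)
    (hTinv : ∀ t ∈ T, ∃ t' ∈ T, t * t' = 1) {h h' : K →ₗ[k] K →ₗ[k] k}
    (halt : ∀ v, h v v = 0) (hinv : ∀ t ∈ T, ∀ v w, h (t * v) (t * w) = h v w) (h0 : h ≠ 0)
    (halt' : ∀ v, h' v v = 0) (hinv' : ∀ t ∈ T, ∀ v w, h' (t * v) (t * w) = h' v w)
    (h0' : h' ≠ 0) :
    ∃ d : K, d ≠ 0 ∧ ∀ x y, h' (d * x) (d * y) = h x y := by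
  have : FiniteDimensional k K := Module.Finite.of_finite
  have hker' := ker_eq_bot_of_invariant hT hTinv h0' hinv'
  have hnd' : ∀ v, (∀ w, h' v w = 0) → v = 0 := fun v hv =>
    (LinearMap.ker_eq_bot'.mp hker') v (LinearMap.ext hv)
  have hneg' : ∀ x y, h' x y = -h' y x := fun x y => (LinearMap.IsAlt.neg halt' y x).symm
  have hneg : ∀ x y, h x y = -h y x := fun x y => (LinearMap.IsAlt.neg halt y x).symm
  obtain ⟨σ, hσ'⟩ := exists_adjoint_algHom hT hTinv halt' hnd' hinv'
  have hσT : ∀ t ∈ T, ∀ t', t * t' = 1 → σ t = t' := fun t ht t' htt => by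
    refine sub_eq_zero.mp (hnd' _ fun w => ?_)
    rw [hneg', neg_eq_zero, map_sub, sub_eq_zero]
    have h1 := hσ' t w 1
    have h2 := form_mul_left_eq htt (hinv' t ht) w 1
    rw [mul_one] at h1 h2
    exact h1.symm.trans h2
  have hσ : ∀ a v w, h (a * v) w = h v (σ a * w) :=
    form_mul_left_eq_of_adjoin_eq_top hT σ fun t ht => by
      obtain ⟨t', -, htt⟩ := hTinv t ht
      rw [hσT t ht t' htt]
      exact form_mul_left_eq htt (hinv t ht)
  have hσσ : σ.comp σ = AlgHom.id k K := AlgHom.ext_of_adjoin_eq_top hT fun t ht => by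
    obtain ⟨t', ht', htt⟩ := hTinv t ht
    simp [hσT t ht t' htt, hσT t' ht' t (mul_comm t t' ▸ htt)]
  let e : K ≃ₐ[k] K := AlgEquiv.ofAlgHom σ σ hσσ hσσ
  have he1 : e ≠ 1 := fun he => by
    have hσ1 : ∀ t, σ t = t := fun t => DFunLike.congr_fun he t
    have hle : Algebra.adjoin k T ≤ ⊥ := Algebra.adjoin_le fun t ht => by
      obtain ⟨t', -, htt⟩ := hTinv t ht
      have : t = t' := (hσ1 t).symm.trans (hσT t ht t' htt)
      subst this
      obtain rfl | rfl := mul_self_eq_one_iff.mp htt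
      · exact one_mem _
      · exact neg_mem (one_mem _)
    refine h0 (LinearMap.ext₂ fun x y => ?_)
    obtain ⟨r, rfl⟩ := Algebra.mem_bot.mp (hle (hT ▸ Algebra.mem_top : x ∈ Algebra.adjoin k T))
    obtain ⟨s, rfl⟩ := Algebra.mem_bot.mp (hle (hT ▸ Algebra.mem_top : y ∈ Algebra.adjoin k T))
    simp [Algebra.algebraMap_eq_smul_one, halt]
  obtain ⟨c, hc⟩ : ∃ c, h' c = h 1 := by
    have hinj : Function.Injective h' := LinearMap.ker_eq_bot.mp hker'
    have hfr : Module.finrank k K = Module.finrank k (K →ₗ[k] k) :=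
      (Subspace.dual_finrank_eq (K := k) (V := K)).symm
    exact (LinearMap.injective_iff_surjective_of_finrank_eq_finrank hfr).mp hinj (h 1)
  have hch : ∀ x y, h' (c * x) y = h x y := fun x y => by
    rw [mul_comm, hσ', hc, ← hσ, mul_one]
  have hσc : σ c = c := by
    refine mul_right_cancel₀ one_ne_zero (sub_eq_zero.mp (hnd' (σ c * 1 - c * 1) fun w => ?_))
    rw [map_sub, LinearMap.sub_apply, hch, hneg', ← hσ', hch, hneg 1 w, sub_self]
  obtain ⟨d, hd⟩ := exists_mul_eq_of_involution e he1 (AlgEquiv.ext fun x =>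
    DFunLike.congr_fun hσσ x) (c := c) hσc
  have hdh : ∀ x y, h' (d * x) (d * y) = h x y := fun x y => by
    have hde : σ (σ d) = d := DFunLike.congr_fun hσσ d
    have hd' : σ d * d = c := hd
    rw [← hch x y, ← hd', mul_assoc, hσ' (σ d), hde]
  refine ⟨d, ?_, hdh⟩
  rintro rfl
  exact h0 (LinearMap.ext₂ fun x y => by simp [← hdh x y])

end InvariantForms

theorem chiVal_mul_inv (p : ℕ) [Fact p.Prime] {S : Type*} [Group S]
    (χ : S →* (AlgebraicClosure (ZMod p))ˣ) (s : S) : chiVal p χ s * chiVal p χ s⁻¹ = 1 :=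
  Subtype.ext (by simp [chiVal])

theorem adjoin_range_chiVal (p : ℕ) [Fact p.Prime] {S : Type*} [Group S]
    (χ : S →* (AlgebraicClosure (ZMod p))ˣ) :
    Algebra.adjoin (ZMod p) (Set.range (chiVal p χ)) = ⊤ := by
  refine Eq.trans ?_ (Algebra.adjoin_adjoin_coe_preimage (R := ZMod p)
    (s := Set.range fun s => (χ s : AlgebraicClosure (ZMod p))))
  congr 1
  ext x
  constructor
  · rintro ⟨s, rfl⟩
    exact ⟨s, rfl⟩
  · rintro ⟨s, hs⟩
    exact ⟨s, Subtype.ext hs⟩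

theorem finite_chiField_s10 (p : ℕ) [Fact p.Prime] {S : Type*} [Group S] [Finite S]
    (χ : S →* (AlgebraicClosure (ZMod p))ˣ) : Finite (chiField p χ) := by
  have : Module.Finite (ZMod p) (chiField p χ) :=
    Algebra.finite_adjoin_of_finite_of_isIntegral (Set.finite_range _)
      fun x _ => Algebra.IsIntegral.isIntegral x
  exact Module.finite_of_finite (ZMod p)

/-- if `𝔽_p(χ)` is symplectic then every nonzero invariant
alternating form on it is anisotropic, and any two such forms are isometric. -/
theorem stmt_10 (p : ℕ) [Fact p.Prime] (S : Type*) [Group S] [Finite S]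
    (hScyc : IsCyclic S) (hSord : ¬ p ∣ Nat.card S)
    (χ : S →* (AlgebraicClosure (ZMod p))ˣ)
    -- 𝔽_p(χ) is symplectic
    (hsymp : ∃ h : chiField p χ →ₗ[ZMod p] chiField p χ →ₗ[ZMod p] ZMod p,
      (∀ v, h v v = 0) ∧
      (∀ v, (∀ w, h v w = 0) → v = 0) ∧
      (∀ (s : S) (v w : chiField p χ),
        h (chiVal p χ s * v) (chiVal p χ s * w) = h v w)) :
    -- (1) every nonzero S-invariant alternating form is S-anisotropic
    (∀ h : chiField p χ →ₗ[ZMod p] chiField p χ →ₗ[ZMod p] ZMod p,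
      h ≠ 0 → (∀ v, h v v = 0) →
      (∀ (s : S) (v w : chiField p χ),
        h (chiVal p χ s * v) (chiVal p χ s * w) = h v w) →
      ∀ U : Submodule (ZMod p) (chiField p χ),
        (∀ s : S, ∀ u ∈ U, chiVal p χ s * u ∈ U) →
        (∀ u ∈ U, ∀ w ∈ U, h u w = 0) → U = ⊥) ∧
    -- (2) any two nonzero S-invariant alternating forms are S-isometric
    (∀ h h' : chiField p χ →ₗ[ZMod p] chiField p χ →ₗ[ZMod p] ZMod p,
      h ≠ 0 → (∀ v, h v v = 0) →
      (∀ (s : S) (v w : chiField p χ),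
        h (chiVal p χ s * v) (chiVal p χ s * w) = h v w) →
      h' ≠ 0 → (∀ v, h' v v = 0) →
      (∀ (s : S) (v w : chiField p χ),
        h' (chiVal p χ s * v) (chiVal p χ s * w) = h' v w) →
      ∃ g : chiField p χ ≃ₗ[ZMod p] chiField p χ,
        (∀ (s : S) (x : chiField p χ), g (chiVal p χ s * x) = chiVal p χ s * g x) ∧
        (∀ x y : chiField p χ, h' (g x) (g y) = h x y)) := by
  have := finite_chiField_s10 p χ
  let : Field (chiField p χ) := (Finite.isField_of_domain (chiField p χ)).toField
  have hT := adjoin_range_chiVal p χ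
  have hTinv : ∀ t ∈ Set.range (chiVal p χ), ∃ t' ∈ Set.range (chiVal p χ), t * t' = 1 := by
    rintro _ ⟨s, rfl⟩
    exact ⟨_, ⟨s⁻¹, rfl⟩, chiVal_mul_inv p χ s⟩
  refine ⟨fun h h0 _ _ U hU hiso => ?_, fun h h' h0 halt hinv h0' halt' hinv' => ?_⟩
  · exact eq_bot_of_isotropic hT h0 U (Set.forall_mem_range.mpr hU) hiso
  · obtain ⟨d, hd0, hd⟩ := exists_isometry hT hTinv halt (Set.forall_mem_range.mpr hinv) h0
      halt' (Set.forall_mem_range.mpr hinv') h0'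
    refine ⟨LinearEquiv.ofBijective (LinearMap.mulLeft (ZMod p) d)
      ⟨mul_right_injective₀ hd0, fun y => ⟨d⁻¹ * y, mul_inv_cancel_left₀ hd0 y⟩⟩,
      fun s x => mul_left_comm _ _ _, hd⟩
end

section
/- Let p be a prime and S a finite cyclic group of order prime to p. A finite-dimensional 𝔽_p-representation U of S admits a nondegenerate S-invariant alternating 𝔽_p-bilinear form that is S-anisotropic if and only if there exist an integer r ≥ 0 and homomorphisms χ_1, …, χ_r : S → 𝔽̄_p^× such that: (a) each representation 𝔽_p(χ_j) is symplectic; (b) for i ≠ j, χ_i is not equal to χ_j composed with any power of the Frobenius x ↦ x^p; and (c) U is isomorphic, as an 𝔽_p-representation of S, to the direct sum of the 𝔽_p(χ_j), 1 ≤ j ≤ r. -/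
set_option synthInstance.maxHeartbeats 1000000
set_option maxHeartbeats 1000000

open Polynomial

/-- An algebra endomorphism of a finite field of characteristic `p` is a power of Frobenius. -/
lemma exists_eq_pow_of_algHom (p : ℕ) [Fact p.Prime] {F : Type*} [Field F] [Finite F]
    [Algebra (ZMod p) F] (σ : F →ₐ[ZMod p] F) :
    ∃ n < Module.finrank (ZMod p) F, σ = FiniteField.frobeniusAlgHom (ZMod p) F ^ n ∧
      ∀ x, σ x = x ^ p ^ n := by
  obtain ⟨n, hn⟩ := (FiniteField.bijective_frobeniusAlgHom_pow (ZMod p) F).2 σ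
  refine ⟨n, n.2, hn.symm, fun x => ?_⟩
  rw [← hn]
  simp [AlgHom.coe_pow, FiniteField.coe_frobeniusAlgHom, pow_iterate, ZMod.card]

/-- Surjectivity of the norm onto the fixed field of an involution of a finite field. -/
lemma exists_mul_involution_eq (p : ℕ) [Fact p.Prime] {F : Type*} [Field F] [Finite F]
    [Algebra (ZMod p) F] (σ : F →ₐ[ZMod p] F) (hσ : ∀ x, σ (σ x) = x) (hne : ∃ x, σ x ≠ x)
    {t : F} (ht : σ t = t) : ∃ c, c * σ c = t := by
  have hp : p.Prime := Fact.out
  obtain ⟨n, hn, hfrob, hpow⟩ := exists_eq_pow_of_algHom p σ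
  have hn0 : n ≠ 0 := by
    rintro rfl
    obtain ⟨x, hx⟩ := hne
    exact hx (by simpa using hpow x)
  have hdvd : Module.finrank (ZMod p) F ∣ 2 * n := by
    rw [← FiniteField.orderOf_frobeniusAlgHom (ZMod p) F, orderOf_dvd_iff_pow_eq_one, mul_comm,
      pow_mul, ← hfrob, pow_two]
    ext x
    simpa using hσ x
  have hf : Module.finrank (ZMod p) F = 2 * n := by
    obtain ⟨k, hk⟩ := hdvd
    rcases k with _ | _ | k
    · omega
    · omega
    · nlinarith
  have hcard : Nat.card F = p ^ (2 * n) := by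
    rw [Module.natCard_eq_pow_finrank (K := ZMod p), hf, Nat.card_zmod]
  rcases eq_or_ne t 0 with rfl | ht0
  · exact ⟨0, by simp⟩
  obtain ⟨γ, hγ⟩ := IsCyclic.exists_generator (α := Fˣ)
  obtain ⟨a, ha⟩ := mem_powers_iff_mem_zpowers.mpr (hγ (Units.mk0 t ht0))
  have hord : orderOf γ = (p ^ n - 1) * (p ^ n + 1) := by
    rw [orderOf_eq_card_of_forall_mem_zpowers hγ, Nat.card_units, hcard, mul_comm 2, pow_mul,
      mul_comm (_ - 1)]
    simpa using Nat.sq_sub_sq (p ^ n) 1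
  have hpn : 1 < p ^ n := Nat.one_lt_pow hn0 hp.one_lt
  have h1 : γ ^ (a * (p ^ n - 1)) = 1 := by
    rw [pow_mul, show γ ^ a = Units.mk0 t ht0 from ha]
    have h2 : Units.mk0 t ht0 ^ p ^ n = Units.mk0 t ht0 := by
      ext
      simpa [ht] using (hpow t).symm
    have h3 : Units.mk0 t ht0 ^ (p ^ n - 1) * Units.mk0 t ht0 = 1 * Units.mk0 t ht0 := by
      rw [← pow_succ, Nat.sub_add_cancel hpn.le, h2, one_mul]
    exact mul_right_cancel h3
  have h2 : (p ^ n + 1) ∣ a := by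
    have := orderOf_dvd_of_pow_eq_one h1
    rw [hord, mul_comm a] at this
    exact Nat.dvd_of_mul_dvd_mul_left (by omega) this
  obtain ⟨b, rfl⟩ := h2
  refine ⟨(γ ^ b : Fˣ), ?_⟩
  have h4 : (γ ^ b) ^ (p ^ n + 1) = Units.mk0 t ht0 := by
    rw [← pow_mul, mul_comm b]
    exact ha
  rw [hpow, ← pow_succ', ← Units.val_pow_eq_pow_val, h4, Units.val_mk0]

/-- Two elements of an algebraic extension of `𝔽_p` with the same minimal polynomial are conjugate
under a power of Frobenius. -/
lemma exists_eq_pow_of_aeval_minpoly (p : ℕ) [Fact p.Prime] {K : Type*} [Field K]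
    [Algebra (ZMod p) K] [Normal (ZMod p) K] {a b : K} (h : aeval b (minpoly (ZMod p) a) = 0) :
    ∃ n, b = a ^ p ^ n := by
  have hint : IsIntegral (ZMod p) a := Algebra.IsIntegral.isIntegral a
  have hc := (isConjRoot_iff_aeval_eq_zero hint).2 h
  obtain ⟨σ, hσ⟩ := isConjRoot_iff_exists_algEquiv.1 hc.symm
  let L := IntermediateField.adjoin (ZMod p) {a}
  have : FiniteDimensional (ZMod p) L := IntermediateField.adjoin.finiteDimensional hint
  have : Finite L := Module.finite_of_finite (ZMod p)
  obtain ⟨n, -, -, hn⟩ := exists_eq_pow_of_algHom p (σ.restrictNormal L : L →ₐ[ZMod p] L)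
  have ha := hn ⟨a, IntermediateField.mem_adjoin_simple_self _ a⟩
  refine ⟨n, ?_⟩
  have h2 := AlgEquiv.restrictNormal_commutes σ L ⟨a, IntermediateField.mem_adjoin_simple_self _ a⟩
  rw [← hσ]
  refine h2.symm.trans ?_
  have h3 := congrArg (algebraMap L K) ha
  rw [map_pow] at h3
  exact h3

lemma aeval_semiconj {R V V' : Type*} [CommRing R] [AddCommGroup V] [Module R V]
    [AddCommGroup V'] [Module R V'] {T : Module.End R V} {T' : Module.End R V'} {f : V →ₗ[R] V'}
    (hf : ∀ x, f (T x) = T' (f x)) (P : R[X]) (x : V) : f (aeval T P x) = aeval T' P (f x) := by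
  induction P using Polynomial.induction_on' with
  | add P Q hP hQ => simp [hP, hQ]
  | monomial n r =>
    have : ∀ n : ℕ, f ((T ^ n) x) = (T' ^ n) (f x) := by
      intro n
      induction n with
      | zero => simp
      | succ n ih => rw [pow_succ', pow_succ', Module.End.mul_apply, Module.End.mul_apply, hf, ih]
    simp [aeval_monomial, Algebra.algebraMap_eq_smul_one, this]

lemma aeval_lmul_apply {R A : Type*} [CommRing R] [CommRing A] [Algebra R A] (a : A) (P : R[X])
    (x : A) : aeval (Algebra.lmul R A a) P x = aeval a P * x := by
  rw [aeval_algHom_apply]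
  rfl

lemma form_aeval {p : ℕ} [Fact p.Prime] {F : Type*} [Field F] [Algebra (ZMod p) F] {a : F}
    (ha : a ≠ 0) {B : F →ₗ[ZMod p] F →ₗ[ZMod p] ZMod p}
    (hB : ∀ x y, B (a * x) (a * y) = B x y) (P : (ZMod p)[X]) (x y : F) :
    B (aeval a P * x) y = B x (aeval a⁻¹ P * y) := by
  have hB' : ∀ x y, B (a * x) y = B x (a⁻¹ * y) := fun x y => by
    rw [← hB x, mul_inv_cancel_left₀ ha]
  have h1 : ∀ (n : ℕ) x y, B (a ^ n * x) y = B x (a⁻¹ ^ n * y) := by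
    intro n
    induction n with
    | zero => simp
    | succ n ih =>
      intro x y
      rw [pow_succ', mul_assoc, hB', ih, pow_succ, mul_assoc]
  induction P using Polynomial.induction_on' with
  | add P Q hP hQ => simp only [map_add, add_mul, LinearMap.add_apply, hP, hQ]
  | monomial n r =>
    simp only [aeval_monomial, Algebra.algebraMap_eq_smul_one, smul_mul_assoc, one_mul, map_smul,
      LinearMap.smul_apply, h1]

/-- Any two nonzero invariant alternating forms on `𝔽_p(a)` differ by a sign after rescaling the
variables of one of them by a common constant `c`. -/
lemma exists_scaling_add_eq_zero (p : ℕ) [Fact p.Prime] {F : Type*} [Field F] [Finite F]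
    [Algebra (ZMod p) F] {a : F} (ha : a ≠ 0) (hgen : ∀ x : F, ∃ P : (ZMod p)[X], aeval a P = x)
    {B₁ B₂ : F →ₗ[ZMod p] F →ₗ[ZMod p] ZMod p}
    (alt₁ : ∀ x, B₁ x x = 0) (inv₁ : ∀ x y, B₁ (a * x) (a * y) = B₁ x y) (ne₁ : B₁ ≠ 0)
    (inv₂ : ∀ x y, B₂ (a * x) (a * y) = B₂ x y) (alt₂ : ∀ x, B₂ x x = 0) (ne₂ : B₂ ≠ 0) :
    ∃ c, ∀ x y, B₁ x y + B₂ (c * x) (c * y) = 0 := by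
  have hne : ∀ {B : F →ₗ[ZMod p] F →ₗ[ZMod p] ZMod p},
      (∀ x y, B (a * x) (a * y) = B x y) → B ≠ 0 → B 1 ≠ 0 := by
    intro B hB h0 h1
    apply h0
    ext x y
    obtain ⟨P, rfl⟩ := hgen x
    rw [← mul_one (aeval a P), form_aeval ha hB, h1]
    simp
  have hroot : aeval a⁻¹ (minpoly (ZMod p) a) = 0 := by
    by_contra h
    refine hne inv₁ ne₁ (LinearMap.ext fun y => ?_)
    have := form_aeval ha inv₁ (minpoly (ZMod p) a) 1 ((aeval a⁻¹ (minpoly (ZMod p) a))⁻¹ * y)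
    rw [mul_inv_cancel_left₀ h, minpoly.aeval] at this
    simpa using this.symm
  obtain ⟨σ, hσ⟩ := isConjRoot_iff_exists_algEquiv.1
    ((isConjRoot_iff_aeval_eq_zero (Algebra.IsIntegral.isIntegral a)).2 hroot).symm
  have hσa : ∀ P : (ZMod p)[X], σ (aeval a P) = aeval a⁻¹ P := fun P => by
    rw [← aeval_algHom_apply, hσ]
  have hσσ : ∀ x, σ (σ x) = x := fun x => by
    obtain ⟨P, rfl⟩ := hgen x
    rw [hσa, ← aeval_algHom_apply, map_inv₀, hσ, inv_inv]
  have hform : ∀ {B : F →ₗ[ZMod p] F →ₗ[ZMod p] ZMod p},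
      (∀ x y, B (a * x) (a * y) = B x y) → ∀ x y, B x y = B 1 (σ x * y) := by
    intro B hB x y
    obtain ⟨P, rfl⟩ := hgen x
    rw [hσa, ← form_aeval ha hB, mul_one]
  have hskew : ∀ {B : F →ₗ[ZMod p] F →ₗ[ZMod p] ZMod p},
      (∀ x y, B (a * x) (a * y) = B x y) → (∀ x, B x x = 0) → ∀ y, B 1 (σ y) = - B 1 y := by
    intro B hB hB' y
    have h1 := hB' (1 + y)
    simp only [map_add, LinearMap.add_apply, hB', zero_add, add_zero] at h1
    rw [hform hB y 1, mul_one] at h1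
    exact eq_neg_of_add_eq_zero_left (by simpa [add_comm] using h1)
  have hsep : ∀ z, (∀ y, B₂ 1 (z * y) = 0) → z = 0 := by
    intro z hz
    by_contra h0
    refine hne inv₂ ne₂ (LinearMap.ext fun y => ?_)
    simpa [mul_inv_cancel_left₀ h0] using hz (z⁻¹ * y)
  obtain ⟨t, ht⟩ : ∃ t, ∀ y, B₁ 1 y = - B₂ 1 (t * y) := by
    let D : F →ₗ[ZMod p] Module.Dual (ZMod p) F :=
      (LinearMap.mul (ZMod p) F).compr₂ (B₂ 1)
    have hinj : Function.Injective D := by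
      rw [← LinearMap.ker_eq_bot, LinearMap.ker_eq_bot']
      intro z hz
      exact hsep z fun y => by simpa [D] using LinearMap.congr_fun hz y
    obtain ⟨t, ht⟩ := (LinearMap.injective_iff_surjective_of_finrank_eq_finrank
      Subspace.dual_finrank_eq.symm).1 hinj (- B₁ 1)
    refine ⟨t, fun y => ?_⟩
    have := LinearMap.congr_fun ht y
    simp only [D, LinearMap.compr₂_apply, LinearMap.mul_apply', LinearMap.neg_apply] at this
    rw [this, neg_neg]
  have hσt : σ t = t := by
    rw [← sub_eq_zero]
    refine hsep _ fun y => ?_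
    have h1 := hskew inv₁ alt₁ y
    rw [ht, ht] at h1
    have h2 := hskew inv₂ alt₂ (t * σ y)
    rw [map_mul, hσσ] at h2
    rw [sub_mul, map_sub, h2]
    linear_combination h1
  obtain ⟨c, hc⟩ : ∃ c, c * σ c = t := by
    by_cases hid : ∃ x, σ x ≠ x
    · exact exists_mul_involution_eq p (σ : F →ₐ[ZMod p] F) hσσ hid hσt
    · push Not at hid
      have : CharP F p := charP_of_injective_algebraMap (algebraMap (ZMod p) F).injective p
      rcases eq_or_ne p 2 with hp2 | hp2
      · obtain ⟨c, hc⟩ := FiniteField.isSquare_of_char_two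
          ((ringChar.eq F p).trans hp2) t
        exact ⟨c, by rw [hid, hc]⟩
      · exfalso
        refine hne inv₁ ne₁ (LinearMap.ext fun y => ?_)
        have h1 := hskew inv₁ alt₁ y
        rw [hid] at h1
        have h2 : (2 : ZMod p) ≠ 0 := by
          exact Ring.two_ne_zero (by rwa [ZMod.ringChar_zmod_n])
        have h3 : (2 : ZMod p) * B₁ 1 y = 0 := by linear_combination h1
        simpa [h2] using h3
  refine ⟨c, fun x y => ?_⟩
  rw [hform inv₁ x y, hform inv₂ (c * x), ht, map_mul σ, ← hc,
    show σ c * σ x * (c * y) = c * σ c * (σ x * y) by ring, neg_add_cancel]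

/-- `h` is an alternating `T`-invariant form without nonzero `T`-stable isotropic subspaces. -/
structure IsAnisotropic {k U : Type*} [Field k] [AddCommGroup U] [Module k U]
    (T : Module.End k U) (h : U →ₗ[k] U →ₗ[k] k) : Prop where
  alt : ∀ v, h v v = 0
  inv : ∀ v w, h (T v) (T w) = h v w
  eq_bot : ∀ W : Submodule k U,
    (∀ u ∈ W, T u ∈ W) → (∀ u ∈ W, ∀ w ∈ W, h u w = 0) → W = ⊥

namespace IsAnisotropic

section

variable {k U : Type*} [Field k] [AddCommGroup U] [Module k U]
  {T : Module.End k U} {h : U →ₗ[k] U →ₗ[k] k}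

lemma neg (hh : IsAnisotropic T h) (v w : U) : h v w = - h w v :=
  (LinearMap.IsAlt.neg (B := h) hh.alt w v).symm

lemma restrict (hh : IsAnisotropic T h) {V : Submodule k U} (hV : ∀ v ∈ V, T v ∈ V) :
    IsAnisotropic (T.restrict hV) (h.compl₁₂ V.subtype V.subtype) where
  alt v := hh.alt v
  inv v w := hh.inv v w
  eq_bot W hW hiso := by
    have := hh.eq_bot (W.map V.subtype)
      (by
        rintro _ ⟨u, hu, rfl⟩
        exact ⟨_, hW u hu, rfl⟩)
      (by
        rintro _ ⟨u, hu, rfl⟩ _ ⟨w, hw, rfl⟩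
        exact hiso u hu w hw)
    exact Submodule.map_injective_of_injective V.injective_subtype
      (this.trans (Submodule.map_bot _).symm)

variable {F : Type*} [Field F] [Algebra k F] {a : F} {i : F →ₗ[k] U}

lemma range_stable (hi : ∀ x, i (a * x) = T (i x)) : ∀ u ∈ LinearMap.range i,
    T u ∈ LinearMap.range i := by
  rintro _ ⟨x, rfl⟩
  exact ⟨a * x, hi x⟩

/-- The orthogonal of the image of an equivariant map is stable. -/
lemma orthogonal_stable (hh : IsAnisotropic T h) (ha : a ≠ 0) (hi : ∀ x, i (a * x) = T (i x)) :
    ∀ v ∈ LinearMap.ker (h.comp i).flip, T v ∈ LinearMap.ker (h.comp i).flip := by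
  intro v hv
  ext x
  have h1 : h (i (a⁻¹ * x)) v = 0 := LinearMap.congr_fun hv (a⁻¹ * x)
  rw [← hh.inv, ← hi, mul_inv_cancel_left₀ ha] at h1
  exact h1

lemma eq_zero_of_forall (hh : IsAnisotropic T h) (ha : a ≠ 0) (hi : ∀ x, i (a * x) = T (i x))
    (hinj : Function.Injective i) {x : F} (hx : ∀ y, h (i y) (i x) = 0) : x = 0 := by
  have hbot := hh.eq_bot (LinearMap.range i ⊓ LinearMap.ker (h.comp i).flip)
    (fun u hu => ⟨range_stable hi u hu.1, hh.orthogonal_stable ha hi u hu.2⟩)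
    (by
      rintro _ ⟨⟨y, rfl⟩, -⟩ w ⟨-, hw⟩
      exact LinearMap.congr_fun hw y)
  have hmem : i x ∈ LinearMap.range i ⊓ LinearMap.ker (h.comp i).flip :=
    ⟨⟨x, rfl⟩, LinearMap.ext hx⟩
  rw [hbot, Submodule.mem_bot] at hmem
  exact hinj (by rw [hmem, map_zero])

/-- The image of an equivariant embedding is an orthogonal direct summand. -/
lemma bijective_coprod (hh : IsAnisotropic T h) [FiniteDimensional k F] (ha : a ≠ 0)
    (hi : ∀ x, i (a * x) = T (i x)) (hinj : Function.Injective i) :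
    Function.Bijective (i.coprod (LinearMap.ker (h.comp i).flip).subtype) := by
  have hker : ∀ x, (∀ y, h (i y) (i x) = 0) → x = 0 := fun x =>
    hh.eq_zero_of_forall ha hi hinj
  constructor
  · rw [← LinearMap.ker_eq_bot, LinearMap.ker_eq_bot']
    rintro ⟨x, v, hv⟩ hxv
    have hxv' : i x + v = 0 := hxv
    have hx : x = 0 := by
      refine hker x fun y => ?_
      have : h (i y) v = 0 := LinearMap.congr_fun hv y
      rw [eq_neg_of_add_eq_zero_left hxv', map_neg, this, neg_zero]
    subst hx
    rw [map_zero, zero_add] at hxv'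
    simp [hxv']
  · intro u
    have hinj' : Function.Injective ((h.comp i).flip.comp i) := by
      rw [← LinearMap.ker_eq_bot, LinearMap.ker_eq_bot']
      exact fun x hx => hker x fun y => LinearMap.congr_fun hx y
    obtain ⟨x, hx⟩ := (LinearMap.injective_iff_surjective_of_finrank_eq_finrank
      (Subspace.dual_finrank_eq (K := k) (V := F)).symm).1 hinj' ((h.comp i).flip u)
    refine ⟨(x, ⟨u - i x, ?_⟩), ?_⟩
    · rw [LinearMap.mem_ker, map_sub, sub_eq_zero]
      exact hx.symm
    · simp

end

variable {p : ℕ} [Fact p.Prime] {U F : Type*} [AddCommGroup U] [Module (ZMod p) U]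
  {T : Module.End (ZMod p) U} {h : U →ₗ[ZMod p] U →ₗ[ZMod p] ZMod p} [Field F] [Finite F]
  [Algebra (ZMod p) F] {a : F} {i k : F →ₗ[ZMod p] U}

/-- A simple constituent cannot be embedded twice orthogonally. -/
lemma false_of_orthogonal (hh : IsAnisotropic T h) (ha : a ≠ 0)
    (hgen : ∀ x : F, ∃ P : (ZMod p)[X], aeval a P = x)
    (hi : ∀ x, i (a * x) = T (i x)) (hinj : Function.Injective i)
    (hk : ∀ x, k (a * x) = T (k x)) (kinj : Function.Injective k)
    (orth : ∀ x y, h (i x) (k y) = 0) : False := by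
  have ne : ∀ {i : F →ₗ[ZMod p] U}, (∀ x, i (a * x) = T (i x)) → Function.Injective i →
      h.compl₁₂ i i ≠ 0 := by
    intro i hi hinj h0
    exact one_ne_zero (hh.eq_zero_of_forall ha hi hinj (x := (1 : F)) fun y =>
      LinearMap.congr_fun₂ h0 y 1)
  have inv : ∀ {i : F →ₗ[ZMod p] U}, (∀ x, i (a * x) = T (i x)) →
      ∀ x y, h.compl₁₂ i i (a * x) (a * y) = h.compl₁₂ i i x y := by
    intro i hi x y
    simp only [LinearMap.compl₁₂_apply, hi, hh.inv]
  obtain ⟨c, hc⟩ := exists_scaling_add_eq_zero p ha hgen (fun x => hh.alt (i x)) (inv hi)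
    (ne hi hinj) (inv hk) (fun x => hh.alt (k x)) (ne hk kinj)
  have hbot := hh.eq_bot (LinearMap.range (i + k.comp (LinearMap.mulLeft (ZMod p) c)))
    (range_stable (a := a) fun x => by simp [hi, ← hk, mul_left_comm c])
    (by
      rintro _ ⟨x, rfl⟩ _ ⟨y, rfl⟩
      have h1 := hc x y
      simp only [LinearMap.compl₁₂_apply] at h1
      simp [orth, hh.neg (k _) (i _), h1])
  refine one_ne_zero (hh.eq_zero_of_forall ha hi hinj (x := (1 : F)) fun y => ?_)
  have h1 : i 1 + k (c * 1) = 0 := by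
    rw [← Submodule.mem_bot (ZMod p), ← hbot]
    exact ⟨1, rfl⟩
  rw [eq_neg_of_add_eq_zero_left h1, map_neg, orth, neg_zero]

end IsAnisotropic

section CharacterField

variable {p : ℕ} [Fact p.Prime] {S : Type*} [Group S]

/-- The algebra `𝔽_p(χ)` is a field. -/
noncomputable abbrev chiFieldToField (χ : S →* (AlgebraicClosure (ZMod p))ˣ) :
    Field (chiField p χ) :=
  (Subalgebra.isField_of_algebraic (chiField p χ)).toField

lemma chiVal_ne_zero (χ : S →* (AlgebraicClosure (ZMod p))ˣ) (s : S) : chiVal p χ s ≠ 0 :=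
  fun h => (χ s).ne_zero (congrArg Subtype.val h)

lemma chiVal_pow (χ : S →* (AlgebraicClosure (ZMod p))ˣ) (s : S) (n : ℕ) :
    chiVal p χ (s ^ n) = chiVal p χ s ^ n :=
  Subtype.ext (by simp [chiVal])

lemma coe_aeval_chiVal (χ : S →* (AlgebraicClosure (ZMod p))ˣ) (s : S) (P : (ZMod p)[X]) :
    (aeval (chiVal p χ s) P : AlgebraicClosure (ZMod p)) =
      aeval (χ s : AlgebraicClosure (ZMod p)) P :=
  (aeval_algHom_apply (chiField p χ).val (chiVal p χ s) P).symm

/-- A Frobenius power as an equivariant embedding between conjugate character fields. -/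
lemma exists_frobenius_embedding {χ ψ : S →* (AlgebraicClosure (ZMod p))ˣ} {n : ℕ}
    (hχ : ∀ s, χ s = ψ s ^ p ^ n) :
    ∃ φ : chiField p ψ →ₗ[ZMod p] chiField p χ, Function.Injective φ ∧
      ∀ s x, φ (chiVal p ψ s * x) = chiVal p χ s * φ x := by
  let f : AlgebraicClosure (ZMod p) →ₐ[ZMod p] AlgebraicClosure (ZMod p) :=
    FiniteField.frobeniusAlgHom (ZMod p) _ ^ n
  have hf : ∀ x, f x = x ^ p ^ n := fun x => by
    simp [f, AlgHom.coe_pow, FiniteField.coe_frobeniusAlgHom, pow_iterate, ZMod.card]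
  have hle : chiField p ψ ≤ (chiField p χ).comap f := by
    refine Algebra.adjoin_le ?_
    rintro _ ⟨s, rfl⟩
    refine Algebra.subset_adjoin ⟨s, ?_⟩
    simp [hf, hχ]
  let φ : chiField p ψ →ₐ[ZMod p] chiField p χ :=
    (f.comp (chiField p ψ).val).codRestrict _ fun x => hle x.2
  refine ⟨φ.toLinearMap, fun x y hxy => ?_, fun s x => ?_⟩
  · exact Subtype.ext (f.injective (congrArg Subtype.val hxy))
  · refine (map_mul φ _ _).trans (congrArg (· * φ x) (Subtype.ext ?_))
    change f (ψ s) = χ s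
    simp [hf, hχ]

variable [Finite S] {g : S}

lemma chiField_eq_adjoin (hg : ∀ s, s ∈ Subgroup.zpowers g)
    (χ : S →* (AlgebraicClosure (ZMod p))ˣ) :
    chiField p χ = Algebra.adjoin (ZMod p) {(χ g : AlgebraicClosure (ZMod p))} := by
  apply le_antisymm
  · refine Algebra.adjoin_le ?_
    rintro _ ⟨s, rfl⟩
    obtain ⟨n, rfl⟩ := mem_powers_iff_mem_zpowers.mpr (hg s)
    simp only [map_pow, Units.val_pow_eq_pow_val]
    exact pow_mem (Algebra.self_mem_adjoin_singleton _ _) n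
  · exact Algebra.adjoin_mono (by simp)

lemma exists_aeval_chiVal (hg : ∀ s, s ∈ Subgroup.zpowers g)
    (χ : S →* (AlgebraicClosure (ZMod p))ˣ) (x : chiField p χ) :
    ∃ P : (ZMod p)[X], aeval (chiVal p χ g) P = x := by
  have hx := (chiField_eq_adjoin hg χ).le x.2
  rw [Algebra.adjoin_singleton_eq_range_aeval] at hx
  obtain ⟨P, hP⟩ := hx
  exact ⟨P, Subtype.ext ((coe_aeval_chiVal χ g P).trans hP)⟩

instance finite_chiField_s11 (χ : S →* (AlgebraicClosure (ZMod p))ˣ) :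
    Module.Finite (ZMod p) (chiField p χ) :=
  Algebra.finite_adjoin_of_finite_of_isIntegral (Set.finite_range _)
    fun x _ => Algebra.IsIntegral.isIntegral x

/-- Every nonzero space with an operator of order dividing `|S|` contains some `𝔽_p(χ)`. -/
lemma exists_chiField_embedding (hg : ∀ s, s ∈ Subgroup.zpowers g) {U : Type*} [AddCommGroup U]
    [Module (ZMod p) U] [FiniteDimensional (ZMod p) U] [Nontrivial U] {T : Module.End (ZMod p) U}
    (hT : T ^ Nat.card S = 1) :
    ∃ (χ : S →* (AlgebraicClosure (ZMod p))ˣ) (i : chiField p χ →ₗ[ZMod p] U),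
      Function.Injective i ∧ ∀ x, i (chiVal p χ g * x) = T (i x) := by
  have hTint : IsIntegral (ZMod p) T := Algebra.IsIntegral.isIntegral T
  obtain ⟨f, hf, q, hq⟩ := WfDvdMonoid.exists_irreducible_factor (minpoly.not_isUnit (ZMod p) T)
    (minpoly.ne_zero hTint)
  obtain ⟨w, hw0, hw⟩ : ∃ w, w ≠ 0 ∧ aeval T f w = 0 := by
    by_contra! hcon
    have hqT : aeval T q = 0 := by
      ext v
      by_contra hv
      refine hcon _ hv ?_
      have := minpoly.aeval (ZMod p) T
      rw [hq, map_mul] at this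
      exact LinearMap.congr_fun this v
    have hdvd := minpoly.dvd (ZMod p) T hqT
    have hq0 : q ≠ 0 := by
      rintro rfl
      exact minpoly.ne_zero hTint (by rw [hq, mul_zero])
    rw [hq] at hdvd
    nth_rewrite 2 [← one_mul q] at hdvd
    exact hf.not_isUnit (isUnit_of_dvd_one ((mul_dvd_mul_iff_right hq0).1 hdvd))
  obtain ⟨α, hα⟩ := IsAlgClosed.exists_aeval_eq_zero (AlgebraicClosure (ZMod p)) f
    (degree_pos_of_irreducible hf).ne'
  have hker : ∀ P : (ZMod p)[X], aeval α P = 0 → aeval T P w = 0 := by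
    intro P hP
    have h1 : f ∣ minpoly (ZMod p) α :=
      ((minpoly.irreducible (Algebra.IsIntegral.isIntegral α)).dvd_symm hf)
        (minpoly.dvd (ZMod p) α hα)
    obtain ⟨Q, rfl⟩ := h1.trans (minpoly.dvd (ZMod p) α hP)
    rw [mul_comm, map_mul, Module.End.mul_apply, hw, map_zero]
  have hαpow : α ^ Nat.card S = 1 := by
    have h1 : minpoly (ZMod p) T ∣ X ^ Nat.card S - 1 := minpoly.dvd _ _ (by simp [hT])
    obtain ⟨Q, hQ⟩ := (Dvd.intro _ hq.symm).trans h1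
    have h2 := congrArg (aeval α) hQ
    rw [map_mul, hα, zero_mul] at h2
    simpa [sub_eq_zero] using h2
  let β : (AlgebraicClosure (ZMod p))ˣ := Units.ofPowEqOne α _ hαpow Nat.card_pos.ne'
  have hβ : orderOf β ∣ orderOf g := by
    rw [orderOf_eq_card_of_forall_mem_zpowers hg, orderOf_dvd_iff_pow_eq_one]
    exact Units.pow_ofPowEqOne hαpow _
  let χ := monoidHomOfForallMemZpowers hg hβ
  have hχ : (χ g : AlgebraicClosure (ZMod p)) = α := by
    simp [χ, monoidHomOfForallMemZpowers_apply_gen, β]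
  let π : (ZMod p)[X] →ₗ[ZMod p] chiField p χ := (aeval (chiVal p χ g)).toLinearMap
  let ψ : (ZMod p)[X] →ₗ[ZMod p] U := (LinearMap.applyₗ w).comp (aeval T).toLinearMap
  obtain ⟨σ, hσ⟩ := LinearMap.exists_rightInverse_of_surjective π
    (LinearMap.range_eq_top.2 (exists_aeval_chiVal hg χ))
  have hψ : ∀ P, ψ (σ (π P)) = ψ P := by
    intro P
    rw [← sub_eq_zero, ← map_sub]
    refine hker _ ?_
    rw [← hχ, ← coe_aeval_chiVal]
    have : π (σ (π P) - P) = 0 := by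
      rw [map_sub, sub_eq_zero]
      exact LinearMap.congr_fun hσ (π P)
    exact congrArg Subtype.val this
  have hmul : ∀ x, ψ (σ (chiVal p χ g * x)) = T (ψ (σ x)) := by
    intro x
    obtain ⟨P, rfl⟩ := exists_aeval_chiVal hg χ x
    have h1 : chiVal p χ g * aeval (chiVal p χ g) P = π (X * P) := by simp [π]
    rw [h1, hψ, show aeval (chiVal p χ g) P = π P from rfl, hψ]
    simp [ψ]
  refine ⟨χ, ψ.comp σ, ?_, hmul⟩
  rw [← LinearMap.ker_eq_bot, LinearMap.ker_eq_bot']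
  intro x hx
  by_contra hx0
  obtain ⟨y, hy⟩ := (Subalgebra.isField_of_algebraic (chiField p χ)).mul_inv_cancel hx0
  obtain ⟨Q, rfl⟩ := exists_aeval_chiVal hg χ y
  have h1 := aeval_semiconj (T := Algebra.lmul (ZMod p) _ (chiVal p χ g)) (f := ψ.comp σ) hmul Q x
  rw [aeval_lmul_apply, mul_comm, hy, hx, map_zero] at h1
  have h2 : ψ (σ (π 1)) = 0 := by simpa [π] using h1
  rw [hψ] at h2
  exact hw0 (by simpa [ψ] using h2)

/-- Two orthogonal equivariant embeddings of `𝔽_p(χ)` contradict anisotropy. -/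
lemma IsAnisotropic.false_of_orthogonal_chiField (hg : ∀ s, s ∈ Subgroup.zpowers g) {U : Type*}
    [AddCommGroup U] [Module (ZMod p) U] {T : Module.End (ZMod p) U}
    {h : U →ₗ[ZMod p] U →ₗ[ZMod p] ZMod p} (hh : IsAnisotropic T h)
    {χ : S →* (AlgebraicClosure (ZMod p))ˣ} {i k : chiField p χ →ₗ[ZMod p] U}
    (hi : ∀ x, i (chiVal p χ g * x) = T (i x)) (hinj : Function.Injective i)
    (hk : ∀ x, k (chiVal p χ g * x) = T (k x)) (kinj : Function.Injective k)
    (orth : ∀ x y, h (i x) (k y) = 0) : False := by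
  let := chiFieldToField χ
  have : Finite (chiField p χ) := Module.finite_of_finite (ZMod p)
  exact hh.false_of_orthogonal (chiVal_ne_zero χ g) (exists_aeval_chiVal hg χ) hi hinj hk kinj orth

/-- A space with an anisotropic form is a sum of pairwise non-conjugate symplectic `𝔽_p(χ)`. -/
lemma IsAnisotropic.exists_decomposition (hg : ∀ s, s ∈ Subgroup.zpowers g) {U : Type*}
    [AddCommGroup U] [Module (ZMod p) U] [FiniteDimensional (ZMod p) U]
    {T : Module.End (ZMod p) U} (hT : T ^ Nat.card S = 1)
    {h : U →ₗ[ZMod p] U →ₗ[ZMod p] ZMod p} (hh : IsAnisotropic T h) :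
    ∃ (r : ℕ) (χ : Fin r → (S →* (AlgebraicClosure (ZMod p))ˣ)),
      (∀ j : Fin r,
        ∃ h : chiField p (χ j) →ₗ[ZMod p] chiField p (χ j) →ₗ[ZMod p] ZMod p,
          (∀ v, h v v = 0) ∧
          (∀ v, (∀ w, h v w = 0) → v = 0) ∧
          (∀ v w, h (chiVal p (χ j) g * v) (chiVal p (χ j) g * w) = h v w)) ∧
      (∀ i j : Fin r, i ≠ j → ∀ n : ℕ, ¬ (∀ s : S, χ i s = (χ j s) ^ (p ^ n))) ∧
      (∃ e : U ≃ₗ[ZMod p] ((j : Fin r) → chiField p (χ j)),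
        ∀ (u : U) (j : Fin r), e (T u) j = chiVal p (χ j) g * (e u j)) := by
  induction hn : Module.finrank (ZMod p) U using Nat.strong_induction_on generalizing U with
  | _ n ih =>
  rcases subsingleton_or_nontrivial U with hU | hU
  · exact ⟨0, Fin.elim0, fun j => j.elim0, fun j => j.elim0,
      { toFun := fun _ j => j.elim0
        invFun := fun _ => 0
        map_add' := fun _ _ => Subsingleton.elim _ _
        map_smul' := fun _ _ => Subsingleton.elim _ _
        left_inv := fun _ => Subsingleton.elim _ _
        right_inv := fun _ => Subsingleton.elim _ _ }, fun _ j => j.elim0⟩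
  obtain ⟨χ₀, i, hinj, hi⟩ := exists_chiField_embedding hg hT
  let := chiFieldToField χ₀
  have ha := chiVal_ne_zero χ₀ g
  let V := LinearMap.ker (h.comp i).flip
  have hV : ∀ v ∈ V, T v ∈ V := hh.orthogonal_stable ha hi
  have hiV : ∀ x, ∀ v : V, h (i x) v = 0 := fun x v => LinearMap.congr_fun v.2 x
  have hlt : Module.finrank (ZMod p) V < n := by
    rw [← hn]
    refine Submodule.finrank_lt fun htop => ?_
    refine one_ne_zero (hh.eq_zero_of_forall ha hi hinj (x := 1) fun y => ?_)
    exact hiV y ⟨i 1, htop ▸ Submodule.mem_top⟩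
  have hTV : T.restrict hV ^ Nat.card S = 1 := by
    rw [Module.End.pow_restrict]
    ext v
    simp [hT]
  obtain ⟨r, χ, hsymp, hconj, e, he⟩ := ih _ hlt hTV (hh.restrict hV) rfl
  let k (j : Fin r) : chiField p (χ j) →ₗ[ZMod p] U :=
    V.subtype ∘ₗ e.symm.toLinearMap ∘ₗ LinearMap.single (ZMod p) (fun j => chiField p (χ j)) j
  have kinj : ∀ j, Function.Injective (k j) := fun j =>
    V.injective_subtype.comp (e.symm.injective.comp
      (Pi.single_injective (M := fun j => chiField p (χ j)) j))
  have hk : ∀ j x, k j (chiVal p (χ j) g * x) = T (k j x) := by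
    intro j x
    have : e.symm (Pi.single j (chiVal p (χ j) g * x)) =
        T.restrict hV (e.symm (Pi.single j x)) := by
      rw [LinearEquiv.symm_apply_eq]
      ext1 l
      rw [he, LinearEquiv.apply_symm_apply]
      rcases eq_or_ne l j with rfl | hl
      · simp
      · simp [hl]
    exact congrArg Subtype.val this
  let E : (chiField p χ₀ × V) ≃ₗ[ZMod p] U :=
    LinearEquiv.ofBijective _ (hh.bijective_coprod ha hi hinj)
  have hE : ∀ x v, E (chiVal p χ₀ g * x, T.restrict hV v) = T (E (x, v)) := by
    intro x v
    change i (chiVal p χ₀ g * x) + T v = T (i x + v)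
    rw [hi, map_add]
  refine ⟨r + 1, Fin.cons χ₀ χ, ?_, ?_,
    E.symm.trans (((LinearEquiv.refl _ _).prodCongr e).trans
      (Fin.consLinearEquiv (ZMod p) fun j => chiField p ((Fin.cons χ₀ χ : Fin (r + 1) → _) j))), ?_⟩
  · refine Fin.cases ?_ hsymp
    refine ⟨h.compl₁₂ i i, fun v => hh.alt _, fun v hv => ?_,
      fun (v w : chiField p χ₀) => ?_⟩
    · refine hh.eq_zero_of_forall ha hi hinj fun y => ?_
      rw [hh.neg, neg_eq_zero]
      exact hv y
    · change h (i (chiVal p χ₀ g * v)) (i (chiVal p χ₀ g * w)) = h (i v) (i w)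
      rw [hi, hi, hh.inv]
  · intro l j
    refine Fin.cases ?_ (fun l => ?_) l <;> refine Fin.cases ?_ (fun j => ?_) j
    · exact fun hne => absurd rfl hne
    · intro _ n hχ
      obtain ⟨φ, φinj, hφ⟩ := exists_frobenius_embedding (χ := χ₀) (ψ := χ j) hχ
      exact hh.false_of_orthogonal_chiField hg (i := i ∘ₗ φ) (k := k j)
        (fun x => by rw [LinearMap.comp_apply, hφ, hi]; rfl) (hinj.comp φinj) (hk j) (kinj j)
        fun x y => hiV _ _
    · intro _ n hχ
      obtain ⟨φ, φinj, hφ⟩ := exists_frobenius_embedding (χ := χ l) (ψ := χ₀) hχ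
      exact hh.false_of_orthogonal_chiField hg (i := i) (k := k l ∘ₗ φ) hi hinj
        (fun x => by rw [LinearMap.comp_apply, hφ, hk]; rfl) ((kinj l).comp φinj)
        fun x y => hiV _ _
    · exact fun hne => hconj l j fun h => hne (congrArg Fin.succ h)
  · intro u j
    obtain ⟨⟨x, v⟩, rfl⟩ := E.surjective u
    rw [← hE]
    simp only [LinearEquiv.trans_apply, LinearEquiv.symm_apply_apply]
    refine Fin.cases ?_ (fun j => ?_) j
    · rfl
    · exact he v j

/-- On a sum of pairwise non-conjugate character fields the orthogonal sum of nondegenerate forms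
is anisotropic. -/
lemma eq_bot_of_isotropic_s11 (hg : ∀ s, s ∈ Subgroup.zpowers g) {U : Type*}
    [AddCommGroup U] [Module (ZMod p) U] {T : Module.End (ZMod p) U}
    {ι : Type*} [Fintype ι] [DecidableEq ι] {χ : ι → (S →* (AlgebraicClosure (ZMod p))ˣ)}
    (hconj : ∀ i j : ι, i ≠ j → ∀ n : ℕ, ¬ (∀ s : S, χ i s = (χ j s) ^ (p ^ n)))
    (e : U ≃ₗ[ZMod p] ((j : ι) → chiField p (χ j)))
    (he : ∀ u j, e (T u) j = chiVal p (χ j) g * e u j)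
    {h : (j : ι) → chiField p (χ j) →ₗ[ZMod p] chiField p (χ j) →ₗ[ZMod p] ZMod p}
    (hnd : ∀ j v, (∀ w, h j v w = 0) → v = 0)
    {W : Submodule (ZMod p) U} (hW : ∀ u ∈ W, T u ∈ W)
    (hiso : ∀ u ∈ W, ∀ w ∈ W, ∑ j, h j (e u j) (e w j) = 0) : W = ⊥ := by
  rw [Submodule.eq_bot_iff]
  intro u hu
  by_contra hu0
  obtain ⟨j, hj⟩ : ∃ j, e u j ≠ 0 := by
    by_contra! hcon
    exact hu0 (e.map_eq_zero_iff.1 (funext hcon))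
  let := chiFieldToField (χ j)
  have heP : ∀ (P : (ZMod p)[X]) u l, e (aeval T P u) l = aeval (chiVal p (χ l) g) P * e u l := by
    intro P u l
    rw [← aeval_lmul_apply]
    exact aeval_semiconj (T' := Algebra.lmul (ZMod p) _ (chiVal p (χ l) g))
      (f := LinearMap.proj l ∘ₗ e.toLinearMap) (fun x => he x l) P u
  have hWP : ∀ P : (ZMod p)[X], ∀ u ∈ W, aeval T P u ∈ W := by
    intro P u hu
    have := aeval_semiconj (T := T.restrict hW) (T' := T) (f := W.subtype) (fun _ => rfl) P ⟨u, hu⟩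
    rw [Submodule.subtype_apply, Submodule.subtype_apply] at this
    rw [← this]
    exact Subtype.prop _
  let Q : (ZMod p)[X] := ∏ l ∈ Finset.univ.erase j,
    minpoly (ZMod p) (χ l g : AlgebraicClosure (ZMod p))
  have hQl : ∀ l, l ≠ j → aeval (chiVal p (χ l) g) Q = 0 := by
    intro l hl
    refine Subtype.ext ?_
    rw [coe_aeval_chiVal, map_prod]
    exact Finset.prod_eq_zero (Finset.mem_erase.2 ⟨hl, Finset.mem_univ l⟩) (minpoly.aeval _ _)
  have hQj : aeval (chiVal p (χ j) g) Q ≠ 0 := by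
    intro h0
    have h1 := congrArg Subtype.val h0
    rw [coe_aeval_chiVal, map_prod] at h1
    obtain ⟨l, hl, hl0⟩ := Finset.prod_eq_zero_iff.1 h1
    obtain ⟨n, hn⟩ := exists_eq_pow_of_aeval_minpoly p hl0
    refine hconj j l (Finset.ne_of_mem_erase hl).symm n fun s => ?_
    obtain ⟨m, rfl⟩ := mem_powers_iff_mem_zpowers.mpr (hg s)
    have hn' : χ j g = χ l g ^ p ^ n := Units.ext (by simpa using hn)
    simp only [map_pow, hn', ← pow_mul, mul_comm]
  have hsingle : ∀ y, e.symm (Pi.single j y) ∈ W := by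
    intro y
    obtain ⟨R, hR⟩ := exists_aeval_chiVal hg (χ j)
      (y * (aeval (chiVal p (χ j) g) Q * e u j)⁻¹)
    convert hWP R _ (hWP Q u hu)
    rw [LinearEquiv.symm_apply_eq]
    ext1 l
    rw [heP, heP]
    rcases eq_or_ne l j with rfl | hl
    · rw [hR, inv_mul_cancel_right₀ (mul_ne_zero hQj hj), Pi.single_eq_same]
    · rw [hQl l hl, zero_mul, mul_zero, Pi.single_eq_of_ne hl]
  refine one_ne_zero (hnd j 1 fun w => ?_)
  have := hiso _ (hsingle 1) _ (hsingle w)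
  rw [Finset.sum_eq_single j (fun l _ hl => by simp [hl]) (by simp)] at this
  simpa using this

end CharacterField

/-- classification of the anisotropic symplectic representations
of a cyclic group `S` of order prime to `p` over `𝔽_p`. -/
theorem stmt_11 (p : ℕ) [Fact p.Prime] (S : Type*) [Group S] [Finite S]
    (hScyc : IsCyclic S) (hSord : ¬ p ∣ Nat.card S)
    (U : Type*) [AddCommGroup U] [Module (ZMod p) U] [FiniteDimensional (ZMod p) U]
    (ρ : Representation (ZMod p) S U) :
    -- U admits a nondegenerate S-invariant alternating form that is S-anisotropic
    (∃ h : U →ₗ[ZMod p] U →ₗ[ZMod p] ZMod p,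
      (∀ v, h v v = 0) ∧
      (∀ v, (∀ w, h v w = 0) → v = 0) ∧
      (∀ (s : S) (v w : U), h (ρ s v) (ρ s w) = h v w) ∧
      (∀ W : Submodule (ZMod p) U,
        (∀ s : S, ∀ u ∈ W, ρ s u ∈ W) → (∀ u ∈ W, ∀ w ∈ W, h u w = 0) → W = ⊥)) ↔
    -- iff U is a sum of pairwise non-conjugate symplectic 𝔽_p(χ_j)
    (∃ (r : ℕ) (χ : Fin r → (S →* (AlgebraicClosure (ZMod p))ˣ)),
      -- (a) each 𝔽_p(χ j) is symplectic
      (∀ j : Fin r,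
        ∃ h : chiField p (χ j) →ₗ[ZMod p] chiField p (χ j) →ₗ[ZMod p] ZMod p,
          (∀ v, h v v = 0) ∧
          (∀ v, (∀ w, h v w = 0) → v = 0) ∧
          (∀ (s : S) (v w : chiField p (χ j)),
            h (chiVal p (χ j) s * v) (chiVal p (χ j) s * w) = h v w)) ∧
      -- (b) the χ j are pairwise not Frobenius-conjugate
      (∀ i j : Fin r, i ≠ j → ∀ n : ℕ, ¬ (∀ s : S, χ i s = (χ j s) ^ (p ^ n))) ∧
      -- (c) U ≅ ⊕_j 𝔽_p(χ j) as 𝔽_p-representations of S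
      (∃ e : U ≃ₗ[ZMod p] ((j : Fin r) → chiField p (χ j)),
        ∀ (s : S) (u : U) (j : Fin r),
          e (ρ s u) j = chiVal p (χ j) s * (e u j))) := by
  obtain ⟨g, hg⟩ := IsCyclic.exists_generator (α := S)
  have hstable : ∀ W : Submodule (ZMod p) U, (∀ u ∈ W, ρ g u ∈ W) →
      ∀ s : S, ∀ u ∈ W, ρ s u ∈ W := by
    intro W hW s
    obtain ⟨n, rfl⟩ := mem_powers_iff_mem_zpowers.mpr (hg s)
    induction n with
    | zero => simp
    | succ n ih =>
      intro u hu
      simpa [pow_succ] using ih _ (hW u hu)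
  constructor
  · rintro ⟨h, halt, -, hinv, haniso⟩
    have hT : ρ g ^ Nat.card S = 1 := by rw [← map_pow, pow_card_eq_one', map_one]
    obtain ⟨r, χ, hsymp, hconj, e, he⟩ := IsAnisotropic.exists_decomposition hg hT
      ⟨halt, hinv g, fun W hW => haniso W (hstable W hW)⟩
    refine ⟨r, χ, fun j => ?_, hconj, e, fun s => ?_⟩
    · obtain ⟨b, hb, hb', hb''⟩ := hsymp j
      refine ⟨b, hb, hb', fun s => ?_⟩
      obtain ⟨n, rfl⟩ := mem_powers_iff_mem_zpowers.mpr (hg s)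
      simp only [chiVal_pow]
      induction n with
      | zero => simp
      | succ n ih => simpa only [pow_succ', mul_assoc, hb''] using ih
    · obtain ⟨n, rfl⟩ := mem_powers_iff_mem_zpowers.mpr (hg s)
      simp only [chiVal_pow, map_pow]
      induction n with
      | zero => simp
      | succ n ih =>
        intro u j
        rw [pow_succ', Module.End.mul_apply, he, ih, pow_succ', mul_assoc]
  · rintro ⟨r, χ, hsymp, hconj, e, he⟩
    choose b halt hnd hinv using hsymp
    let l (j : Fin r) : U →ₗ[ZMod p] chiField p (χ j) := LinearMap.proj j ∘ₗ e.toLinearMap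
    have hsum : ∀ u w, (∑ j, (b j).compl₁₂ (l j) (l j)) u w = ∑ j, b j (e u j) (e w j) := by
      intro u w
      simp [l, LinearMap.sum_apply]
    refine ⟨∑ j, (b j).compl₁₂ (l j) (l j), fun v => ?_, fun v hv => ?_, fun s v w => ?_,
      fun W hW hiso => ?_⟩
    · rw [hsum]
      exact Finset.sum_eq_zero fun j _ => halt j _
    · refine e.map_eq_zero_iff.1 (funext fun j => hnd j _ fun y => ?_)
      have := hv (e.symm (Pi.single j y))
      rw [hsum, Finset.sum_eq_single j (fun l _ hl => by simp [hl]) (by simp)] at this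
      simpa using this
    · simp only [hsum, he, hinv]
    · exact eq_bot_of_isotropic_s11 hg hconj e (he g) hnd (hW g) fun u hu w hw => by
        rw [← hsum]
        exact hiso u hu w hw
end

section
/- Let p be a prime, S a finite cyclic group of order prime to p, and U a nonzero finite-dimensional 𝔽_p-representation of S that is isotypic, i.e., isomorphic to a direct sum of copies of a single irreducible 𝔽_p-representation of S. If U carries a nondegenerate S-invariant alternating 𝔽_p-bilinear form that is S-anisotropic, then U is irreducible. -/
open MvPolynomial in
/-- A family of bilinear forms over a finite field that is small compared to the dimension has a
common nonzero isotropic vector. -/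
theorem exists_ne_zero_forall_bilin_self_eq_zero {K V ι : Type*} [Field K] [Finite K]
    [AddCommGroup V] [Module K V] [FiniteDimensional K V] [Fintype ι]
    (B : ι → V →ₗ[K] V →ₗ[K] K) (hcard : 2 * Fintype.card ι < Module.finrank K V) :
    ∃ v : V, v ≠ 0 ∧ ∀ i, B i v v = 0 := by
  classical
  have := Fintype.ofFinite K
  let b := Module.finBasis K V
  let f : ι → MvPolynomial (Fin (Module.finrank K V)) K := fun i =>
    ∑ j, ∑ k, C (B i (b j) (b k)) * (X j * X k)
  have hdeg (i : ι) : (f i).totalDegree ≤ 2 := by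
    refine totalDegree_finsetSum_le fun j _ => totalDegree_finsetSum_le fun k _ => ?_
    refine (totalDegree_mul _ _).trans ?_
    refine (Nat.add_le_add_left (totalDegree_mul _ _) _).trans ?_
    simp
  have heval (i : ι) (x : Fin (Module.finrank K V) → K) :
      eval x (f i) = B i (b.equivFun.symm x) (b.equivFun.symm x) := by
    simp only [f, map_sum, map_mul, eval_C, eval_X, Module.Basis.equivFun_symm_apply, map_smul,
      LinearMap.sum_apply, LinearMap.smul_apply, smul_eq_mul, Finset.mul_sum]
    rw [Finset.sum_comm]
    refine Finset.sum_congr rfl fun j _ => Finset.sum_congr rfl fun k _ => by ring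
  obtain ⟨q, hq⟩ := CharP.exists K
  have hdvd := char_dvd_card_solutions_of_fintype_sum_lt q (f := f) <| by
    calc ∑ i, (f i).totalDegree ≤ ∑ _i : ι, 2 := Finset.sum_le_sum fun i _ => hdeg i
      _ < _ := by simpa [mul_comm] using hcard
  have hq1 : 1 < q := ((CharP.char_is_prime_or_zero K q).resolve_right
    (CharP.char_ne_zero_of_finite K q)).one_lt
  have hzero : ∀ i, eval (0 : Fin (Module.finrank K V) → K) (f i) = 0 := fun i => by rw [heval]; simp
  have hpos := Fintype.card_pos_iff.2 ⟨(⟨0, hzero⟩ :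
    {x : Fin (Module.finrank K V) → K // ∀ i, eval x (f i) = 0})⟩
  obtain ⟨⟨x, hx⟩, hne⟩ := Fintype.exists_ne_of_one_lt_card
    (hq1.trans_le (Nat.le_of_dvd hpos hdvd)) ⟨0, hzero⟩
  refine ⟨b.equivFun.symm x, fun h => hne (Subtype.ext ?_), fun i => heval i x ▸ hx i⟩
  exact b.equivFun.symm.map_eq_zero_iff.1 h

/-- If a generator of `S` satisfies a monic polynomial of degree less than the dimension, then an
invariant alternating form over a finite field is not anisotropic. -/
theorem exists_invariant_isotropic_of_natDegree_lt {K S U : Type*} [Field K] [Finite K] [Group S]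
    [Finite S] [AddCommGroup U] [Module K U] [FiniteDimensional K U] (ρ : Representation K S U)
    {g : S} (hg : ∀ s, s ∈ Subgroup.zpowers g) (P : Polynomial K) (hP : P.Monic)
    (hPg : Polynomial.aeval (ρ g) P = 0) (hdeg : P.natDegree < Module.finrank K U)
    (h : U →ₗ[K] U →ₗ[K] K) (halt : ∀ v, h v v = 0)
    (hinv : ∀ s v w, h (ρ s v) (ρ s w) = h v w) :
    ∃ W : Submodule K U, (∀ s, ∀ u ∈ W, ρ s u ∈ W) ∧ (∀ u ∈ W, ∀ w ∈ W, h u w = 0) ∧ W ≠ ⊥ := by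
  set e := P.natDegree / 2 with he
  obtain ⟨v, hv, hv0⟩ := exists_ne_zero_forall_bilin_self_eq_zero
    (fun i : Fin e => h ∘ₗ ρ (g ^ (i + 1 : ℕ))) (by rw [Fintype.card_fin]; omega)
  have hadj (s : S) (x y : U) : h x (ρ s y) = h (ρ s⁻¹ x) y := by
    rw [← hinv s (ρ s⁻¹ x), ← Module.End.mul_apply, ← map_mul]; simp
  have hsmall (n : ℕ) (hn : n ≤ e) : h (ρ (g ^ n) v) v = 0 := by
    rcases n with _ | n
    · simpa using halt v
    · exact hv0 ⟨n, hn⟩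
  have hsmallneg (n : ℕ) (hn : n ≤ e) : h (ρ (g ^ n)⁻¹ v) v = 0 := by
    rw [← hadj, ← LinearMap.IsAlt.neg (B := h) halt, hsmall n hn, neg_zero]
  have hrec (s : S) : h (ρ (s * g ^ P.natDegree) v) v =
      -∑ j ∈ Finset.range P.natDegree, P.coeff j * h (ρ (s * g ^ j) v) v := by
    have hsum : ∑ j ∈ Finset.range (P.natDegree + 1), P.coeff j * h (ρ (s * g ^ j) v) v = 0 := by
      have := congrArg (fun f : Module.End K U => h (ρ s (f v)) v) hPg
      simpa [Polynomial.aeval_eq_sum_range, LinearMap.sum_apply] using this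
    rw [Finset.sum_range_succ, hP.coeff_natDegree, one_mul] at hsum
    exact eq_neg_of_add_eq_zero_right hsum
  have hshift (k : ℕ) : h (ρ ((g ^ e)⁻¹ * g ^ k) v) v = 0 := by
    induction k using Nat.strong_induction_on with
    | _ k ih =>
      by_cases hk : k < P.natDegree
      · rcases le_total k e with hke | hke
        · have := hsmallneg (e - k) (by omega)
          rwa [pow_sub _ hke, mul_inv_rev, inv_inv, (Commute.refl g).pow_pow k e |>.inv_right.eq]
            at this
        · have := hsmall (k - e) (by omega)
          rwa [pow_sub _ hke, ((Commute.refl g).pow_pow k e).inv_right.eq] at this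
      · obtain ⟨m, rfl⟩ := Nat.exists_eq_add_of_le' (not_lt.1 hk)
        rw [pow_add, ← mul_assoc, hrec, neg_eq_zero]
        refine Finset.sum_eq_zero fun j hj => ?_
        rw [mul_assoc, ← pow_add, ih _ (by have := Finset.mem_range.1 hj; omega), mul_zero]
  have hall (s : S) : h (ρ s v) v = 0 := by
    obtain ⟨k, hk : g ^ k = g ^ e * s⟩ :=
      (isOfFinOrder_of_finite g).mem_powers_iff_mem_zpowers.2 (hg (g ^ e * s))
    have := hshift k
    rwa [hk, inv_mul_cancel_left] at this
  refine ⟨Submodule.span K (Set.range fun s => ρ s v), fun s u hu => ?_, fun u hu w hw => ?_,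
    fun hbot => hv ?_⟩
  · induction hu using Submodule.span_induction with
    | mem x hx =>
      obtain ⟨t, rfl⟩ := hx
      exact Submodule.subset_span ⟨s * t, by simp⟩
    | zero => simp
    | add x y _ _ hx hy => rw [map_add]; exact add_mem hx hy
    | smul a x _ hx => rw [map_smul]; exact Submodule.smul_mem _ a hx
  · induction hu, hw using Submodule.span_induction₂ with
    | mem_mem x y hx hy =>
      obtain ⟨s, rfl⟩ := hx
      obtain ⟨t, rfl⟩ := hy
      rw [hadj, ← Module.End.mul_apply, ← map_mul, hall]
    | zero_left y hy => simp
    | zero_right x hx => simp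
    | add_left x y z _ _ _ h1 h2 => simp [h1, h2]
    | add_right x y z _ _ _ h1 h2 => simp [h1, h2]
    | smul_left r x y _ _ h1 => simp [h1]
    | smul_right r x y _ _ h1 => simp [h1]
  · exact (Submodule.mem_bot K).1 (hbot ▸ Submodule.subset_span ⟨1, by simp⟩)


/-- a nonzero isotypic `𝔽_p`-representation of `S` carrying a
nondegenerate `S`-invariant alternating anisotropic form is irreducible. -/
theorem stmt_12 (p : ℕ) [Fact p.Prime] (S : Type*) [Group S] [Finite S]
    (hScyc : IsCyclic S) (hSord : ¬ p ∣ Nat.card S)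
    (U : Type*) [AddCommGroup U] [Module (ZMod p) U] [FiniteDimensional (ZMod p) U]
    [Nontrivial U]
    (ρ : Representation (ZMod p) S U)
    -- U is isotypic: a direct sum of copies of a single irreducible representation
    (hiso : ∃ (n : ℕ) (W : Submodule (MonoidAlgebra (ZMod p) S) ρ.asModule),
      IsSimpleModule (MonoidAlgebra (ZMod p) S) W ∧
      Nonempty (ρ.asModule ≃ₗ[MonoidAlgebra (ZMod p) S] (Fin n → W)))
    -- U carries a nondegenerate S-invariant alternating S-anisotropic form
    (h : U →ₗ[ZMod p] U →ₗ[ZMod p] ZMod p)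
    (halt : ∀ v : U, h v v = 0)
    (hnd : ∀ v : U, (∀ w : U, h v w = 0) → v = 0)
    (hinv : ∀ (s : S) (v w : U), h (ρ s v) (ρ s w) = h v w)
    (haniso : ∀ W : Submodule (ZMod p) U,
      (∀ s : S, ∀ u ∈ W, ρ s u ∈ W) → (∀ u ∈ W, ∀ w ∈ W, h u w = 0) → W = ⊥) :
    -- then U is irreducible
    IsSimpleModule (MonoidAlgebra (ZMod p) S) ρ.asModule := by
  obtain ⟨n, W, hW, ⟨φ⟩⟩ := hiso
  let ψ : U ≃ₗ[ZMod p] (Fin n → W) := ρ.asModuleEquiv.symm.trans (φ.restrictScalars (ZMod p))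
  obtain ⟨g, hg⟩ := hScyc.exists_generator
  have : FiniteDimensional (ZMod p) ρ.asModule := Module.Finite.equiv ρ.asModuleEquiv.symm
  have : FiniteDimensional (ZMod p) W :=
    inferInstanceAs (FiniteDimensional (ZMod p) (W.restrictScalars (ZMod p)))
  have := IsSimpleModule.nontrivial (MonoidAlgebra (ZMod p) S) W
  have hdim : Module.finrank (ZMod p) U = n * Module.finrank (ZMod p) W := by
    rw [ψ.finrank_eq, Module.finrank_pi_fintype]; simp
  have hWpos : 0 < Module.finrank (ZMod p) W := Module.finrank_pos
  have hUpos : 0 < Module.finrank (ZMod p) U := Module.finrank_pos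
  rcases n with _ | _ | n
  · omega
  · exact IsSimpleModule.congr (φ.trans (LinearEquiv.funUnique (Fin 1) _ W))
  exfalso
  let a : MonoidAlgebra (ZMod p) S := MonoidAlgebra.of (ZMod p) S g
  let T : Module.End (ZMod p) W := Algebra.lsmul (ZMod p) (ZMod p) W a
  have hann (u : ρ.asModule) : Polynomial.aeval a T.charpoly • u = 0 := by
    apply φ.injective
    ext1 i
    have := LinearMap.congr_fun (LinearMap.aeval_self_charpoly T) (φ u i)
    rw [show T = Algebra.lsmul (ZMod p) (ZMod p) W a from rfl, Polynomial.aeval_algHom_apply] at this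
    simpa using this
  have hPg : Polynomial.aeval (ρ g) T.charpoly = 0 := by
    rw [show ρ g = ρ.asAlgebraHom a by simp [a], Polynomial.aeval_algHom_apply]
    ext u
    simpa using congrArg ρ.asModuleEquiv (hann (ρ.asModuleEquiv.symm u))
  obtain ⟨V, hVinv, hViso, hV⟩ := exists_invariant_isotropic_of_natDegree_lt ρ hg T.charpoly
    T.charpoly_monic hPg (by rw [T.charpoly_natDegree, hdim]; nlinarith) h halt hinv
  exact hV (haniso V hVinv hViso)
end
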